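/- Let π ∈ ℤ[ρ] be a primary prime with p = π·π̄. Then the cubic Gauss sum satisfies G₃(π) = −χ_π(3)·π̃²·π̃̄, where π̃̄ denotes the complex conjugate of the canonical cubic root π̃ of π. (This is equivalent to the Cassels–Matthews formula.) -/

import Mathlib

open Complex BigOperators

noncomputable section

/-- `ρ = e^{2πi/3}`, a primitive cube root of unity. -/
def ρ3 : ℂ := Complex.exp (2 * Real.pi * Complex.I / 3)

/-- The ring of Eisenstein integers `ℤ[ρ]`, realized as a subring of `ℂ`. -/
def O3 : Subring ℂ := Subring.closure {ρ3}

/-- `√−3 = i·√3`. -/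
def sqrtm3 : ℂ := Complex.I * (Real.sqrt 3 : ℝ)

/-- The congruence `a ≡ b (mod c)` in `ℤ[ρ]`. -/
def ECong (a b c : ℂ) : Prop := ∃ d ∈ O3, a - b = c * d

/-- `a` and `b` are coprime in `ℤ[ρ]`. -/
def ECoprime (a b : ℂ) : Prop := ∃ u ∈ O3, ∃ v ∈ O3, u * a + v * b = 1

/-- The real period `ϖ₁ = ∫₀¹ (1−x³)^{−2/3} dx`. -/
def varpi1 : ℝ := ∫ x in (0:ℝ)..(1:ℝ), (1 - x ^ 3) ^ (-(2:ℝ)/3)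

/-- The points of the period lattice `ϖ₁·ℤ[ρ]`. -/
def ω3 (m : ℤ × ℤ) : ℂ := (varpi1 : ℂ) * ((m.1 : ℂ) + (m.2 : ℂ) * ρ3)

/-- The Weierstrass `℘`-function of the period lattice `ϖ₁·ℤ[ρ]`
(so that `℘′² = 4℘³ − 27`). -/
def wp3 (u : ℂ) : ℂ :=
  (u ^ 2)⁻¹ + ∑' m : ℤ × ℤ, if m = 0 then 0 else (((u - ω3 m) ^ 2)⁻¹ - ((ω3 m) ^ 2)⁻¹)

/-- The derivative `℘′` of the Weierstrass `℘`-function of `ϖ₁·ℤ[ρ]`. -/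
def wp3' (u : ℂ) : ℂ := ∑' m : ℤ × ℤ, (-2) * ((u - ω3 m) ^ 3)⁻¹

/-- The Weierstrass `ζ`-function of the period lattice `ϖ₁·ℤ[ρ]`. -/
def wzeta3 (u : ℂ) : ℂ :=
  u⁻¹ + ∑' m : ℤ × ℤ, if m = 0 then 0 else ((u - ω3 m)⁻¹ + (ω3 m)⁻¹ + u * ((ω3 m) ^ 2)⁻¹)

/-- The non-analytic doubly periodic function `Z(u) = ζ(ϖ₁u) − (2π/(√3·ϖ₁))·ū`. -/
def Z3 (u : ℂ) : ℂ :=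
  wzeta3 ((varpi1 : ℂ) * u) -
    ((2 * Real.pi / (Real.sqrt 3 * varpi1) : ℝ) : ℂ) * (starRingEnd ℂ) u

/-- The elliptic function `φ(u) = 6℘(ϖ₁u)/(9+℘′(ϖ₁u))` of period lattice `ℤ[ρ]`. -/
def phi3 (u : ℂ) : ℂ := 6 * wp3 ((varpi1 : ℂ) * u) / (9 + wp3' ((varpi1 : ℂ) * u))

/-- The elliptic function `ψ(u) = (9−℘′(ϖ₁u))/(9+℘′(ϖ₁u))` of period lattice `ℤ[ρ]`. -/
def psi3 (u : ℂ) : ℂ := (9 - wp3' ((varpi1 : ℂ) * u)) / (9 + wp3' ((varpi1 : ℂ) * u))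

/-- A residue class character modulo `β` on `ℤ[ρ]`. -/
structure IsResChar3 (β : ℂ) (χ : ℂ → ℂ) : Prop where
  periodic : ∀ a ∈ O3, ∀ b ∈ O3, ECong a b β → χ a = χ b
  map_mul : ∀ a ∈ O3, ∀ b ∈ O3, χ (a * b) = χ a * χ b
  map_one : χ 1 = 1
  vanish : ∀ a ∈ O3, ¬ ECoprime a β → χ a = 0

/-- The cubic residue character `χ_π = (·/π)₃` modulo a prime `π` with `p = π·π̄`:
`χ_π(ν)³ = 1` and `χ_π(ν) ≡ ν^{(p−1)/3} (mod π)`. -/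
structure IsCubicChar (π : ℂ) (p : ℕ) (χ : ℂ → ℂ) : Prop where
  resChar : IsResChar3 π χ
  cube : ∀ ν ∈ O3, ECoprime ν π → χ ν ^ 3 = 1
  euler : ∀ ν ∈ O3, ECoprime ν π → ECong (χ ν) (ν ^ ((p - 1) / 3)) π

/-- The elliptic Gauss sum `G_π(χ, f) = (1/3)·Σ_{ν ∈ (ℤ[ρ]/(π))^×} χ(ν)·f(ν/π)`,
computed via the integer representatives `1, …, p−1` of `(ℤ[ρ]/(π))^× ≅ (ℤ/p)^×`. -/
def EGS3 (p : ℕ) (χ f : ℂ → ℂ) (π : ℂ) : ℂ :=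
  (1/3 : ℂ) * ∑ r ∈ Finset.Icc 1 (p - 1), χ (r : ℂ) * f ((r : ℂ) / π)

/-- `S` is a third set of `(ℤ[ρ]/(π))^×`, i.e. `(ℤ[ρ]/(π))^× = S ∪ ρS ∪ ρ̄S`. -/
def IsThirdSet (π : ℂ) (S : Finset ℂ) : Prop :=
  (∀ ν ∈ S, ν ∈ O3 ∧ ECoprime ν π) ∧
  (∀ a ∈ O3, ECoprime a π →
    ∃ ν ∈ S, ∃ ε ∈ ({1, ρ3, ρ3 ^ 2} : Set ℂ), ECong a (ε * ν) π) ∧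
  (∀ ν ∈ S, ∀ μ ∈ S, ∀ ε ∈ ({1, ρ3, ρ3 ^ 2} : Set ℂ), ∀ ε' ∈ ({1, ρ3, ρ3 ^ 2} : Set ℂ),
    ECong (ε * ν) (ε' * μ) π → ν = μ ∧ ε = ε')

/-- `γ(S)` is the cube root of unity with `γ(S) ≡ −∏_{ν∈S} ν (mod π)`. -/
def IsGamma3 (π : ℂ) (S : Finset ℂ) (γ : ℂ) : Prop :=
  γ ^ 3 = 1 ∧ ECong γ (-(∏ ν ∈ S, ν)) π

/-- `L` is the value at `s = 1` of the analytic continuation of the Hecke `L`-series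
`L(s, χ̃) = Σ_𝔞 χ̃(𝔞)·N𝔞^{−s} = (1/6)·Σ_{ν ∈ ℤ[ρ]} χ₁(ν)·ν̄·|ν|^{−2s}` attached to the
weight-one Hecke character `χ̃((ν)) = χ₁(ν)·ν̄` of `ℚ(ρ)`. -/
def IsLValue3 (χ₁ : ℂ → ℂ) (L : ℂ) : Prop :=
  ∃ F : ℂ → ℂ, DifferentiableOn ℂ F {s : ℂ | 0 < s.re} ∧
    (∀ s : ℂ, 3/2 < s.re →
      F s = (1/6 : ℂ) *
        ∑' ν : O3, χ₁ (ν : ℂ) * (starRingEnd ℂ) (ν : ℂ) *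
          ((Complex.normSq (ν : ℂ) : ℂ) ^ (-s))) ∧
    F 1 = L

/-- `T` is a complete residue system modulo `β` in `ℤ[ρ]`. -/
def IsCRS3 (β : ℂ) (T : Finset ℂ) : Prop :=
  (∀ a ∈ T, a ∈ O3) ∧ (∀ a ∈ T, ∀ b ∈ T, ECong a b β → a = b) ∧
  (∀ z ∈ O3, ∃ a ∈ T, ECong z a β)

/-- `e^{2πi·S(z)}` where `S(a + b·ρ̄) = a`, i.e. `2πi·S(z) = (2π/√3)·(zρ − z̄ρ̄)`. -/
def eS3 (z : ℂ) : ℂ :=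
  Complex.exp (((2 * Real.pi / Real.sqrt 3 : ℝ) : ℂ) *
    (z * ρ3 - (starRingEnd ℂ) z * (starRingEnd ℂ) ρ3))

/-- `χ₀`: the character mod `3` giving the natural isomorphism `(ℤ[ρ]/(3))^× ≅ W`,
i.e. `χ₀(ν) = ε` for `ν ≡ ε (mod 3)`, `ε ∈ W = {±1, ±ρ, ±ρ̄}`. -/
def IsChi0₃ (χ₀ : ℂ → ℂ) : Prop :=
  IsResChar3 3 χ₀ ∧ ∀ ε ∈ ({1, -1, ρ3, -ρ3, ρ3 ^ 2, -ρ3 ^ 2} : Set ℂ), χ₀ ε = ε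

/-- `χ₀′`: the character mod `√−3` giving `(ℤ[ρ]/(√−3))^× ≅ {±1}`,
i.e. `χ₀′(ν) = δ` for `ν ≡ δ (mod √−3)`, `δ ∈ {±1}`. -/
def IsChi0'₃ (χ₀' : ℂ → ℂ) : Prop :=
  IsResChar3 sqrtm3 χ₀' ∧ χ₀' (-1) = -1

/-- The classical cubic (Kummer) Gauss sum `G₃(π) = Σ_{r=1}^{p−1} (r/π)₃·e^{2πir/p}`. -/
def G3sum (p : ℕ) (χ : ℂ → ℂ) : ℂ :=
  ∑ r ∈ Finset.Icc 1 (p - 1), χ (r : ℂ) * Complex.exp (2 * Real.pi * Complex.I * (r : ℂ) / (p : ℂ))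


open Filter Topology

open Polynomial in
theorem det_mul_eval_eq {F : Type*} [Field F] {n : ℕ} (v c : Fin n → F) (P : ℕ → F[X])
    (hP : ∀ j, (P j).natDegree ≤ j) :
    (Matrix.of fun i j : Fin n => c i * (P j).eval (v i)).det =
      (∏ i, c i) * (∏ j : Fin n, (P j).coeff j) * (Matrix.vandermonde v).det := by
  have h : (Matrix.of fun i j : Fin n => c i * (P j).eval (v i)) =
      Matrix.diagonal c * Matrix.vandermonde v *
        Matrix.of fun k j : Fin n => (P j).coeff k := by
    ext i j
    rw [Matrix.mul_assoc, Matrix.diagonal_mul, Matrix.mul_apply]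
    simp only [Matrix.of_apply, Matrix.vandermonde_apply]
    rw [eval_eq_sum_range' (n := n) (lt_of_le_of_lt (hP j) j.2),
      ← Fin.sum_univ_eq_sum_range (fun k => (P j).coeff k * v i ^ k)]
    congr 1
    exact Finset.sum_congr rfl fun k _ => mul_comm _ _
  have hU : (Matrix.of fun k j : Fin n => (P j).coeff k).det =
      ∏ j : Fin n, (P j).coeff j := by
    rw [Matrix.det_of_isUpperTriangular]
    · rfl
    · intro i j hij
      exact coeff_eq_zero_of_natDegree_lt (lt_of_le_of_lt (hP j) hij)
  rw [h, Matrix.det_mul, Matrix.det_mul, Matrix.det_diagonal, hU]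
  ring

open Polynomial in
theorem exists_polynomial_of_recurrence {F : Type*} [Field F] (α β γ : ℕ → F) (N : ℕ)
    (hα : ∀ i < N, α i ≠ 0) :
    ∃ P : ℕ → F[X], ∀ j ≤ N, (P j).natDegree ≤ j ∧ (P j).coeff j = ∏ i ∈ Finset.range j, (α i)⁻¹ ∧
      ∀ (v : F) (a : ℕ → F), α 0 * a 1 = (v + β 0) * a 0 →
        (∀ i, i + 1 < N → α (i + 1) * a (i + 2) = (v + β (i + 1)) * a (i + 1) + γ i * a i) →
        a j = a 0 * (P j).eval v := by
  have key : ∀ j, ∃ P : F[X], j ≤ N → P.natDegree ≤ j ∧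
      P.coeff j = ∏ i ∈ Finset.range j, (α i)⁻¹ ∧
      ∀ (v : F) (a : ℕ → F), α 0 * a 1 = (v + β 0) * a 0 →
        (∀ i, i + 1 < N → α (i + 1) * a (i + 2) = (v + β (i + 1)) * a (i + 1) + γ i * a i) →
        a j = a 0 * P.eval v := by
    intro j
    induction j using Nat.strong_induction_on with
    | _ j ih =>
      match j with
      | 0 => exact ⟨1, fun _ => by simp⟩
      | 1 =>
        refine ⟨C (α 0)⁻¹ * (X + C (β 0)), fun h1 => ⟨?_, ?_, ?_⟩⟩
        · exact (natDegree_C_mul_le _ _).trans (natDegree_X_add_C _).le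
        · simp [coeff_X]
        · intro v a h0 _
          have := hα 0 h1
          simp
          field_simp
          linear_combination h0
      | k + 2 =>
        obtain ⟨P, hP⟩ := ih (k + 1) (by omega)
        obtain ⟨Q, hQ⟩ := ih k (by omega)
        refine ⟨C (α (k + 1))⁻¹ * ((X + C (β (k + 1))) * P + C (γ k) * Q), fun hk => ?_⟩
        obtain ⟨hP1, hP2, hP3⟩ := hP (by omega)
        obtain ⟨hQ1, hQ2, hQ3⟩ := hQ (by omega)
        refine ⟨?_, ?_, ?_⟩
        · refine (natDegree_C_mul_le _ _).trans (natDegree_add_le_of_degree_le (n := k + 2) ?_ ?_)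
          · refine natDegree_mul_le.trans ?_
            rw [natDegree_X_add_C]; omega
          · exact (natDegree_C_mul_le _ _).trans (by omega)
        · rw [coeff_C_mul, coeff_add, add_mul, coeff_add, coeff_X_mul, coeff_C_mul, coeff_C_mul,
            coeff_eq_zero_of_natDegree_lt (p := P) (n := k + 2) (lt_of_le_of_lt hP1 (by omega)),
            coeff_eq_zero_of_natDegree_lt (p := Q) (n := k + 2) (lt_of_le_of_lt hQ1 (by omega)), hP2,
            Finset.prod_range_succ _ (k + 1)]
          ring
        · intro v a h0 h1
          have hne := hα (k + 1) (by omega)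
          have e := h1 k (by omega)
          rw [hP3 v a h0 h1, hQ3 v a h0 h1] at e
          simp only [eval_mul, eval_add, eval_C, eval_X]
          field_simp
          linear_combination e
  choose P hP using key
  exact ⟨P, hP⟩

theorem sign_revPerm_eq (n : ℕ) :
    Equiv.Perm.sign (Fin.revPerm : Equiv.Perm (Fin n)) = ∏ j : Fin n, (-1) ^ (j : ℕ) := by
  rw [Equiv.Perm.sign_eq_prod_prod_Iio]
  refine Finset.prod_congr rfl fun j _ => ?_
  rw [Finset.prod_congr rfl (g := fun _ => (-1 : ℤˣ)), Finset.prod_const, Fin.card_Iio]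
  intro i hi
  rw [Finset.mem_Iio] at hi
  rw [if_neg]
  simpa using hi.le

/-- The product formula for the solutions of the three-term recurrence attached to the
derivation `x ↦ y², y ↦ x²` on the Fermat cubic in characteristic `p = 3n + 1`. -/
theorem prod_mul_prod_eq_prod_sq {F : Type*} [Field F] (p n : ℕ) [Fact p.Prime] [CharP F p]
    (hpn : p = 3 * n + 1) (hn : Even n) (e : Fin n → F)
    (he : Function.Injective fun r => e r ^ 3) (he0 : ∀ r, e r ≠ 0) (a b c : Fin n → ℕ → F)
    (hab : ∀ r j, e r * a r j = (3 * j + 1) * b r j)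
    (hbc0 : ∀ r, e r * b r 0 = 2 * c r 0)
    (hbc : ∀ r j, e r * b r (j + 1) = (3 * j + 5) * c r (j + 1) - (3 * j + 3) * c r j)
    (hca : ∀ r j, e r * c r j = (3 * j + 3) * a r (j + 1) - (3 * j + 2) * a r j)
    (ha : ∀ r, a r n = 0) (hb : ∀ r, b r n = -1) (hc : ∀ r, c r n = 0) :
    (∏ r, a r 0) * ∏ j ∈ Finset.range n, ((3 * (j : F) + 1) * (3 * j + 2)) = ∏ r, e r ^ 2 := by
  have hp := Fact.out (p := p.Prime)
  have hp0 : (3 * n + 1 : F) = 0 := by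
    have := CharP.cast_eq_zero F p
    rw [hpn] at this; exact_mod_cast this
  have hcast : ∀ k : ℕ, 0 < k → k < p → (k : F) ≠ 0 := fun k h0 hk h =>
    absurd (Nat.le_of_dvd h0 ((CharP.cast_eq_zero_iff F p k).1 h)) (by omega)
  obtain ⟨m, rfl⟩ : ∃ m, n = m + 1 := by
    cases n with
    | zero => exact absurd hp (by rw [hpn]; decide)
    | succ m => exact ⟨m, rfl⟩
  have hm : 0 < m := by
    rcases hn with ⟨k, hk⟩; omega
  have h2 : (2 : F) ≠ 0 := by exact_mod_cast hcast 2 (by omega) (by omega)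
  -- ascending recurrence
  obtain ⟨P, hP⟩ := exists_polynomial_of_recurrence (F := F)
    (fun i => (3 * i + 1) * (3 * i + 2) * (3 * i + 3))
    (fun i => 2 * (3 * i + 1) ^ 3 + 2 * (3 * i + 1))
    (fun i => -((3 * i + 4) * (3 * i + 3) * (3 * i + 2))) m (fun i hi => by
      refine mul_ne_zero (mul_ne_zero ?_ ?_) ?_
      · exact_mod_cast hcast (3 * i + 1) (by omega) (by omega)
      · exact_mod_cast hcast (3 * i + 2) (by omega) (by omega)
      · exact_mod_cast hcast (3 * i + 3) (by omega) (by omega))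
  obtain ⟨Q, hQ⟩ := exists_polynomial_of_recurrence (F := F)
    (fun i => -((3 * i + 3) * (3 * i + 4) * (3 * i + 5)))
    (fun i => -(2 * (3 * i + 3) ^ 3 + 2 * (3 * i + 3)))
    (fun i => (3 * i + 6) * (3 * i + 5) * (3 * i + 4)) m (fun i hi => by
      refine neg_ne_zero.2 (mul_ne_zero (mul_ne_zero ?_ ?_) ?_)
      · exact_mod_cast hcast (3 * i + 3) (by omega) (by omega)
      · exact_mod_cast hcast (3 * i + 4) (by omega) (by omega)
      · exact_mod_cast hcast (3 * i + 5) (by omega) (by omega))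
  have rec0 : ∀ r, e r ^ 3 * a r 0 = 6 * a r 1 - 4 * a r 0 := fun r => by
    have h1 := hab r 0
    have h3 := hca r 0
    have h2' := hbc0 r
    push_cast at h1 h3
    linear_combination e r ^ 2 * h1 + e r * h2' + 2 * h3
  have hrec : ∀ r j, e r ^ 3 * a r (j + 1) =
      (3 * j + 4) * (3 * j + 5) * (3 * j + 6) * a r (j + 2)
        - (2 * (3 * j + 4) ^ 3 + 2 * (3 * j + 4)) * a r (j + 1)
        + (3 * j + 4) * (3 * j + 3) * (3 * j + 2) * a r j := fun r j => by
    have h1 := hab r (j + 1)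
    have h3 := hca r j
    have h4 := hca r (j + 1)
    have h2' := hbc r j
    push_cast at h1 h3 h4
    linear_combination e r ^ 2 * h1 + e r * (3 * j + 4) * h2' +
      (3 * j + 4) * (3 * j + 5) * h4 - (3 * j + 4) * (3 * j + 3) * h3
  have up : ∀ r, ∀ j ≤ m, a r j = a r 0 * (P j).eval (e r ^ 3) := fun r j hj => by
    refine (hP j hj).2.2 (e r ^ 3) (a r) ?_ ?_
    · have := rec0 r
      push_cast
      linear_combination -this
    · intro i _
      have := hrec r i
      push_cast
      linear_combination -this
  have hend : ∀ r, a r m = -(e r ^ 2) / 2 := fun r => by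
    have h1 := hca r m
    have h3 := hbc r m
    rw [hb, hc] at h3
    rw [ha] at h1
    push_cast at hp0
    field_simp
    have h3' : c r m = - e r := by linear_combination -h3 + hp0 * c r m
    rw [h3'] at h1
    linear_combination -h1 + hp0 * a r m
  have down : ∀ r, ∀ j ≤ m, a r (m - j) = a r m * (Q j).eval (e r ^ 3) := fun r j hj => by
    have := (hQ j hj).2.2 (e r ^ 3) (fun j => a r (m - j)) ?_ ?_
    · simpa using this
    · obtain ⟨k, rfl⟩ : ∃ k, m = k + 1 := ⟨m - 1, by omega⟩
      have h := hrec r k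
      rw [ha r] at h
      simp only [Nat.sub_zero, Nat.add_sub_cancel]
      push_cast at hp0 ⊢
      have hk : (3 * k : F) = -7 := by linear_combination hp0
      rw [hk] at h
      linear_combination -h
    · intro i hi
      obtain ⟨k, rfl⟩ : ∃ k, m = k + i + 2 := ⟨m - i - 2, by omega⟩
      have h := hrec r k
      have e1 : k + i + 2 - (i + 2) = k := by omega
      have e2 : k + i + 2 - (i + 1) = k + 1 := by omega
      have e3 : k + i + 2 - i = k + 2 := by omega
      simp only [e1, e2, e3]
      push_cast at hp0 ⊢
      have hk : (3 * k : F) = -(3 * i + 10) := by linear_combination hp0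
      rw [hk] at h
      linear_combination -h
  set v : Fin (m + 1) → F := fun r => e r ^ 3 with hv
  have hV : (Matrix.vandermonde v).det ≠ 0 := Matrix.det_vandermonde_ne_zero_iff.2 he
  -- truncate the polynomial families beyond `m`
  have detUp : (Matrix.of fun r j : Fin (m + 1) => a r j).det =
      (∏ r, a r 0) * (∏ j : Fin (m + 1), ∏ i ∈ Finset.range j,
        ((3 * (i : F) + 1) * (3 * i + 2) * (3 * i + 3))⁻¹) * (Matrix.vandermonde v).det := by
    have := det_mul_eval_eq v (fun r => a r 0) (fun j => if j ≤ m then P j else 0) (fun j => by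
      split_ifs with h
      · exact (hP j h).1
      · simp)
    rw [← Finset.prod_congr rfl (fun (j : Fin (m + 1)) _ => (hP j (by omega)).2.1)]
    convert this using 4 with j
    · ext j; simp [up _ j (by omega : (j : ℕ) ≤ m), show (j : ℕ) ≤ m by omega, hv]
    · rename_i j _
      simp [show (j : ℕ) ≤ m by omega]
  have detDown : (Matrix.of fun r j : Fin (m + 1) => a r (m - j)).det =
      (∏ r, a r m) * (∏ j : Fin (m + 1), ∏ i ∈ Finset.range j,
        (-((3 * (i : F) + 3) * (3 * i + 4) * (3 * i + 5)))⁻¹) * (Matrix.vandermonde v).det := by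
    have := det_mul_eval_eq v (fun r => a r m) (fun j => if j ≤ m then Q j else 0) (fun j => by
      split_ifs with h
      · exact (hQ j h).1
      · simp)
    rw [← Finset.prod_congr rfl (fun (j : Fin (m + 1)) _ => (hQ j (by omega)).2.1)]
    convert this using 4 with j
    · ext j; simp [down _ j (by omega : (j : ℕ) ≤ m), show (j : ℕ) ≤ m by omega, hv]
    · rename_i j _
      simp [show (j : ℕ) ≤ m by omega]
  have hperm : (Matrix.of fun r j : Fin (m + 1) => a r (m - j)).det =
      (∏ j : Fin (m + 1), (-1) ^ (j : ℕ)) * (Matrix.of fun r j : Fin (m + 1) => a r j).det := by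
    have := Matrix.det_permute' (Fin.revPerm : Equiv.Perm (Fin (m + 1)))
      (Matrix.of fun r j : Fin (m + 1) => a r j)
    rw [sign_revPerm_eq] at this
    push_cast at this
    rw [← this]
    congr 1
    ext r j
    simp only [Matrix.of_apply, Matrix.submatrix_apply, id, Fin.revPerm_apply, Fin.val_rev]
    congr 1
    omega
  rw [detUp, detDown] at hperm
  have hfin := mul_right_cancel₀ hV (hperm.trans (mul_assoc _ _ _).symm)
  have tel : ∀ j, j ≤ m → (∏ i ∈ Finset.range j, ((3 * (i : F) + 1) * (3 * i + 2) * (3 * i + 3))⁻¹) * 2 =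
      (∏ i ∈ Finset.range j, (((3 * (i : F) + 3) * (3 * i + 4) * (3 * i + 5)))⁻¹) *
        ((3 * (j : F) + 1) * (3 * j + 2)) := by
    intro j hj
    induction j with
    | zero => simp
    | succ k ih =>
      rw [Finset.prod_range_succ, Finset.prod_range_succ]
      have i1 : (3 * (k : F) + 1) ≠ 0 := by exact_mod_cast hcast (3 * k + 1) (by omega) (by omega)
      have i2 : (3 * (k : F) + 2) ≠ 0 := by exact_mod_cast hcast (3 * k + 2) (by omega) (by omega)
      have i3 : (3 * (k : F) + 3) ≠ 0 := by exact_mod_cast hcast (3 * k + 3) (by omega) (by omega)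
      have i4 : (3 * (k : F) + 4) ≠ 0 := by exact_mod_cast hcast (3 * k + 4) (by omega) (by omega)
      have i5 : (3 * (k : F) + 5) ≠ 0 := by exact_mod_cast hcast (3 * k + 5) (by omega) (by omega)
      have := ih (by omega)
      generalize (∏ i ∈ Finset.range k, ((3 * (i : F) + 1) * (3 * i + 2) * (3 * i + 3))⁻¹) = A at *
      generalize (∏ i ∈ Finset.range k, ((3 * (i : F) + 3) * (3 * i + 4) * (3 * i + 5))⁻¹) = B at *
      push_cast
      rw [mul_right_comm, this]
      field_simp
      ring
  have hnonz : (∏ j : Fin (m + 1), ∏ i ∈ Finset.range j,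
      ((3 * (i : F) + 3) * (3 * i + 4) * (3 * i + 5))⁻¹) ≠ 0 := by
    refine Finset.prod_ne_zero_iff.2 fun j _ => Finset.prod_ne_zero_iff.2 fun k hk => ?_
    have hk' := Finset.mem_range.1 hk
    have hj := j.2
    refine inv_ne_zero (mul_ne_zero (mul_ne_zero ?_ ?_) ?_)
    · exact_mod_cast hcast (3 * k + 3) (by omega) (by omega)
    · exact_mod_cast hcast (3 * k + 4) (by omega) (by omega)
    · exact_mod_cast hcast (3 * k + 5) (by omega) (by omega)
  have hs : (∏ j : Fin (m + 1), ∏ i ∈ Finset.range j,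
        (-((3 * (i : F) + 3) * (3 * i + 4) * (3 * i + 5)))⁻¹) =
      (∏ j : Fin (m + 1), (-1 : F) ^ (j : ℕ)) * (∏ j : Fin (m + 1), ∏ i ∈ Finset.range j,
      ((3 * (i : F) + 3) * (3 * i + 4) * (3 * i + 5))⁻¹) := by
    rw [← Finset.prod_mul_distrib]
    refine Finset.prod_congr rfl fun j _ => ?_
    rw [Finset.prod_congr rfl fun i _ => inv_neg, Finset.prod_neg, Finset.card_range]
  have hε : (∏ j : Fin (m + 1), (-1 : F) ^ (j : ℕ)) ≠ 0 :=
    Finset.prod_ne_zero_iff.2 fun j _ => pow_ne_zero _ (neg_ne_zero.2 one_ne_zero)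
  have htel : (∏ j : Fin (m + 1), ∏ i ∈ Finset.range j,
        ((3 * (i : F) + 1) * (3 * i + 2) * (3 * i + 3))⁻¹) * 2 ^ (m + 1) =
      (∏ j : Fin (m + 1), ∏ i ∈ Finset.range j,
      ((3 * (i : F) + 3) * (3 * i + 4) * (3 * i + 5))⁻¹) *
        ∏ j ∈ Finset.range (m + 1), ((3 * (j : F) + 1) * (3 * j + 2)) := by
    rw [← Fin.prod_univ_eq_prod_range (fun j => ((3 * (j : F) + 1) * (3 * j + 2))) (m + 1),
      ← Finset.prod_mul_distrib]
    have h2p : (2 : F) ^ (m + 1) = ∏ _j : Fin (m + 1), 2 := by simp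
    rw [h2p, ← Finset.prod_mul_distrib]
    exact Finset.prod_congr rfl fun j _ => tel j (by omega)
  have hlast : (∏ r, a r m) * 2 ^ (m + 1) = ∏ r, e r ^ 2 := by
    have h2p : (2 : F) ^ (m + 1) = ∏ _j : Fin (m + 1), 2 := by simp
    rw [h2p, ← Finset.prod_mul_distrib]
    rw [Finset.prod_congr rfl (g := fun r => - e r ^ 2)
      (fun r _ => by rw [hend r]; field_simp), Finset.prod_neg]
    simp [hn.neg_one_pow]
  rw [hs] at hfin
  generalize (∏ j : Fin (m + 1), (-1 : F) ^ (j : ℕ)) = ε at *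
  generalize (∏ j : Fin (m + 1), ∏ i ∈ Finset.range j,
      ((3 * (i : F) + 3) * (3 * i + 4) * (3 * i + 5))⁻¹) = B at *
  generalize (∏ j : Fin (m + 1), ∏ i ∈ Finset.range j,
        ((3 * (i : F) + 1) * (3 * i + 2) * (3 * i + 3))⁻¹) = A at *
  refine mul_left_cancel₀ (mul_ne_zero hε hnonz) ?_
  rw [← hlast]
  linear_combination -2 ^ (m + 1) * hfin - ε * (∏ r, a r 0) * htel

section Resid

variable {K : Type*} [Field K] (A : ValuationSubring K)

/-- Reduction of an element of a field to the residue field of a valuation subring,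
extended by `0` outside the subring. -/
noncomputable def resid (z : K) : IsLocalRing.ResidueField A :=
  open Classical in if h : z ∈ A then IsLocalRing.residue A ⟨z, h⟩ else 0

variable {A}

theorem resid_of_mem {z : K} (h : z ∈ A) : resid A z = IsLocalRing.residue A ⟨z, h⟩ := by
  simp [resid, h]

theorem resid_add {a b : K} (ha : a ∈ A) (hb : b ∈ A) :
    resid A (a + b) = resid A a + resid A b := by
  rw [resid_of_mem ha, resid_of_mem hb, resid_of_mem (add_mem ha hb), ← map_add]; rfl

theorem resid_mul {a b : K} (ha : a ∈ A) (hb : b ∈ A) :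
    resid A (a * b) = resid A a * resid A b := by
  rw [resid_of_mem ha, resid_of_mem hb, resid_of_mem (mul_mem ha hb), ← map_mul]; rfl

theorem resid_neg {a : K} (ha : a ∈ A) : resid A (-a) = -resid A a := by
  rw [resid_of_mem ha, resid_of_mem (neg_mem ha), ← map_neg]; rfl

theorem resid_sub {a b : K} (ha : a ∈ A) (hb : b ∈ A) :
    resid A (a - b) = resid A a - resid A b := by
  rw [resid_of_mem ha, resid_of_mem hb, resid_of_mem (sub_mem ha hb), ← map_sub]; rfl

theorem resid_one : resid A 1 = 1 := by
  rw [resid_of_mem (one_mem A), ← map_one (IsLocalRing.residue A)]; rfl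

theorem resid_natCast (n : ℕ) : resid A (n : K) = n := by
  rw [resid_of_mem (natCast_mem A n), ← map_natCast (IsLocalRing.residue A)]; rfl

theorem resid_intCast (n : ℤ) : resid A (n : K) = n := by
  rw [resid_of_mem (intCast_mem A n), ← map_intCast (IsLocalRing.residue A)]; rfl

theorem resid_zero : resid A 0 = 0 := by
  have := resid_natCast (A := A) 0
  push_cast at this; exact this

theorem resid_pow {a : K} (ha : a ∈ A) (n : ℕ) : resid A (a ^ n) = resid A a ^ n := by
  induction n with
  | zero => simp [resid_one]
  | succ n ih => rw [pow_succ, resid_mul (pow_mem ha n) ha, ih, pow_succ]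

theorem resid_sum {ι : Type*} (s : Finset ι) (f : ι → K) (h : ∀ i ∈ s, f i ∈ A) :
    resid A (∑ i ∈ s, f i) = ∑ i ∈ s, resid A (f i) := by
  classical
  induction s using Finset.induction_on with
  | empty => simp [resid_zero]
  | insert i s hi ih =>
    rw [Finset.sum_insert hi, Finset.sum_insert hi, resid_add (h _ (Finset.mem_insert_self _ _))
      (sum_mem fun j hj => h _ (Finset.mem_insert_of_mem hj)),
      ih fun j hj => h _ (Finset.mem_insert_of_mem hj)]

theorem resid_prod {ι : Type*} (s : Finset ι) (f : ι → K) (h : ∀ i ∈ s, f i ∈ A) :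
    resid A (∏ i ∈ s, f i) = ∏ i ∈ s, resid A (f i) := by
  classical
  induction s using Finset.induction_on with
  | empty => simp [resid_one]
  | insert i s hi ih =>
    rw [Finset.prod_insert hi, Finset.prod_insert hi, resid_mul (h _ (Finset.mem_insert_self _ _))
      (prod_mem fun j hj => h _ (Finset.mem_insert_of_mem hj)),
      ih fun j hj => h _ (Finset.mem_insert_of_mem hj)]

theorem resid_eq_zero_iff {a : K} (ha : a ∈ A) : resid A a = 0 ↔ A.valuation a < 1 := by
  rw [resid_of_mem ha, IsLocalRing.residue_eq_zero_iff, A.valuation_lt_one_iff]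

theorem mem_of_valuation_lt_one {a : K} (ha : A.valuation a < 1) : a ∈ A :=
  (A.valuation_le_one_iff a).1 ha.le

theorem resid_eq_zero {a : K} (ha : A.valuation a < 1) : resid A a = 0 :=
  (resid_eq_zero_iff (mem_of_valuation_lt_one ha)).2 ha

theorem resid_ne_zero_iff {a : K} (ha : a ∈ A) : resid A a ≠ 0 ↔ A.valuation a = 1 := by
  rw [Ne, resid_eq_zero_iff ha, not_lt]
  exact ⟨fun h => le_antisymm ((A.valuation_le_one_iff a).2 ha) h, fun h => h.ge⟩

theorem resid_eq_iff {a b : K} (ha : a ∈ A) (hb : b ∈ A) :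
    resid A a = resid A b ↔ A.valuation (a - b) < 1 := by
  rw [← resid_eq_zero_iff (sub_mem ha hb), resid_sub ha hb, sub_eq_zero]

theorem mem_of_valuation_eq_one {a : K} (ha : A.valuation a = 1) : a ∈ A :=
  (A.valuation_le_one_iff a).1 ha.le

theorem inv_mem_of_valuation_eq_one {a : K} (ha : A.valuation a = 1) : a⁻¹ ∈ A :=
  (A.valuation_le_one_iff _).1 (by simp [ha])

theorem resid_inv {a : K} (ha : A.valuation a = 1) : resid A a⁻¹ = (resid A a)⁻¹ := by
  have h0 : a ≠ 0 := by rintro rfl; simp at ha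
  refine eq_inv_of_mul_eq_one_left ?_
  rw [← resid_mul (inv_mem_of_valuation_eq_one ha) (mem_of_valuation_eq_one ha),
    inv_mul_cancel₀ h0, resid_one]

theorem charP_residueField {p : ℕ} (hp : p.Prime) (h : A.valuation (p : K) < 1) :
    CharP (IsLocalRing.ResidueField A) p := by
  have : (p : IsLocalRing.ResidueField A) = 0 := by rw [← resid_natCast, resid_eq_zero h]
  have h1 := ringChar.dvd this
  rcases (Nat.dvd_prime hp).1 h1 with h2 | h2
  · exact absurd h2 CharP.ringChar_ne_one
  · rw [← h2]; infer_instance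

theorem div_mem_of_valuation_le {a b : K} (h : A.valuation a ≤ A.valuation b) :
    a / b ∈ A := by
  rw [← A.valuation_le_one_iff, map_div₀]
  exact div_le_one_of_le₀ h zero_le

end Resid

section Fermat

variable {K : Type*} [Field K]

/-- A cyclic group of order dividing `p` on the Fermat cubic `x³ - y³ = 1`, with neutral
element `(0, -1)`. -/
structure FermatGroup (p : ℕ) (x y : ℕ → K) : Prop where
  curve : ∀ s, x s ^ 3 - y s ^ 3 = 1
  x_zero : x 0 = 0
  y_zero : y 0 = -1
  x_period : ∀ s, x (s + p) = x s
  y_period : ∀ s, y (s + p) = y s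
  x_add : ∀ r s, x (r + s) * (1 - x r ^ 3 * x s ^ 3) =
    x r * y s ^ 2 + x s * y r ^ 2 - x r ^ 2 * x s ^ 2 * y r * y s
  y_add : ∀ r s, y (r + s) * (1 - x r ^ 3 * x s ^ 3) =
    -(y r * y s) + x r ^ 2 * x s * y s ^ 2 + x r * x s ^ 2 * y r ^ 2

namespace FermatGroup

variable {p : ℕ} {x y : ℕ → K} (h : FermatGroup p x y) {A : ValuationSubring K}
include h

theorem x_add_mul (s k : ℕ) : x (s + p * k) = x s := by
  induction k with
  | zero => simp
  | succ k ih => rw [mul_add, mul_one, ← add_assoc, h.x_period, ih]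

theorem y_add_mul (s k : ℕ) : y (s + p * k) = y s := by
  induction k with
  | zero => simp
  | succ k ih => rw [mul_add, mul_one, ← add_assoc, h.y_period, ih]

theorem x_congr {r s : ℕ} (hrs : r ≡ s [MOD p]) : x r = x s := by
  rw [← Nat.mod_add_div r p, ← Nat.mod_add_div s p, h.x_add_mul, h.x_add_mul, hrs]

theorem y_congr {r s : ℕ} (hrs : r ≡ s [MOD p]) : y r = y s := by
  rw [← Nat.mod_add_div r p, ← Nat.mod_add_div s p, h.y_add_mul, h.y_add_mul, hrs]

theorem y_mem {s : ℕ} (hx : x s ∈ A) : y s ∈ A := by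
  have : y s ^ 3 ∈ A := by
    rw [show y s ^ 3 = x s ^ 3 - 1 by linear_combination -h.curve s]
    exact sub_mem (pow_mem hx 3) (one_mem A)
  rw [← A.valuation_le_one_iff] at this ⊢
  rw [map_pow] at this
  exact (pow_le_one_iff_of_nonneg zero_le (by norm_num)).1 this

end FermatGroup

namespace FermatGroup

variable {p : ℕ} {x y : ℕ → K} {A : ValuationSubring K}

theorem valuation_one_sub {a : K} (ha : A.valuation a < 1) : A.valuation (1 - a) = 1 := by
  rw [Valuation.map_sub_eq_of_lt_left, map_one]; rwa [map_one]

theorem add_step (h : FermatGroup p x y) {r s : ℕ} (hr : A.valuation (x r) < 1) (hs : A.valuation (x s) < 1) :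
    A.valuation (x (r + s)) < 1 ∧ resid A (y (r + s)) = -(resid A (y r) * resid A (y s)) := by
  have mr := mem_of_valuation_lt_one hr
  have ms := mem_of_valuation_lt_one hs
  have yr := h.y_mem mr
  have ys := h.y_mem ms
  have rr := resid_eq_zero hr
  have rs := resid_eq_zero hs
  have hD : A.valuation (1 - x r ^ 3 * x s ^ 3) = 1 := by
    refine valuation_one_sub ?_
    refine (resid_eq_zero_iff (mul_mem (pow_mem mr 3) (pow_mem ms 3))).1 ?_
    rw [resid_mul (pow_mem mr 3) (pow_mem ms 3), resid_pow mr, rr]; simp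
  have hN : A.valuation (x (r + s)) < 1 := by
    have e := congrArg A.valuation (h.x_add r s)
    rw [map_mul, hD, mul_one] at e
    rw [e]
    refine Valuation.map_sub_lt _ (Valuation.map_add_lt _ ?_ ?_) ?_
    · refine (resid_eq_zero_iff (mul_mem mr (pow_mem ys 2))).1 ?_
      rw [resid_mul mr (pow_mem ys 2), rr, zero_mul]
    · refine (resid_eq_zero_iff (mul_mem ms (pow_mem yr 2))).1 ?_
      rw [resid_mul ms (pow_mem yr 2), rs, zero_mul]
    · have : x r ^ 2 * x s ^ 2 * y r * y s = x r * (x r * x s ^ 2 * y r * y s) := by ring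
      have m' : x r * x s ^ 2 * y r * y s ∈ A :=
        mul_mem (mul_mem (mul_mem mr (pow_mem ms 2)) yr) ys
      rw [this]
      refine (resid_eq_zero_iff (mul_mem mr m')).1 ?_
      rw [resid_mul mr m', rr, zero_mul]
  refine ⟨hN, ?_⟩
  have e := congrArg (resid A) (h.y_add r s)
  have myrs := h.y_mem (mem_of_valuation_lt_one hN)
  have mD := mem_of_valuation_eq_one hD
  have m1 : x r ^ 3 * x s ^ 3 ∈ A := mul_mem (pow_mem mr 3) (pow_mem ms 3)
  have m2 : x r ^ 2 * x s * y s ^ 2 ∈ A := mul_mem (mul_mem (pow_mem mr 2) ms) (pow_mem ys 2)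
  have m3 : x r * x s ^ 2 * y r ^ 2 ∈ A := mul_mem (mul_mem mr (pow_mem ms 2)) (pow_mem yr 2)
  have m4 : y r * y s ∈ A := mul_mem yr ys
  rw [resid_mul myrs mD, resid_sub (one_mem A) m1, resid_one,
    resid_mul (pow_mem mr 3) (pow_mem ms 3), resid_pow mr, rr,
    resid_add (add_mem (neg_mem m4) m2) m3, resid_add (neg_mem m4) m2, resid_neg m4,
    resid_mul yr ys, resid_mul (mul_mem (pow_mem mr 2) ms) (pow_mem ys 2),
    resid_mul (pow_mem mr 2) ms, rs, resid_mul (mul_mem mr (pow_mem ms 2)) (pow_mem yr 2),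
    resid_mul mr (pow_mem ms 2), rr] at e
  simpa using e

theorem all_small (h : FermatGroup p x y) (hp : p.Prime) (hp3 : p % 3 = 1) {s : ℕ} (hs : ¬ p ∣ s)
    (hxs : A.valuation (x s) < 1) (r : ℕ) :
    A.valuation (x r) < 1 ∧ resid A (y r) = -1 := by
  set c := resid A (y s) with hc
  have key : ∀ k, A.valuation (x (k * s)) < 1 ∧ resid A (y (k * s)) = -(-c) ^ k := by
    intro k
    induction k with
    | zero =>
      simp only [zero_mul, h.x_zero, h.y_zero, pow_zero, map_zero]
      exact ⟨zero_lt_one, by rw [resid_neg (one_mem A), resid_one]⟩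
    | succ k ih =>
      have := h.add_step ih.1 hxs
      rw [add_mul, one_mul]
      refine ⟨this.1, ?_⟩
      rw [this.2, ih.2, ← hc, pow_succ]; ring
  have mx := mem_of_valuation_lt_one hxs
  have hc3 : (-c) ^ 3 = 1 := by
    have e := congrArg (resid A) (h.curve s)
    rw [resid_sub (pow_mem mx 3) (pow_mem (h.y_mem mx) 3), resid_pow mx,
      resid_pow (h.y_mem mx), resid_eq_zero hxs, resid_one] at e
    rw [← hc] at e
    linear_combination e
  have hcc : -c = 1 := by
    have e := (key p).2
    have e0 : y (p * s) = y 0 := by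
      have := h.y_add_mul 0 s
      rwa [zero_add] at this
    rw [e0, h.y_zero, resid_neg (one_mem A), resid_one, ← Nat.mod_add_div p 3, hp3, pow_add,
      pow_mul, hc3] at e
    simp at e
    linear_combination e
  obtain ⟨k, hk⟩ : ∃ k, k * s ≡ r [MOD p] := by
    have hco : Nat.Coprime s p := ((Nat.Prime.coprime_iff_not_dvd hp).2 hs).symm
    obtain ⟨m, -, hm⟩ := Nat.exists_mul_mod_eq_one_of_coprime hco hp.one_lt
    refine ⟨r * m, ?_⟩
    have : s * m ≡ 1 [MOD p] := by
      rw [Nat.ModEq, hm, Nat.mod_eq_of_lt hp.one_lt]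
    calc r * m * s = r * (s * m) := by ring
      _ ≡ r * 1 [MOD p] := Nat.ModEq.mul_left r this
      _ = r := mul_one r
  rw [← h.x_congr hk, ← h.y_congr hk]
  refine ⟨(key k).1, ?_⟩
  rw [(key k).2, hcc, one_pow]

end FermatGroup

end Fermat

section

variable {K : Type*} [Field K]

/-- A cyclic group of `p`-torsion points of the Fermat cubic lying in the kernel of
reduction modulo the maximal ideal of a valuation subring of residue characteristic `p`. -/
structure FermatKernel (A : ValuationSubring K) (p : ℕ) (x y : ℕ → K) : Prop
    extends FermatGroup p x y where
  prime : p.Prime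
  mod_three : p % 3 = 1
  p_small : A.valuation (p : K) < 1
  x_small : ∀ s, A.valuation (x s) < 1
  y_resid : ∀ s, resid A (y s) = -1
  x_one_ne : x 1 ≠ 0

namespace FermatKernel

variable {A : ValuationSubring K} {p : ℕ} {x y : ℕ → K} (h : FermatKernel A p x y)
include h

theorem charP : CharP (IsLocalRing.ResidueField A) p := charP_residueField h.prime h.p_small

theorem resid_natCast_ne_zero {k : ℕ} (h0 : 0 < k) (hk : k < p) :
    (k : IsLocalRing.ResidueField A) ≠ 0 := fun e =>
  haveI := h.charP
  absurd (Nat.le_of_dvd h0 ((CharP.cast_eq_zero_iff _ p k).1 e)) (by omega)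

theorem seven_le : 7 ≤ p := by
  have h1 := h.mod_three
  have h2 := h.prime.two_le
  by_contra hlt
  interval_cases p <;> first | omega | exact absurd h.prime (by decide)

theorem x_mem (s : ℕ) : x s ∈ A := mem_of_valuation_lt_one (h.x_small s)

theorem y_mem' (s : ℕ) : y s ∈ A := h.y_mem (h.x_mem s)

theorem valuation_t_ne : A.valuation (x 1) ≠ 0 := (Valuation.ne_zero_iff _).2 h.x_one_ne

theorem valuation_one_add {g : K} (hg : g ∈ A) : A.valuation (1 + x 1 ^ 3 * g) = 1 := by
  rw [show 1 + x 1 ^ 3 * g = 1 - x 1 * (-(x 1 ^ 2 * g)) by ring]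
  refine FermatGroup.valuation_one_sub ?_
  have m : -(x 1 ^ 2 * g) ∈ A := neg_mem (mul_mem (pow_mem (h.x_mem 1) 2) hg)
  refine (resid_eq_zero_iff (mul_mem (h.x_mem 1) m)).1 ?_
  rw [resid_mul (h.x_mem 1) m, resid_eq_zero (h.x_small 1), zero_mul]

theorem one_add_ne_zero {g : K} (hg : g ∈ A) : 1 + x 1 ^ 3 * g ≠ 0 := by
  intro e
  have := h.valuation_one_add hg
  rw [e, map_zero] at this
  exact zero_ne_one this

theorem inv_mem {g : K} (hg : g ∈ A) : (1 + x 1 ^ 3 * g)⁻¹ ∈ A :=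
  inv_mem_of_valuation_eq_one (h.valuation_one_add hg)

theorem resid_one_add {g : K} (hg : g ∈ A) : resid A (1 + x 1 ^ 3 * g) = 1 := by
  rw [resid_add (one_mem A) (mul_mem (pow_mem (h.x_mem 1) 3) hg), resid_one,
    resid_mul (pow_mem (h.x_mem 1) 3) hg, resid_pow (h.x_mem 1), resid_eq_zero (h.x_small 1)]
  simp

theorem exists_y_one : ∃ η ∈ A, y 1 = -1 + x 1 ^ 3 * η := by
  have hy := h.y_mem' 1
  set w := y 1 ^ 2 - y 1 + 1 with hw
  have hwm : w ∈ A := add_mem (sub_mem (pow_mem hy 2) hy) (one_mem A)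
  have hr : resid A w = 3 := by
    rw [hw, resid_add (sub_mem (pow_mem hy 2) hy) (one_mem A), resid_sub (pow_mem hy 2) hy,
      resid_pow hy, h.y_resid, resid_one]
    norm_num
  have h7 := h.seven_le
  have h3 : resid A w ≠ 0 := by
    rw [hr]; exact_mod_cast h.resid_natCast_ne_zero (k := 3) (by norm_num) (by omega)
  have hv := (resid_ne_zero_iff hwm).1 h3
  have hw0 : w ≠ 0 := by rintro e; rw [e] at hv; simp at hv
  refine ⟨w⁻¹, inv_mem_of_valuation_eq_one hv, ?_⟩
  have hc := h.curve 1
  field_simp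
  rw [hw]
  linear_combination -hc

theorem exists_x_eq (s : ℕ) : ∃ u ∈ A, x s = x 1 * u ∧ resid A u = s := by
  induction s with
  | zero => exact ⟨0, zero_mem A, by simp [h.x_zero], by simp [resid_zero]⟩
  | succ s ih =>
    obtain ⟨u, hu, hxu, hru⟩ := ih
    have hx := h.x_mem s
    have hy := h.y_mem' s
    have hy1 := h.y_mem' 1
    have ht := h.x_mem 1
    have mD : -(x s ^ 3) ∈ A := neg_mem (pow_mem hx 3)
    have hD := h.inv_mem mD
    have hD0 := h.one_add_ne_zero mD
    have m1 : u * y 1 ^ 2 ∈ A := mul_mem hu (pow_mem hy1 2)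
    have m2 : y s ^ 2 ∈ A := pow_mem hy 2
    have m4 : x 1 ^ 2 * u ^ 2 * y s * y 1 ∈ A :=
      mul_mem (mul_mem (mul_mem (pow_mem ht 2) (pow_mem hu 2)) hy) hy1
    have m3 : x 1 * (x 1 ^ 2 * u ^ 2 * y s * y 1) ∈ A := mul_mem ht m4
    refine ⟨(u * y 1 ^ 2 + y s ^ 2 - x 1 * (x 1 ^ 2 * u ^ 2 * y s * y 1)) *
      (1 + x 1 ^ 3 * -(x s ^ 3))⁻¹, mul_mem (sub_mem (add_mem m1 m2) m3) hD, ?_, ?_⟩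
    · have := h.x_add s 1
      rw [← div_eq_mul_inv, ← mul_div_assoc, eq_div_iff hD0]
      rw [show 1 + x 1 ^ 3 * -(x s ^ 3) = 1 - x s ^ 3 * x 1 ^ 3 by ring, this, hxu]
      ring
    · rw [resid_mul (sub_mem (add_mem m1 m2) m3) hD, resid_inv (h.valuation_one_add mD),
        h.resid_one_add mD, resid_sub (add_mem m1 m2) m3, resid_add m1 m2, resid_mul ht m4,
        resid_eq_zero (h.x_small 1), resid_mul hu (pow_mem hy1 2), resid_pow hy1, resid_pow hy,
        h.y_resid, h.y_resid, hru]
      push_cast; ring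

end FermatKernel

/-- The ring of functions on the group generated by the coordinates and by inverses of
functions congruent to `1` modulo `t³`. -/
inductive ShiftAlg (A : ValuationSubring K) (t : K) (x y : ℕ → K) : (ℕ → K) → Prop
  | const (a : K) (ha : a ∈ A) : ShiftAlg A t x y fun _ => a
  | coord_x : ShiftAlg A t x y x
  | coord_y : ShiftAlg A t x y y
  | add (f g : ℕ → K) : ShiftAlg A t x y f → ShiftAlg A t x y g → ShiftAlg A t x y (f + g)
  | mul (f g : ℕ → K) : ShiftAlg A t x y f → ShiftAlg A t x y g → ShiftAlg A t x y (f * g)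
  | inv (g : ℕ → K) : ShiftAlg A t x y g → ShiftAlg A t x y fun s => (1 + t ^ 3 * g s)⁻¹

namespace ShiftAlg

variable {A : ValuationSubring K} {t : K} {x y f g : ℕ → K}

theorem neg (hf : ShiftAlg A t x y f) : ShiftAlg A t x y (-f) := by
  have := (ShiftAlg.const (t := t) (x := x) (y := y) (-1) (neg_mem (one_mem A))).mul _ _ hf
  convert this using 1
  ext s; simp

theorem sub (hf : ShiftAlg A t x y f) (hg : ShiftAlg A t x y g) : ShiftAlg A t x y (f - g) := by
  rw [sub_eq_add_neg]; exact hf.add _ _ hg.neg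

theorem smul {a : K} (ha : a ∈ A) (hf : ShiftAlg A t x y f) : ShiftAlg A t x y (a • f) := by
  have := (ShiftAlg.const (t := t) (x := x) (y := y) a ha).mul _ _ hf
  exact this

theorem pow (hf : ShiftAlg A t x y f) (n : ℕ) : ShiftAlg A t x y (f ^ n) := by
  induction n with
  | zero => rw [pow_zero]; exact ShiftAlg.const 1 (one_mem A)
  | succ n ih => rw [pow_succ]; exact ih.mul _ _ hf

end ShiftAlg

/-- `g` is the first-order difference quotient of `f` in the parameter `t`. -/
def HasShift (A : ValuationSubring K) (t : K) (x y f g : ℕ → K) : Prop :=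
  ShiftAlg A t x y f ∧ ShiftAlg A t x y g ∧
    ∃ R, ShiftAlg A t x y R ∧ ∀ s, f (s + 1) = f s + t * g s + t ^ 2 * R s

namespace FermatKernel

variable {A : ValuationSubring K} {p : ℕ} {x y : ℕ → K} (h : FermatKernel A p x y)
include h

theorem shiftAlg_mem {f : ℕ → K} (hf : ShiftAlg A (x 1) x y f) (s : ℕ) : f s ∈ A := by
  induction hf with
  | const a ha => exact ha
  | coord_x => exact h.x_mem s
  | coord_y => exact h.y_mem' s
  | add f g _ _ hf hg => exact add_mem hf hg
  | mul f g _ _ hf hg => exact mul_mem hf hg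
  | inv g _ hg => exact h.inv_mem hg

theorem hasShift_x : HasShift A (x 1) x y x (y ^ 2) := by
  obtain ⟨η, hη, hy1⟩ := h.exists_y_one
  have bx := ShiftAlg.coord_x (A := A) (t := x 1) (x := x) (y := y)
  have bY := ShiftAlg.coord_y (A := A) (t := x 1) (x := x) (y := y)
  have ht := h.x_mem 1
  have bd := (bx.pow 3).neg.inv
  have hη' : -2 * η + x 1 ^ 3 * η ^ 2 ∈ A :=
    add_mem (mul_mem (neg_mem (by exact_mod_cast natCast_mem A 2)) hη)
      (mul_mem (pow_mem ht 3) (pow_mem hη 2))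
  refine ⟨bx, bY.pow 2, _, (((bY.pow 2).mul _ _ ((bx.pow 3).mul _ _ bd)).smul (pow_mem ht 2)).add _ _
    ((((bx.smul (mul_mem ht hη')).sub (((bx.pow 2).mul _ _ bY).smul (h.y_mem' 1))).add _ _
      ((bx.pow 4).smul ht)).mul _ _ bd), fun s => ?_⟩
  have hD0 := h.one_add_ne_zero (neg_mem (pow_mem (h.x_mem s) 3))
  have := h.x_add s 1
  simp only [Pi.add_apply, Pi.mul_apply, Pi.smul_apply, Pi.sub_apply, Pi.neg_apply, Pi.pow_apply,
    smul_eq_mul]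
  refine mul_right_cancel₀ hD0 ?_
  generalize hE : (1 + x 1 ^ 3 * -x s ^ 3)⁻¹ = E
  have hE1 : E * (1 + x 1 ^ 3 * -x s ^ 3) = 1 := by rw [← hE]; exact inv_mul_cancel₀ hD0
  rw [show 1 + x 1 ^ 3 * -x s ^ 3 = 1 - x s ^ 3 * x 1 ^ 3 by ring] at hE1 ⊢
  rw [this]
  have e2 : y 1 ^ 2 = 1 + x 1 ^ 3 * (-2 * η + x 1 ^ 3 * η ^ 2) := by rw [hy1]; ring
  linear_combination (x s) * e2 - (x 1 ^ 2 * (x 1 ^ 2 * y s ^ 2 * x s ^ 3 +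
    (x 1 * (-2 * η + x 1 ^ 3 * η ^ 2) * x s - y 1 * (x s ^ 2 * y s) + x 1 * x s ^ 4))) * hE1

theorem hasShift_y : HasShift A (x 1) x y y (x ^ 2) := by
  obtain ⟨η, hη, hy1⟩ := h.exists_y_one
  have bx := ShiftAlg.coord_x (A := A) (t := x 1) (x := x) (y := y)
  have bY := ShiftAlg.coord_y (A := A) (t := x 1) (x := x) (y := y)
  have ht := h.x_mem 1
  have bd := (bx.pow 3).neg.inv
  have hη' : -2 * η + x 1 ^ 3 * η ^ 2 ∈ A :=
    add_mem (mul_mem (neg_mem (by exact_mod_cast natCast_mem A 2)) hη)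
      (mul_mem (pow_mem ht 3) (pow_mem hη 2))
  refine ⟨bY, bx.pow 2, _, (((bx.pow 2).mul _ _ ((bx.pow 3).mul _ _ bd)).smul (pow_mem ht 2)).add _ _
    (((((bx.pow 2).smul (mul_mem (pow_mem ht 2) hη')).sub (bY.smul (mul_mem ht hη))).add _ _
      ((bx.mul _ _ (bY.pow 2)).add _ _ (((bx.pow 3).mul _ _ bY).smul ht))).mul _ _ bd), fun s => ?_⟩
  have hD0 := h.one_add_ne_zero (neg_mem (pow_mem (h.x_mem s) 3))
  have := h.y_add s 1
  simp only [Pi.add_apply, Pi.mul_apply, Pi.smul_apply, Pi.sub_apply, Pi.neg_apply, Pi.pow_apply,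
    smul_eq_mul]
  refine mul_right_cancel₀ hD0 ?_
  generalize hE : (1 + x 1 ^ 3 * -x s ^ 3)⁻¹ = E
  have hE1 : E * (1 + x 1 ^ 3 * -x s ^ 3) = 1 := by rw [← hE]; exact inv_mul_cancel₀ hD0
  rw [show 1 + x 1 ^ 3 * -x s ^ 3 = 1 - x s ^ 3 * x 1 ^ 3 by ring] at hE1 ⊢
  rw [this]
  have e2 : y 1 ^ 2 = 1 + x 1 ^ 3 * (-2 * η + x 1 ^ 3 * η ^ 2) := by rw [hy1]; ring
  linear_combination (x s ^ 2 * x 1) * e2 - y s * hy1 - (x 1 ^ 2 * (x 1 ^ 2 * x s ^ 2 * x s ^ 3 +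
    (x 1 ^ 2 * (-2 * η + x 1 ^ 3 * η ^ 2) * x s ^ 2 - x 1 * η * y s + (x s * y s ^ 2 +
      x 1 * (x s ^ 3 * y s))))) * hE1

theorem hasShift_mul {f f' g g' : ℕ → K} (hf : HasShift A (x 1) x y f f')
    (hg : HasShift A (x 1) x y g g') :
    HasShift A (x 1) x y (f * g) (f' * g + f * g') := by
  obtain ⟨bf, bf', R, hR, eR⟩ := hf
  obtain ⟨bg, bg', Q, hQ, eQ⟩ := hg
  have ht := h.x_mem 1
  refine ⟨bf.mul _ _ bg, (bf'.mul _ _ bg).add _ _ (bf.mul _ _ bg'), _,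
    (((bf'.mul _ _ bg').add _ _ ((bf.mul _ _ hQ).add _ _ (hR.mul _ _ bg))).add _ _
      (((bf'.mul _ _ hQ).add _ _ (hR.mul _ _ bg')).smul ht)).add _ _
      ((hR.mul _ _ hQ).smul (pow_mem ht 2)), fun s => ?_⟩
  simp only [Pi.add_apply, Pi.mul_apply, Pi.smul_apply, smul_eq_mul, eR, eQ]
  ring

theorem hasShift_pow {f f' : ℕ → K} (hf : HasShift A (x 1) x y f f') (n : ℕ) :
    HasShift A (x 1) x y (f ^ (n + 1)) (((n : K) + 1) • (f ^ n * f')) := by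
  induction n with
  | zero => simpa using hf
  | succ n ih =>
    rw [pow_succ]
    convert h.hasShift_mul ih hf using 1
    ext s
    simp only [Pi.add_apply, Pi.mul_apply, Pi.smul_apply, smul_eq_mul, Pi.pow_apply]
    push_cast; ring

theorem exists_difference {f : ℕ → K} (hf : ShiftAlg A (x 1) x y f) :
    ∃ g, ShiftAlg A (x 1) x y g ∧ ∀ s, f (s + 1) = f s + x 1 * g s := by
  have ht := h.x_mem 1
  have of_hasShift : ∀ {f g}, HasShift A (x 1) x y f g →
      ∃ g, ShiftAlg A (x 1) x y g ∧ ∀ s, f (s + 1) = f s + x 1 * g s := by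
    rintro f g ⟨_, bg, R, hR, e⟩
    exact ⟨_, bg.add _ _ (hR.smul ht), fun s => by
      simp only [Pi.add_apply, Pi.smul_apply, smul_eq_mul, e]; ring⟩
  induction hf with
  | const a ha => exact ⟨_, .const 0 (zero_mem A), fun s => by simp⟩
  | coord_x => exact of_hasShift h.hasShift_x
  | coord_y => exact of_hasShift h.hasShift_y
  | add f g _ _ hf hg =>
    obtain ⟨F, bF, eF⟩ := hf
    obtain ⟨G, bG, eG⟩ := hg
    exact ⟨_, bF.add _ _ bG, fun s => by simp only [Pi.add_apply, eF, eG]; ring⟩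
  | mul f g bf bg hf hg =>
    obtain ⟨F, bF, eF⟩ := hf
    obtain ⟨G, bG, eG⟩ := hg
    exact ⟨_, ((bF.mul _ _ bg).add _ _ (bf.mul _ _ bG)).add _ _ ((bF.mul _ _ bG).smul ht),
      fun s => by
        simp only [Pi.add_apply, Pi.mul_apply, Pi.smul_apply, smul_eq_mul, eF, eG]; ring⟩
  | inv g bg hg =>
    obtain ⟨G, bG, eG⟩ := hg
    refine ⟨_, (((bG.neg.mul _ _ bg.inv).mul _ _ (bg.add _ _ (bG.smul ht)).inv)).smul
      (pow_mem ht 3), fun s => ?_⟩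
    have n1 := h.one_add_ne_zero (h.shiftAlg_mem bg s)
    have n2 := h.one_add_ne_zero (h.shiftAlg_mem bg (s + 1))
    simp only [Pi.add_apply, Pi.mul_apply, Pi.smul_apply, smul_eq_mul, Pi.neg_apply]
    rw [eG] at n2 ⊢
    field_simp
    ring

theorem exists_iterate_difference {f : ℕ → K} (hf : ShiftAlg A (x 1) x y f) (k : ℕ) :
    ∃ g, ShiftAlg A (x 1) x y g ∧ (fwdDiff 1)^[k] f = x 1 ^ k • g := by
  induction k with
  | zero => exact ⟨f, hf, by simp⟩
  | succ k ih =>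
    obtain ⟨g, bg, eg⟩ := ih
    obtain ⟨G, bG, eG⟩ := h.exists_difference bg
    refine ⟨G, bG, ?_⟩
    rw [Function.iterate_succ_apply', eg]
    ext s
    simp only [fwdDiff, Pi.smul_apply, smul_eq_mul, eG]
    ring

end FermatKernel

end

section

variable {K : Type*} [Field K] {A : ValuationSubring K}

theorem valuation_eq_one_of_pow {ω : K} {p : ℕ} (hp : p ≠ 0) (hω : ω ^ p = 1) :
    A.valuation ω = 1 := by
  have e := congrArg A.valuation hω
  rw [map_pow, map_one] at e
  exact (pow_eq_one_iff_of_nonneg zero_le hp).1 e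

theorem resid_root_of_unity {ω : K} {p : ℕ} (hp : p.Prime) (hpv : A.valuation (p : K) < 1)
    (hω : ω ^ p = 1) : resid A ω = 1 := by
  have := charP_residueField hp hpv
  have := Fact.mk hp
  have m := mem_of_valuation_eq_one (valuation_eq_one_of_pow (A := A) hp.ne_zero hω)
  have e : (resid A ω - 1) ^ p = 0 := by
    rw [sub_pow_char, ← resid_pow m, hω, resid_one, one_pow, sub_self]
  exact sub_eq_zero.1 (pow_eq_zero_iff hp.ne_zero |>.1 e)

theorem prod_natCast_Icc_eq {p : ℕ} (hp : p.Prime) {F : Type*} [Field F] [CharP F p] :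
    ∏ s ∈ Finset.Icc 1 (p - 1), (s : F) = -1 := by
  have := Fact.mk hp
  have e := congrArg (ZMod.castHom dvd_rfl F) (ZMod.wilsons_lemma p)
  rw [map_neg, map_one, map_natCast, ← Finset.prod_Ico_id_eq_factorial, Nat.sub_add_cancel hp.one_lt.le] at e
  rw [← e, Nat.cast_prod]
  exact Finset.prod_congr (by ext s; simp; have := hp.one_lt; omega) fun _ _ => rfl

theorem natCast_eq_sub_one_pow_mul {ω : K} {p : ℕ} (hp : p.Prime)
    (hpv : A.valuation (p : K) < 1) (hω : ω ^ p = 1) (h1 : ω ≠ 1) :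
    ∃ ε ∈ A, (p : K) = (1 - ω) ^ (p - 1) * ε ∧ resid A ε = -1 := by
  have := charP_residueField hp hpv
  have m := mem_of_valuation_eq_one (valuation_eq_one_of_pow (A := A) hp.ne_zero hω)
  have hprim : IsPrimitiveRoot ω p := by
    have := Fact.mk hp
    exact IsPrimitiveRoot.iff_orderOf.2 (orderOf_eq_prime hω h1)
  have mk : ∀ k, ∑ i ∈ Finset.range k, ω ^ i ∈ A := fun k => sum_mem fun i _ => pow_mem m i
  refine ⟨∏ k ∈ Finset.Icc 1 (p - 1), ∑ i ∈ Finset.range k, ω ^ i, prod_mem fun k _ => mk k, ?_, ?_⟩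
  · obtain ⟨q, rfl⟩ : ∃ q, p = q + 1 := ⟨p - 1, by have := hp.one_lt; omega⟩
    have := hprim.prod_one_sub_pow_eq_order
    rw [← Nat.cast_succ] at this
    rw [← this, Nat.add_sub_cancel]
    have hc : (1 - ω) ^ q = ∏ k ∈ Finset.Icc 1 q, (1 - ω) := by simp
    rw [hc, ← Finset.prod_mul_distrib, Finset.range_eq_Ico,
      Finset.prod_Ico_add' (fun k => 1 - ω ^ k) 0 q 1]
    refine Finset.prod_congr (by ext; simp) fun k _ => ?_
    linear_combination -mul_neg_geom_sum ω k
  · rw [resid_prod _ _ fun k _ => mk k, ← prod_natCast_Icc_eq hp (F := IsLocalRing.ResidueField A)]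
    refine Finset.prod_congr rfl fun k _ => ?_
    rw [resid_sum _ _ fun i _ => pow_mem m i]
    simp [resid_pow m, resid_root_of_unity hp hpv hω]

/-- The twisted sum of a sequence over one period. -/
def twistedSum (p : ℕ) (ω : K) (f : ℕ → K) : K := ∑ s ∈ Finset.range p, ω ^ s * f s

theorem twistedSum_add (p : ℕ) (ω : K) (f g : ℕ → K) :
    twistedSum p ω (f + g) = twistedSum p ω f + twistedSum p ω g := by
  simp [twistedSum, mul_add, Finset.sum_add_distrib]

theorem twistedSum_smul (p : ℕ) (ω a : K) (f : ℕ → K) :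
    twistedSum p ω (a • f) = a * twistedSum p ω f := by
  simp only [twistedSum, Finset.mul_sum, Pi.smul_apply, smul_eq_mul]
  exact Finset.sum_congr rfl fun s _ => by ring

theorem twistedSum_shift {p : ℕ} {ω : K} (hω : ω ^ p = 1) {f : ℕ → K}
    (hf : f p = f 0) : ω * twistedSum p ω (fun s => f (s + 1)) = twistedSum p ω f := by
  have e1 := Finset.sum_range_succ (fun s => ω ^ s * f s) p
  have e2 := Finset.sum_range_succ' (fun s => ω ^ s * f s) p
  rw [e1, hω, hf, pow_zero, one_mul] at e2
  rw [twistedSum, twistedSum, add_right_cancel e2, Finset.mul_sum]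
  exact Finset.sum_congr rfl fun s _ => by ring

theorem twistedSum_choose_succ {p : ℕ} {ω : K} (hω : ω ^ p = 1) (k : ℕ) :
    twistedSum p ω (fun s => (s.choose (k + 1) : K)) * (ω - 1) =
      p.choose (k + 1) - ω * twistedSum p ω fun s => (s.choose k : K) := by
  have e1 := Finset.sum_range_succ (fun s => ω ^ s * (s.choose (k + 1) : K)) p
  have e2 := Finset.sum_range_succ' (fun s => ω ^ s * (s.choose (k + 1) : K)) p
  rw [e1, hω, Nat.choose_zero_succ, Nat.cast_zero, mul_zero, add_zero, one_mul] at e2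
  have e3 : ∑ s ∈ Finset.range p, ω ^ (s + 1) * ((s + 1).choose (k + 1) : K) =
      ω * twistedSum p ω (fun s => (s.choose k : K)) +
        ω * twistedSum p ω (fun s => (s.choose (k + 1) : K)) := by
    rw [← mul_add, ← twistedSum_add, twistedSum, Finset.mul_sum]
    refine Finset.sum_congr rfl fun s _ => ?_
    rw [Nat.choose_succ_succ]
    push_cast
    simp only [Pi.add_apply]
    ring
  rw [e3] at e2
  have e4 : twistedSum p ω (fun s => (s.choose (k + 1) : K)) =
    ∑ s ∈ Finset.range p, ω ^ s * (s.choose (k + 1) : K) := rfl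
  linear_combination -e2 - e4

theorem valuation_twistedSum_choose_le {p : ℕ} (hp : p.Prime) {ω t : K} (hω : ω ^ p = 1)
    (h1 : ω ≠ 1) (ht : A.valuation t ≤ 1) (hv : A.valuation (ω - 1) = A.valuation t)
    (hpv : A.valuation (p : K) = A.valuation t ^ (p - 1)) {k : ℕ} (hk : k < p) :
    A.valuation (twistedSum p ω fun s => (s.choose k : K)) * A.valuation t ^ k ≤
      A.valuation t ^ (p - 1) := by
  induction k with
  | zero =>
    have : twistedSum p ω (fun s => (s.choose 0 : K)) = 0 := by
      have := mul_geom_sum ω p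
      rw [hω, sub_self] at this
      simpa [twistedSum, sub_ne_zero.2 h1] using this
    rw [this]; simp
  | succ k ih =>
    rw [pow_succ', ← mul_assoc, ← hv, ← map_mul, twistedSum_choose_succ hω, hv, ← map_pow,
      ← map_mul, sub_mul]
    refine Valuation.map_sub_le (v := A.valuation) ?_ ?_
    · obtain ⟨m, hm⟩ := hp.dvd_choose_self (Nat.succ_ne_zero k) hk
      rw [hm, Nat.cast_mul, map_mul, map_mul, hpv, map_pow]
      calc _ ≤ A.valuation t ^ (p - 1) * 1 * 1 := by
            gcongr
            · exact (A.valuation_le_one_iff _).2 (natCast_mem A m)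
            · exact pow_le_one₀ zero_le ht
        _ = _ := by simp
    · rw [map_mul, map_mul, valuation_eq_one_of_pow hp.ne_zero hω, one_mul, map_pow]
      exact ih (by omega)

namespace FermatKernel

variable {p : ℕ} {x y : ℕ → K} (h : FermatKernel A p x y)
include h

theorem valuation_twistedSum_le {ω : K} (hω : ω ^ p = 1) (h1 : ω ≠ 1)
    (hv : A.valuation (ω - 1) = A.valuation (x 1))
    (hpv : A.valuation (p : K) = A.valuation (x 1) ^ (p - 1)) {f : ℕ → K}
    (hf : ShiftAlg A (x 1) x y f) :
    A.valuation (twistedSum p ω f) ≤ A.valuation (x 1) ^ (p - 1) := by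
  choose g bg eg using h.exists_iterate_difference hf
  have newton : ∀ s ∈ Finset.range p, ω ^ s * f s =
      ∑ k ∈ Finset.range p, ω ^ s * (s.choose k : K) * (x 1 ^ k * g k 0) := by
    intro s hs
    have e := shift_eq_sum_fwdDiff_iter 1 f s 0
    rw [smul_eq_mul, mul_one, zero_add] at e
    rw [e, Finset.mul_sum]
    have hsub : Finset.range (s + 1) ⊆ Finset.range p :=
      Finset.range_subset_range.2 (Finset.mem_range.1 hs)
    rw [← Finset.sum_subset hsub]
    · refine Finset.sum_congr rfl fun k _ => ?_
      rw [eg, Pi.smul_apply, nsmul_eq_mul, smul_eq_mul]; ring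
    · intro k _ hk
      rw [Nat.choose_eq_zero_of_lt (by simpa using hk)]; simp
  rw [twistedSum, Finset.sum_congr rfl newton, Finset.sum_comm]
  refine Valuation.map_sum_le _ fun k hk => ?_
  rw [← Finset.sum_mul, map_mul, map_mul, ← mul_assoc, map_pow]
  calc _ ≤ A.valuation (x 1) ^ (p - 1) * 1 := by
        gcongr
        · exact valuation_twistedSum_choose_le h.prime hω h1 (h.x_small 1).le hv hpv
            (Finset.mem_range.1 hk)
        · exact (A.valuation_le_one_iff _).2 (h.shiftAlg_mem (bg k) 0)
    _ = _ := mul_one _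

end FermatKernel

end

section

variable {K : Type*} [Field K] {A : ValuationSubring K}

namespace FermatKernel

variable {p : ℕ} {x y : ℕ → K}

/-- The leading coefficient of a twisted sum. -/
noncomputable def leading (A : ValuationSubring K) (p : ℕ) (t ω : K) (f : ℕ → K) :
    IsLocalRing.ResidueField A := resid A (twistedSum p ω f / t ^ (p - 1))

variable (h : FermatKernel A p x y)
include h

theorem leading_eq_zero {ω : K} (hω : ω ^ p = 1) {f : ℕ → K} (hf : ShiftAlg A (x 1) x y f) (k : ℕ) :
    leading A p (x 1) ω (x ^ (p + k) * f) = 0 := by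
  refine resid_eq_zero ?_
  rw [map_div₀, map_pow]
  have hb : A.valuation (twistedSum p ω (x ^ (p + k) * f)) ≤ A.valuation (x 1) ^ p := by
    refine Valuation.map_sum_le _ fun s _ => ?_
    obtain ⟨u, hu, e, -⟩ := h.exists_x_eq s
    simp only [Pi.mul_apply, Pi.pow_apply]
    rw [e, show ω ^ s * ((x 1 * u) ^ (p + k) * f s) =
      x 1 ^ p * (ω ^ s * (x 1 ^ k * u ^ (p + k) * f s)) by ring, map_mul, map_pow]
    have m : ω ^ s * (x 1 ^ k * u ^ (p + k) * f s) ∈ A :=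
      mul_mem (pow_mem (mem_of_valuation_eq_one (valuation_eq_one_of_pow h.prime.ne_zero hω)) _)
        (mul_mem (mul_mem (pow_mem (h.x_mem 1) _) (pow_mem hu _)) (h.shiftAlg_mem hf s))
    exact mul_le_of_le_one_right' ((A.valuation_le_one_iff _).2 m)
  have h0 := h.valuation_t_ne
  have hpos : 0 < A.valuation (x 1) ^ (p - 1) := zero_lt_iff.2 (pow_ne_zero _ h0)
  rw [div_lt_one₀ hpos]
  refine hb.trans_lt ?_
  have : p = (p - 1) + 1 := by have := h.prime.one_lt; omega
  rw [this, Nat.add_sub_cancel, pow_succ]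
  exact mul_lt_of_lt_one_right hpos (h.x_small 1)

theorem leading_pow_mul_sq {ω : K} (hω : ω ^ p = 1) : leading A p (x 1) ω (x ^ (p - 1) * y ^ 2) = -1 := by
  have := h.charP
  have := Fact.mk h.prime
  have mω := mem_of_valuation_eq_one (valuation_eq_one_of_pow (A := A) h.prime.ne_zero hω)
  choose u hu ex ru using h.exists_x_eq
  have hm : ∀ s, ω ^ s * (u s ^ (p - 1) * y s ^ 2) ∈ A := fun s =>
    mul_mem (pow_mem mω _) (mul_mem (pow_mem (hu s) _) (pow_mem (h.y_mem' s) 2))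
  have e : twistedSum p ω (x ^ (p - 1) * y ^ 2) / x 1 ^ (p - 1) =
      ∑ s ∈ Finset.range p, ω ^ s * (u s ^ (p - 1) * y s ^ 2) := by
    rw [div_eq_iff (pow_ne_zero _ h.x_one_ne), twistedSum, Finset.sum_mul]
    refine Finset.sum_congr rfl fun s _ => ?_
    simp only [Pi.mul_apply, Pi.pow_apply, ex s]
    ring
  have e2 : ∀ s ∈ Finset.range p, resid A (ω ^ s * (u s ^ (p - 1) * y s ^ 2)) =
      if s = 0 then 0 else 1 := by
    intro s hs
    rw [resid_mul (pow_mem mω _) (mul_mem (pow_mem (hu s) _) (pow_mem (h.y_mem' s) 2)),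
      resid_mul (pow_mem (hu s) _) (pow_mem (h.y_mem' s) 2), resid_pow mω,
      resid_root_of_unity h.prime h.p_small hω, resid_pow (hu s), ru, resid_pow (h.y_mem' s),
      h.y_resid]
    split_ifs with h0
    · have := h.seven_le
      rw [h0, Nat.cast_zero, zero_pow (by omega)]; simp
    · have hz : (s : ZMod p) ≠ 0 := by
        rw [Ne, ZMod.natCast_eq_zero_iff]
        exact fun hd => absurd (Nat.le_of_dvd (Nat.pos_of_ne_zero h0) hd)
          (by have := Finset.mem_range.1 hs; omega)
      have := congrArg (ZMod.castHom dvd_rfl (IsLocalRing.ResidueField A))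
        (ZMod.pow_card_sub_one_eq_one hz)
      rw [map_pow, map_natCast, map_one] at this
      rw [this]; norm_num
  rw [leading, e, resid_sum _ _ fun s _ => hm s, Finset.sum_congr rfl e2]
  obtain ⟨q, rfl⟩ : ∃ q, p = q + 1 := ⟨p - 1, by have := h.seven_le; omega⟩
  rw [Finset.sum_range_succ']
  simp only [Nat.add_eq_zero_iff, one_ne_zero, and_false, if_false, Finset.sum_const,
    Finset.card_range, nsmul_eq_mul, mul_one, if_true, add_zero]
  have := CharP.cast_eq_zero (IsLocalRing.ResidueField A) (q + 1)
  push_cast at this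
  linear_combination this

section

variable {ω : K} (hω : ω ^ p = 1) (h1 : ω ≠ 1)
  (hv : A.valuation (ω - 1) = A.valuation (x 1))
  (hpv : A.valuation (p : K) = A.valuation (x 1) ^ (p - 1))
include hω h1 hv hpv

theorem leading_mem {f : ℕ → K} (hf : ShiftAlg A (x 1) x y f) :
    twistedSum p ω f / x 1 ^ (p - 1) ∈ A :=
  div_mem_of_valuation_le (by rw [map_pow]; exact h.valuation_twistedSum_le hω h1 hv hpv hf)

theorem leading_add {f g : ℕ → K} (hf : ShiftAlg A (x 1) x y f) (hg : ShiftAlg A (x 1) x y g) :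
    leading A p (x 1) ω (f + g) = leading A p (x 1) ω f + leading A p (x 1) ω g := by
  rw [leading, twistedSum_add, add_div, resid_add (h.leading_mem hω h1 hv hpv hf)
    (h.leading_mem hω h1 hv hpv hg)]; rfl

theorem leading_smul {f : ℕ → K} (hf : ShiftAlg A (x 1) x y f) {a : K} (ha : a ∈ A) :
    leading A p (x 1) ω (a • f) = resid A a * leading A p (x 1) ω f := by
  rw [leading, twistedSum_smul, mul_div_assoc, resid_mul ha (h.leading_mem hω h1 hv hpv hf)]; rfl

theorem leading_sub {f g : ℕ → K} (hf : ShiftAlg A (x 1) x y f) (hg : ShiftAlg A (x 1) x y g) :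
    leading A p (x 1) ω (f - g) = leading A p (x 1) ω f - leading A p (x 1) ω g := by
  have e : f - g = f + (-1 : K) • g := by ext; simp; ring
  have m : (-1 : K) ∈ A := neg_mem (one_mem A)
  rw [e, h.leading_add hω h1 hv hpv hf (hg.smul m), h.leading_smul hω h1 hv hpv hg m,
    resid_neg (one_mem A), resid_one]
  ring

theorem resid_mul_leading {f g : ℕ → K} (hf : HasShift A (x 1) x y f g) (hfp : f p = f 0) :
    resid A ((ω⁻¹ - 1) / x 1) * leading A p (x 1) ω f = leading A p (x 1) ω g := by
  obtain ⟨bf, bg, R, bR, eR⟩ := hf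
  have ht := h.x_mem 1
  have hω0 : ω ≠ 0 := by rintro rfl; simp [h.prime.ne_zero] at hω
  have hm : (ω⁻¹ - 1) / x 1 ∈ A := by
    refine div_mem_of_valuation_le ?_
    rw [← hv, show ω⁻¹ - 1 = -(ω⁻¹ * (ω - 1)) by field_simp; ring, Valuation.map_neg, map_mul,
      map_inv₀, valuation_eq_one_of_pow h.prime.ne_zero hω, inv_one, one_mul]
  have e1 := twistedSum_shift hω hfp
  have e2 : (fun s => f (s + 1)) = f + x 1 • (g + x 1 • R) := by
    ext s; simp [eR]; ring
  rw [e2, twistedSum_add, twistedSum_smul] at e1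
  rw [leading, ← resid_mul hm (h.leading_mem hω h1 hv hpv bf),
    show (ω⁻¹ - 1) / x 1 * (twistedSum p ω f / x 1 ^ (p - 1)) =
      twistedSum p ω (g + x 1 • R) / x 1 ^ (p - 1) by
      have := h.x_one_ne
      field_simp
      linear_combination -e1]
  have := h.leading_add hω h1 hv hpv bg (bR.smul ht)
  rw [h.leading_smul hω h1 hv hpv bR ht, resid_eq_zero (h.x_small 1), zero_mul, add_zero] at this
  exact this

end

theorem x_p : x p = x 0 := by simpa using h.x_period 0

theorem y_p : y p = y 0 := by simpa using h.y_period 0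

theorem leading_prod {n : ℕ} (hpn : p = 3 * n + 1)
    (hpv : A.valuation (p : K) = A.valuation (x 1) ^ (p - 1)) (ω : Fin n → K)
    (hω : ∀ r, ω r ^ p = 1) (h1 : ∀ r, ω r ≠ 1)
    (hv : ∀ r, A.valuation (ω r - 1) = A.valuation (x 1))
    (he : Function.Injective fun r => resid A (((ω r)⁻¹ - 1) / x 1) ^ 3)
    (he0 : ∀ r, resid A (((ω r)⁻¹ - 1) / x 1) ≠ 0) :
    (∏ r, leading A p (x 1) (ω r) x) *
      ∏ j ∈ Finset.range n, ((3 * (j : IsLocalRing.ResidueField A) + 1) * (3 * j + 2)) =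
      ∏ r, resid A (((ω r)⁻¹ - 1) / x 1) ^ 2 := by
  have := h.charP
  have := Fact.mk h.prime
  have bx := ShiftAlg.coord_x (A := A) (t := x 1) (x := x) (y := y)
  have bY := ShiftAlg.coord_y (A := A) (t := x 1) (x := x) (y := y)
  have hn : Even n := by
    rcases Nat.even_or_odd n with hn | ⟨m, hm⟩
    · exact hn
    · have h7 := h.seven_le
      have h2 := (Nat.prime_dvd_prime_iff_eq Nat.prime_two h.prime).1
        (show 2 ∣ p from ⟨3 * m + 2, by omega⟩)
      omega
  have cN : ∀ k : ℕ, (k : K) ∈ A := natCast_mem A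
  have curve : ∀ s, y s ^ 3 = x s ^ 3 - 1 := fun s => by linear_combination -h.curve s
  have hs2y := h.hasShift_pow h.hasShift_y 1
  have key := prod_mul_prod_eq_prod_sq p n hpn hn
    (fun r => resid A (((ω r)⁻¹ - 1) / x 1)) he he0
    (fun r j => leading A p (x 1) (ω r) (x ^ (3 * j + 1)))
    (fun r j => leading A p (x 1) (ω r) (x ^ (3 * j) * y ^ 2))
    (fun r j => leading A p (x 1) (ω r) (x ^ (3 * j + 2) * y))
    ?_ ?_ ?_ ?_ ?_ ?_ ?_
  · simpa using key
  · intro r j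
    rw [h.resid_mul_leading (hω r) (h1 r) (hv r) hpv (h.hasShift_pow h.hasShift_x (3 * j))
      (by simp [h.x_p])]
    have := h.leading_smul (hω r) (h1 r) (hv r) hpv ((bx.pow (3 * j)).mul _ _ (bY.pow 2))
      (cN (3 * j + 1))
    rw [resid_natCast] at this
    push_cast at this ⊢
    exact this
  · intro r
    simp only [mul_zero, pow_zero, one_mul, zero_add]
    rw [h.resid_mul_leading (hω r) (h1 r) (hv r) hpv (h.hasShift_pow h.hasShift_y 1)
      (by simp [h.y_p])]
    have := h.leading_smul (hω r) (h1 r) (hv r) hpv ((bx.pow 2).mul _ _ bY) (cN 2)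
    rw [resid_natCast] at this
    push_cast at this ⊢
    rw [← this]
    congr 1
    ext s; simp; ring
  · intro r j
    rw [show x ^ (3 * (j + 1)) * y ^ 2 = x ^ (3 * j + 2 + 1) * y ^ (1 + 1) from rfl,
      h.resid_mul_leading (hω r) (h1 r) (hv r) hpv
      (h.hasShift_mul (h.hasShift_pow h.hasShift_x (3 * j + 2)) hs2y) (by simp [h.y_p, h.x_p])]
    have m1 := (bx.pow (3 * (j + 1) + 2)).mul _ _ bY
    have m2 := (bx.pow (3 * j + 2)).mul _ _ bY
    have := h.leading_sub (hω r) (h1 r) (hv r) hpv (m1.smul (cN (3 * j + 5)))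
      (m2.smul (cN (3 * j + 3)))
    rw [h.leading_smul (hω r) (h1 r) (hv r) hpv m1 (cN (3 * j + 5)),
      h.leading_smul (hω r) (h1 r) (hv r) hpv m2 (cN (3 * j + 3)), resid_natCast,
      resid_natCast] at this
    push_cast at this
    rw [← this]
    congr 1
    ext s
    simp only [Pi.add_apply, Pi.mul_apply, Pi.smul_apply, Pi.pow_apply, Pi.sub_apply, smul_eq_mul]
    push_cast
    linear_combination ((3 * j + 3) * x s ^ (3 * j + 2) * y s) * curve s
  · intro r j
    rw [h.resid_mul_leading (hω r) (h1 r) (hv r) hpv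
      (h.hasShift_mul (h.hasShift_pow h.hasShift_x (3 * j + 1)) h.hasShift_y)
      (by simp [h.y_p, h.x_p])]
    have m1 := bx.pow (3 * (j + 1) + 1)
    have m2 := bx.pow (3 * j + 1)
    have := h.leading_sub (hω r) (h1 r) (hv r) hpv (m1.smul (cN (3 * j + 3)))
      (m2.smul (cN (3 * j + 2)))
    rw [h.leading_smul (hω r) (h1 r) (hv r) hpv m1 (cN (3 * j + 3)),
      h.leading_smul (hω r) (h1 r) (hv r) hpv m2 (cN (3 * j + 2)), resid_natCast,
      resid_natCast] at this
    push_cast at this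
    rw [← this]
    congr 1
    ext s
    simp only [Pi.add_apply, Pi.mul_apply, Pi.smul_apply, Pi.pow_apply, Pi.sub_apply, smul_eq_mul]
    push_cast
    linear_combination ((3 * j + 2) * x s ^ (3 * j + 1)) * curve s
  · intro r
    have := h.leading_eq_zero (hω r) (ShiftAlg.const 1 (one_mem A)) 0
    rw [add_zero, hpn] at this
    rw [hpn, ← this]
    congr 1
    ext s; simp
  · intro r
    have := h.leading_pow_mul_sq (hω r)
    rw [hpn, Nat.add_sub_cancel] at this
    rw [hpn]
    exact this
  · intro r
    have := h.leading_eq_zero (hω r) bY 1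
    rw [hpn] at this
    rw [hpn]
    exact this

end FermatKernel

end

section

variable {K : Type*} [Field K] {A : ValuationSubring K}

theorem eq_one_of_resid_eq_one {F : K} (hF : F ^ 3 = 1) (h3 : (3 : IsLocalRing.ResidueField A) ≠ 0)
    (hr : resid A F = 1) : F = 1 := by
  by_contra hne
  have e : F ^ 2 + F + 1 = 0 := by
    have : (F - 1) * (F ^ 2 + F + 1) = 0 := by linear_combination hF
    exact (mul_eq_zero.1 this).resolve_left (sub_ne_zero.2 hne)
  have m := mem_of_valuation_eq_one (valuation_eq_one_of_pow (A := A) three_ne_zero hF)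
  have e2 := congrArg (resid A) e
  rw [resid_add (add_mem (pow_mem m 2) m) (one_mem A), resid_add (pow_mem m 2) m, resid_pow m,
    resid_zero, resid_one, hr] at e2
  apply h3
  linear_combination e2

theorem natCast_factorial_sub_one {p : ℕ} (hp : p.Prime) {F : Type*} [Field F] [CharP F p] :
    ((p - 1).factorial : F) = -1 := by
  have := Fact.mk hp
  have e := congrArg (ZMod.castHom dvd_rfl F) (ZMod.wilsons_lemma p)
  rwa [map_neg, map_one, map_natCast] at e

theorem FermatGroup.kernel_of_prod {p : ℕ} {x y : ℕ → K} (h : FermatGroup p x y) (hp : p.Prime)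
    (hp3 : p % 3 = 1) (hpA : A.valuation (p : K) < 1) {P F : K} (hP0 : P ≠ 0)
    (hP : A.valuation P < 1) (hF : F ^ 3 = 1) (hx : ∏ s ∈ Finset.Icc 1 (p - 1), x s = P * F)
    (hy : F * ∏ s ∈ Finset.Icc 1 (p - 1), y s = 1) :
    FermatKernel A p x y ∧ F = 1 := by
  have vF := valuation_eq_one_of_pow (A := A) three_ne_zero hF
  obtain ⟨s, hs, hxs⟩ : ∃ s ∈ Finset.Icc 1 (p - 1), A.valuation (x s) < 1 := by
    by_contra! hcon
    have e := congrArg A.valuation hx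
    rw [map_mul, vF, mul_one, map_prod] at e
    have : 1 ≤ ∏ s ∈ Finset.Icc 1 (p - 1), A.valuation (x s) := Finset.one_le_prod' hcon
    rw [e] at this
    exact absurd hP (not_lt.2 this)
  have hps : ¬ p ∣ s := fun hd => by
    have := Nat.le_of_dvd (by simp at hs; omega) hd
    simp at hs; have := hp.one_lt; omega
  have key := h.all_small hp hp3 hps hxs
  have hF0 : F ≠ 0 := by rintro rfl; simp at hF
  have hk : FermatKernel A p x y :=
    { h with
      prime := hp, mod_three := hp3, p_small := hpA, x_small := fun r => (key r).1
      y_resid := fun r => (key r).2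
      x_one_ne := fun e => by
        have h1 : (1 : ℕ) ∈ Finset.Icc 1 (p - 1) := by simp; have := hp.one_lt; omega
        rw [Finset.prod_eq_zero h1 e] at hx
        exact mul_ne_zero hP0 hF0 hx.symm }
  refine ⟨hk, eq_one_of_resid_eq_one (A := A) hF ?_ ?_⟩
  · exact_mod_cast hk.resid_natCast_ne_zero (k := 3) (by norm_num) (by have := hk.seven_le; omega)
  · have my : ∀ s ∈ Finset.Icc 1 (p - 1), y s ∈ A := fun s _ => hk.y_mem' s
    have e := congrArg (resid A) hy
    rw [resid_mul (mem_of_valuation_eq_one vF) (prod_mem my), resid_prod _ _ my,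
      Finset.prod_congr rfl fun s _ => hk.y_resid s, resid_one] at e
    simp only [Finset.prod_const, Nat.card_Icc, Nat.add_sub_cancel] at e
    have hev : Even (p - 1) := hp.even_sub_one (by have := hk.seven_le; omega)
    rwa [hev.neg_one_pow, mul_one] at e

namespace FermatKernel

variable {p : ℕ} {x y : ℕ → K} (h : FermatKernel A p x y)
include h

theorem prod_eq : ∃ ε ∈ A, ∏ s ∈ Finset.Icc 1 (p - 1), x s = x 1 ^ (p - 1) * ε ∧
    resid A ε = -1 := by
  have := h.charP
  choose u hu ex ru using h.exists_x_eq
  refine ⟨∏ s ∈ Finset.Icc 1 (p - 1), u s, prod_mem fun s _ => hu s, ?_, ?_⟩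
  · rw [Finset.prod_congr rfl fun s _ => ex s, Finset.prod_mul_distrib]
    simp
  · rw [resid_prod _ _ fun s _ => hu s, Finset.prod_congr rfl fun s _ => ru s,
      prod_natCast_Icc_eq h.prime]

theorem resid_div_natCast (s : ℕ) : resid A (x s / x 1) = s := by
  obtain ⟨u, hu, e, ru⟩ := h.exists_x_eq s
  rw [e, mul_div_cancel_left₀ _ h.x_one_ne, ru]

theorem div_mem (s : ℕ) : x s / x 1 ∈ A := by
  obtain ⟨u, hu, e, ru⟩ := h.exists_x_eq s
  rwa [e, mul_div_cancel_left₀ _ h.x_one_ne]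

theorem valuation_P {P : K} (hx : ∏ s ∈ Finset.Icc 1 (p - 1), x s = P) :
    A.valuation P = A.valuation (x 1) ^ (p - 1) := by
  obtain ⟨ε, hε, e, re⟩ := h.prod_eq
  have vε : A.valuation ε = 1 := (resid_ne_zero_iff hε).1 (by rw [re]; simp)
  rw [← hx, e, map_mul, vε, mul_one, map_pow]

theorem resid_P_div {P : K} (hx : ∏ s ∈ Finset.Icc 1 (p - 1), x s = P) :
    resid A (P / x 1 ^ (p - 1)) = -1 := by
  obtain ⟨ε, hε, e, re⟩ := h.prod_eq
  rw [← hx, e, mul_div_cancel_left₀ _ (pow_ne_zero _ h.x_one_ne), re]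

section Uniformizer

variable {P Q : K} (hpP : (p : K) = P * Q) (hQ : A.valuation Q = 1)
  (hx : ∏ s ∈ Finset.Icc 1 (p - 1), x s = P)
include hpP hQ hx

theorem valuation_p : A.valuation (p : K) = A.valuation (x 1) ^ (p - 1) := by
  rw [hpP, map_mul, hQ, mul_one, h.valuation_P hx]

theorem valuation_root_sub_one {ω : K} (hω : ω ^ p = 1) (h1 : ω ≠ 1) :
    A.valuation (ω - 1) = A.valuation (x 1) := by
  obtain ⟨ε, hε, e, re⟩ := natCast_eq_sub_one_pow_mul h.prime h.p_small hω h1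
  have vε : A.valuation ε = 1 := (resid_ne_zero_iff hε).1 (by rw [re]; simp)
  have e2 := h.valuation_p hpP hQ hx
  rw [e, map_mul, vε, mul_one, map_pow] at e2
  rw [← Valuation.map_neg, neg_sub]
  exact (pow_left_inj₀ zero_le zero_le (by have := h.seven_le; omega)).1 e2

theorem root_div_mem {ω : K} (hω : ω ^ p = 1) : (ω - 1) / x 1 ∈ A := by
  by_cases h1 : ω = 1
  · simp [h1, zero_mem]
  · exact div_mem_of_valuation_le (h.valuation_root_sub_one hpP hQ hx hω h1).le

theorem resid_root_div_ne_zero {ω : K} (hω : ω ^ p = 1) (h1 : ω ≠ 1) :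
    resid A ((ω - 1) / x 1) ≠ 0 := by
  rw [resid_ne_zero_iff (h.root_div_mem hpP hQ hx hω), map_div₀,
    h.valuation_root_sub_one hpP hQ hx hω h1, div_self h.valuation_t_ne]

theorem resid_root_div_pow {ω : K} (hω : ω ^ p = 1) (h1 : ω ≠ 1) :
    resid A ((ω - 1) / x 1) ^ (p - 1) = resid A Q := by
  obtain ⟨ε, hε, e, re⟩ := natCast_eq_sub_one_pow_mul h.prime h.p_small hω h1
  obtain ⟨ε', hε', e', re'⟩ := h.prod_eq
  have m := h.root_div_mem hpP hQ hx hω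
  have hev : Even (p - 1) := h.prime.even_sub_one (by have := h.seven_le; omega)
  have key : ((ω - 1) / x 1) ^ (p - 1) * ε = ε' * Q := by
    have ht := pow_ne_zero (p - 1) h.x_one_ne
    rw [div_pow, div_mul_eq_mul_div, div_eq_iff ht, ← neg_sub 1 ω, hev.neg_pow, ← e, hpP, ← hx, e']
    ring
  have e3 := congrArg (resid A) key
  rw [resid_mul (pow_mem m _) hε, resid_mul hε' (mem_of_valuation_eq_one hQ), re, re',
    resid_pow m] at e3
  linear_combination -e3

theorem resid_root_pow_div {ω : K} (hω : ω ^ p = 1) (k : ℕ) :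
    resid A ((ω ^ k - 1) / x 1) = k * resid A ((ω - 1) / x 1) := by
  have m := h.root_div_mem hpP hQ hx hω
  have mω := mem_of_valuation_eq_one (valuation_eq_one_of_pow (A := A) h.prime.ne_zero hω)
  rw [← mul_geom_sum ω k, mul_div_right_comm, resid_mul m (sum_mem fun i _ => pow_mem mω i),
    resid_sum _ _ fun i _ => pow_mem mω i, mul_comm]
  simp [resid_pow mω, resid_root_of_unity h.prime h.p_small hω]

/-- The residue of a product of torsion points of the conjugate isogeny over a third of the
nonzero residue classes. -/
theorem resid_prod_conj {n : ℕ} (hpn : p = 3 * n + 1) {ζ : K} (hζ : IsPrimitiveRoot ζ p)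
    {x' : ℕ → K} {b : ℕ} (hb : ¬ p ∣ b)
    (hc : ∀ m, ∑ s ∈ Finset.range p, ζ ^ (b * m * s) * x s = -P * x' m) (r : Fin n → ℕ)
    (hr : ∀ i, ¬ p ∣ r i)
    (hinj : Function.Injective fun i => (r i : IsLocalRing.ResidueField A) ^ 3) :
    (∀ m, ¬ p ∣ m → x' m ∈ A) ∧ (∏ i, resid A (x' (r i))) * (-1) = 
      3 ^ n * (n.factorial : IsLocalRing.ResidueField A) *
        ∏ i, (b * r i * resid A ((ζ - 1) / x 1)) ^ 2 := by
  have := h.charP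
  have hp := h.prime
  have h7 := h.seven_le
  have hζp := hζ.pow_eq_one
  have hζ1 : ζ ≠ 1 := hζ.ne_one hp.one_lt
  have hω : ∀ m, (ζ ^ (b * m)) ^ p = 1 := fun m => by rw [pow_right_comm, hζp, one_pow]
  have hω1 : ∀ m, ¬ p ∣ m → ζ ^ (b * m) ≠ 1 := fun m hm e => by
    rcases hp.dvd_mul.1 ((hζ.pow_eq_one_iff_dvd _).1 e) with h' | h' <;> contradiction
  have hcast : ∀ k : ℕ, ¬ p ∣ k → (k : IsLocalRing.ResidueField A) ≠ 0 := fun k hk e =>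
    hk ((CharP.cast_eq_zero_iff _ p k).1 e)
  have hv := fun m (hm : ¬ p ∣ m) => h.valuation_root_sub_one hpP hQ hx (hω m) (hω1 m hm)
  have hpv := h.valuation_p hpP hQ hx
  have ht := pow_ne_zero (p - 1) h.x_one_ne
  have hP := h.resid_P_div hx
  have mP : P / x 1 ^ (p - 1) ∈ A := by
    refine div_mem_of_valuation_le ?_
    rw [h.valuation_P hx, map_pow]
  have vP : A.valuation (P / x 1 ^ (p - 1)) = 1 := (resid_ne_zero_iff mP).1 (by rw [hP]; simp)
  have bx := ShiftAlg.coord_x (A := A) (t := x 1) (x := x) (y := y)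
  have hlam : ∀ m, twistedSum p (ζ ^ (b * m)) x / x 1 ^ (p - 1) =
      -(P / x 1 ^ (p - 1)) * x' m := fun m => by
    rw [show twistedSum p (ζ ^ (b * m)) x = -P * x' m by
      rw [← hc m, twistedSum]; exact Finset.sum_congr rfl fun s _ => by rw [← pow_mul]]
    ring
  have hx' : ∀ m, ¬ p ∣ m → x' m ∈ A := fun m hm => by
    have := h.leading_mem (hω m) (hω1 m hm) (hv m hm) hpv bx
    rw [← A.valuation_le_one_iff, hlam m, map_mul, Valuation.map_neg, vP, one_mul] at this
    exact (A.valuation_le_one_iff _).1 this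
  refine ⟨hx', ?_⟩
  have hlead : ∀ m, ¬ p ∣ m → leading A p (x 1) (ζ ^ (b * m)) x = resid A (x' m) := fun m hm => by
    rw [leading, hlam m, resid_mul (neg_mem mP) (hx' m hm), resid_neg mP, hP]
    ring
  have he : ∀ m, resid A (((ζ ^ (b * m))⁻¹ - 1) / x 1) =
      -(b * m * resid A ((ζ - 1) / x 1)) := fun m => by
    have h0 : ζ ^ (b * m) ≠ 0 := by
      intro e; have := hω m; rw [e, zero_pow hp.ne_zero] at this; exact zero_ne_one this
    have vω := valuation_eq_one_of_pow (A := A) hp.ne_zero (hω m)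
    have mω := inv_mem_of_valuation_eq_one vω
    rw [show ((ζ ^ (b * m))⁻¹ - 1) / x 1 = -((ζ ^ (b * m))⁻¹ * ((ζ ^ (b * m) - 1) / x 1)) by
      have := h.x_one_ne
      field_simp; ring, resid_neg (mul_mem mω (h.root_div_mem hpP hQ hx (hω m))),
      resid_mul mω (h.root_div_mem hpP hQ hx (hω m)), resid_inv vω,
      resid_root_of_unity hp h.p_small (hω m), resid_root_pow_div h hpP hQ hx hζp]
    push_cast; ring
  have hδ := h.resid_root_div_ne_zero hpP hQ hx hζp hζ1
  have key := h.leading_prod hpn hpv (fun i => ζ ^ (b * r i)) (fun i => hω _)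
    (fun i => hω1 _ (hr i)) (fun i => hv _ (hr i)) ?_ ?_
  · simp only [he] at key
    rw [Finset.prod_congr rfl fun i _ => hlead _ (hr i)] at key
    have hfac : 3 ^ n * (n.factorial : IsLocalRing.ResidueField A) *
        ∏ j ∈ Finset.range n, ((3 * (j : IsLocalRing.ResidueField A) + 1) * (3 * j + 2)) = -1 := by
      have e1 : ∀ n : ℕ, 3 ^ n * n.factorial * ∏ j ∈ Finset.range n, ((3 * j + 1) * (3 * j + 2)) =
          (3 * n).factorial := by
        intro n
        induction n with
        | zero => simp
        | succ n ih =>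
          rw [Finset.prod_range_succ, show 3 * (n + 1) = 3 * n + 2 + 1 by ring,
            Nat.factorial_succ (3 * n + 2), Nat.factorial_succ (3 * n + 1),
            Nat.factorial_succ (3 * n), ← ih, Nat.factorial_succ n]
          ring
      have e2 := natCast_factorial_sub_one hp (F := IsLocalRing.ResidueField A)
      rw [hpn, Nat.add_sub_cancel, ← e1 n] at e2
      exact_mod_cast e2
    rw [← hfac]
    simp only [neg_sq] at key
    rw [← key]
    ring
  · intro i j hij
    refine hinj ?_
    simp only [he] at hij ⊢
    have hb0 := hcast b hb
    have : (b * resid A ((ζ - 1) / x 1)) ^ 3 ≠ 0 := pow_ne_zero _ (mul_ne_zero hb0 hδ)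
    refine mul_left_cancel₀ this ?_
    linear_combination -hij
  · intro i
    rw [he]
    exact neg_ne_zero.2 (mul_ne_zero (mul_ne_zero (hcast b hb) (hcast _ (hr i))) hδ)

end Uniformizer

end FermatKernel

end

section

theorem sum_range_natCast_zmod {M : Type*} [AddCommMonoid M] (p : ℕ) [NeZero p] (f : ZMod p → M) :
    ∑ s ∈ Finset.range p, f s = ∑ a, f a := by
  refine Finset.sum_nbij' (fun s => (s : ZMod p)) ZMod.val (by simp) ?_ ?_ (by simp) (by simp)
  · intro a _; simpa using ZMod.val_lt a
  · intro s hs; exact ZMod.val_cast_of_lt (Finset.mem_range.1 hs)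

theorem sum_eval_eq_neg_coeff {p : ℕ} [Fact p.Prime] (f : Polynomial (ZMod p))
    (hf : f.natDegree ≤ p - 1) : ∑ a, f.eval a = -f.coeff (p - 1) := by
  have hp := Fact.out (p := p.Prime)
  have hpow : ∀ i ∈ Finset.range (p - 1 + 1), ∑ a : ZMod p, f.coeff i * a ^ i =
      if i = p - 1 then -f.coeff i else 0 := by
    intro i hi
    rw [← Finset.mul_sum]
    split_ifs with h
    · have : ∑ a : ZMod p, a ^ i = -1 := by
        rw [h, Finset.sum_congr rfl fun a _ => ZMod.pow_card_sub_one a]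
        rw [Finset.sum_ite, Finset.sum_const_zero, add_zero, Finset.sum_const, nsmul_eq_mul, mul_one,
          Finset.filter_ne' Finset.univ (0 : ZMod p), Finset.card_erase_of_mem (Finset.mem_univ _),
          Finset.card_univ, ZMod.card, Nat.cast_sub hp.one_lt.le]
        simp
      rw [this]; ring
    · rw [FiniteField.sum_pow_lt_card_sub_one, mul_zero]
      rw [ZMod.card]
      have := Finset.mem_range.1 hi
      omega
  simp_rw [Polynomial.eval_eq_sum_range' (Nat.lt_succ_of_le hf)]
  rw [Finset.sum_comm, Finset.sum_congr rfl hpow]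
  simp

theorem sum_pow_mul_choose_cast {p : ℕ} (hp : p.Prime) {F : Type*} [Field F] [CharP F p] (n k : ℕ)
    (hnk : n + k ≤ p - 1) :
    (k.factorial : F) * ((∑ s ∈ Finset.range p, s ^ n * s.choose k : ℕ) : F) =
      if n + k = p - 1 then -1 else 0 := by
  have := Fact.mk hp
  have hmon : (Polynomial.X ^ n * descPochhammer (ZMod p) k).Monic :=
    (Polynomial.monic_X_pow n).mul (monic_descPochhammer _ _)
  have hdeg : (Polynomial.X ^ n * descPochhammer (ZMod p) k).natDegree = n + k := by
    rw [(Polynomial.monic_X_pow n).natDegree_mul (monic_descPochhammer _ _),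
      Polynomial.natDegree_X_pow, descPochhammer_natDegree]
  have e1 := sum_eval_eq_neg_coeff _ (hdeg.trans_le hnk)
  have e0 := sum_range_natCast_zmod p
    (fun a => (Polynomial.X ^ n * descPochhammer (ZMod p) k).eval a)
  replace e1 := e0.trans e1
  have e2 : (k.factorial : ZMod p) * ((∑ s ∈ Finset.range p, s ^ n * s.choose k : ℕ) : ZMod p) =
      if n + k = p - 1 then -1 else 0 := by
    rw [Nat.cast_sum, Finset.mul_sum]
    calc _ = ∑ s ∈ Finset.range p,
          (Polynomial.X ^ n * descPochhammer (ZMod p) k).eval (s : ZMod p) := by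
          refine Finset.sum_congr rfl fun s _ => ?_
          rw [Polynomial.eval_mul, Polynomial.eval_pow, Polynomial.eval_X,
            descPochhammer_eval_eq_descFactorial, Nat.descFactorial_eq_factorial_mul_choose]
          push_cast; ring
      _ = _ := by
          rw [e1]
          split_ifs with h
          · rw [← h, ← hdeg, hmon.coeff_natDegree]
          · rw [Polynomial.coeff_eq_zero_of_natDegree_lt (by omega), neg_zero]
  have e3 := congrArg (ZMod.castHom dvd_rfl F) e2
  rw [map_mul, map_natCast, map_natCast] at e3
  rw [e3]
  split_ifs <;> simp

theorem factorial_mul_factorial_eq {p : ℕ} (hp : p.Prime) {F : Type*} [Field F] [CharP F p] (j k : ℕ)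
    (h : j + k = p - 1) : (k.factorial : F) * j.factorial = (-1) ^ (j + 1) := by
  induction j generalizing k with
  | zero =>
    obtain rfl : k = p - 1 := by omega
    simp [natCast_factorial_sub_one hp]
  | succ j ih =>
    have e := ih (k + 1) (by omega)
    rw [Nat.factorial_succ] at e
    have hz : ((k + 1 : ℕ) : F) = -((j + 1 : ℕ) : F) := by
      have : ((k + 1 + (j + 1) : ℕ) : F) = 0 := by
        rw [show k + 1 + (j + 1) = p by have := hp.one_lt; omega]; exact CharP.cast_eq_zero F p
      push_cast at this ⊢
      linear_combination this
    rw [Nat.cast_mul, hz] at e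
    rw [Nat.factorial_succ, pow_succ, ← e]
    push_cast; ring

variable {K : Type*} [Field K] {A : ValuationSubring K}

theorem resid_div_eq {z w T : K} (hw : w ∈ A) (hT : T ≠ 0)
    (hz : A.valuation (z - w * T) < A.valuation T) : z / T ∈ A ∧ resid A (z / T) = resid A w := by
  have hv : A.valuation (z / T - w) < 1 := by
    rw [show z / T - w = (z - w * T) / T by field_simp, map_div₀,
      div_lt_one₀ (zero_lt_iff.2 ((Valuation.ne_zero_iff _).2 hT))]
    exact hz
  have hm : z / T ∈ A := by
    have := add_mem (mem_of_valuation_lt_one hv) hw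
    rwa [sub_add_cancel] at this
  exact ⟨hm, (resid_eq_iff hm hw).2 hv⟩

namespace FermatKernel

variable {p : ℕ} {x y : ℕ → K} (h : FermatKernel A p x y) {P Q : K} (hpP : (p : K) = P * Q)
  (hQ : A.valuation Q = 1) (hx : ∏ s ∈ Finset.Icc 1 (p - 1), x s = P)
include h hpP hQ hx

theorem resid_gaussSum {n : ℕ} (hpn : p = 3 * n + 1) {ζ : K} (hζ : IsPrimitiveRoot ζ p)
    (c : ℕ → K) (hc : ∀ s ∈ Finset.Icc 1 (p - 1), A.valuation (c s - s ^ n) ≤ A.valuation P) :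
    (∑ s ∈ Finset.Icc 1 (p - 1), c s * ζ ^ s) / x 1 ^ (2 * n) ∈ A ∧
      resid A ((∑ s ∈ Finset.Icc 1 (p - 1), c s * ζ ^ s) / x 1 ^ (2 * n)) =
      n.factorial * resid A ((ζ - 1) / x 1) ^ (2 * n) := by
  have := h.charP
  have hp := h.prime
  have h7 := h.seven_le
  have hζp := hζ.pow_eq_one
  have hζ1 : ζ ≠ 1 := hζ.ne_one hp.one_lt
  have mδ := h.root_div_mem hpP hQ hx hζp
  have vt0 := h.valuation_t_ne
  have vtpos := zero_lt_iff.2 vt0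
  have hvζ := h.valuation_root_sub_one hpP hQ hx hζp hζ1
  have hvp := h.valuation_p hpP hQ hx
  set C : ℕ → ℕ := fun k => ∑ s ∈ Finset.range p, s ^ n * s.choose k with hC
  have hlt : ∀ {i j : ℕ}, i < j → A.valuation (x 1) ^ j < A.valuation (x 1) ^ i := fun hij =>
    pow_lt_pow_right_of_lt_one₀ vtpos (h.x_small 1) hij
  have hCk : ∀ k, k < 2 * n → A.valuation (C k : K) ≤ A.valuation (x 1) ^ (p - 1) := by
    intro k hk
    have := Fact.mk hp
    have e := sum_pow_mul_choose_cast hp (F := ZMod p) n k (by omega)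
    rw [if_neg (by omega)] at e
    have hk0 : (k.factorial : ZMod p) ≠ 0 := by
      rw [Ne, ZMod.natCast_eq_zero_iff, hp.dvd_factorial]; omega
    have hd := (ZMod.natCast_eq_zero_iff _ _).1 ((mul_eq_zero.1 e).resolve_left hk0)
    obtain ⟨m, hm⟩ := hd
    rw [show C k = p * m from hm, Nat.cast_mul, map_mul, hvp]
    exact mul_le_of_le_one_right' ((A.valuation_le_one_iff _).2 (natCast_mem A m))
  have hsum : ∑ s ∈ Finset.Icc 1 (p - 1), (s : K) ^ n * ζ ^ s =
      ∑ k ∈ Finset.range p, (C k : K) * (ζ - 1) ^ k := by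
    have e1 : ∑ s ∈ Finset.Icc 1 (p - 1), (s : K) ^ n * ζ ^ s =
        ∑ s ∈ Finset.range p, (s : K) ^ n * ζ ^ s := by
      refine Finset.sum_subset (fun s hs => ?_) fun s hs hs' => ?_
      · simp at hs ⊢; omega
      · have : s = 0 := by simp at hs hs'; omega
        rw [this, Nat.cast_zero, zero_pow (by omega), zero_mul]
    rw [e1]
    simp only [hC, Nat.cast_sum, Finset.sum_mul]
    rw [Finset.sum_comm]
    refine Finset.sum_congr rfl fun s hs => ?_
    have e2 : ζ ^ s = ∑ k ∈ Finset.range (s + 1), (ζ - 1) ^ k * s.choose k := by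
      have := add_pow (ζ - 1) 1 s
      simpa using this
    rw [e2, Finset.mul_sum]
    refine (Finset.sum_subset (Finset.range_subset_range.2 (Finset.mem_range.1 hs)) ?_).trans
      (Finset.sum_congr rfl fun k _ => by push_cast; ring)
    intro k _ hk
    rw [Nat.choose_eq_zero_of_lt (by simpa using hk)]; simp
  have key : A.valuation (∑ s ∈ Finset.Icc 1 (p - 1), c s * ζ ^ s -
      (C (2 * n) : K) * ((ζ - 1) / x 1) ^ (2 * n) * x 1 ^ (2 * n)) <
      A.valuation (x 1 ^ (2 * n)) := by
    have e : ∑ s ∈ Finset.Icc 1 (p - 1), c s * ζ ^ s -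
        (C (2 * n) : K) * ((ζ - 1) / x 1) ^ (2 * n) * x 1 ^ (2 * n) =
        ∑ s ∈ Finset.Icc 1 (p - 1), (c s - s ^ n) * ζ ^ s +
        ∑ k ∈ (Finset.range p).erase (2 * n), (C k : K) * (ζ - 1) ^ k := by
      have e1 := Finset.add_sum_erase (Finset.range p) (fun k => (C k : K) * (ζ - 1) ^ k)
        (Finset.mem_range.2 (show 2 * n < p by omega))
      have e2 : (C (2 * n) : K) * ((ζ - 1) / x 1) ^ (2 * n) * x 1 ^ (2 * n) =
          C (2 * n) * (ζ - 1) ^ (2 * n) := by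
        rw [mul_assoc, ← mul_pow, div_mul_cancel₀ _ h.x_one_ne]
      simp only [sub_mul, Finset.sum_sub_distrib]
      rw [hsum, ← e1, e2]; ring
    rw [e, map_pow]
    refine Valuation.map_add_lt _ ?_ ?_
    · refine Valuation.map_sum_lt _ (pow_ne_zero _ vt0) fun s hs => ?_
      rw [map_mul, map_pow, valuation_eq_one_of_pow hp.ne_zero hζp, one_pow, mul_one]
      refine (hc s hs).trans_lt ?_
      rw [h.valuation_P hx]
      exact hlt (by omega)
    · refine Valuation.map_sum_lt _ (pow_ne_zero _ vt0) fun k hk => ?_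
      obtain ⟨hk1, hk2⟩ := Finset.mem_erase.1 hk
      rw [map_mul, map_pow, hvζ]
      rcases lt_or_gt_of_ne hk1 with hk3 | hk3
      · calc _ ≤ A.valuation (x 1) ^ (p - 1) * 1 := by
              gcongr
              · exact hCk k hk3
              · exact pow_le_one₀ zero_le (h.x_small 1).le
          _ < _ := by rw [mul_one]; exact hlt (by omega)
      · exact (mul_le_of_le_one_left' ((A.valuation_le_one_iff _).2 (natCast_mem A _))).trans_lt
          (hlt hk3)
  obtain ⟨hm, hr⟩ := resid_div_eq (mul_mem (natCast_mem A _) (pow_mem mδ _))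
    (pow_ne_zero _ h.x_one_ne) key
  refine ⟨hm, hr.trans ?_⟩
  rw [resid_mul (natCast_mem A _) (pow_mem mδ _), resid_pow mδ, resid_natCast]
  congr 1
  have e1 := sum_pow_mul_choose_cast hp (F := IsLocalRing.ResidueField A) n (2 * n) (by omega)
  rw [if_pos (by omega)] at e1
  have e2 := factorial_mul_factorial_eq hp (F := IsLocalRing.ResidueField A) n (2 * n) (by omega)
  have hn : Even n := by
    rcases Nat.even_or_odd n with hn | ⟨m, hm⟩
    · exact hn
    · have h2 := (Nat.prime_dvd_prime_iff_eq Nat.prime_two hp).1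
        (show 2 ∣ p from ⟨3 * m + 2, by omega⟩)
      omega
  rw [pow_succ, hn.neg_one_pow, one_mul] at e2
  have h0 : ((2 * n).factorial : IsLocalRing.ResidueField A) ≠ 0 := by
    rintro e; rw [e, zero_mul] at e2; simp at e2
  exact mul_left_cancel₀ h0 (e1.trans e2.symm)

end FermatKernel

end

section

theorem rho3_eq : ρ3 = ⟨-1 / 2, Real.sqrt 3 / 2⟩ := by
  have h : ρ3 = Complex.exp (((2 * Real.pi / 3 : ℝ) : ℂ) * I) := by
    rw [ρ3]; congr 1; push_cast; ring
  have h2 : 2 * Real.pi / 3 = Real.pi - Real.pi / 3 := by ring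
  rw [h, Complex.exp_mul_I, ← Complex.ofReal_cos, ← Complex.ofReal_sin, h2, Real.cos_pi_sub,
    Real.sin_pi_sub, Real.cos_pi_div_three, Real.sin_pi_div_three]
  apply Complex.ext <;> simp; norm_num

theorem rho3_sq_add : ρ3 ^ 2 + ρ3 + 1 = 0 := by
  have h := Real.mul_self_sqrt (show (0 : ℝ) ≤ 3 by norm_num)
  rw [rho3_eq]
  apply Complex.ext
  · simp [pow_two]; nlinarith
  · simp [pow_two]; ring

theorem rho3_cube : ρ3 ^ 3 = 1 := by linear_combination (ρ3 - 1) * rho3_sq_add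

theorem rho3_ne_zero : ρ3 ≠ 0 := fun h => by simpa [h] using rho3_cube

theorem conj_rho3 : (starRingEnd ℂ) ρ3 = ρ3 ^ 2 := by
  have : (starRingEnd ℂ) ρ3 = -1 - ρ3 := by
    rw [rho3_eq]
    apply Complex.ext <;> simp; norm_num
  rw [this]; linear_combination -rho3_sq_add

theorem rho3_mem : ρ3 ∈ O3 := Subring.subset_closure rfl

theorem mem_O3_iff {z : ℂ} : z ∈ O3 ↔ ∃ a b : ℤ, z = a + b * ρ3 := by
  constructor
  · intro hz
    induction hz using Subring.closure_induction with
    | mem x hx => exact ⟨0, 1, by simpa using hx⟩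
    | zero => exact ⟨0, 0, by simp⟩
    | one => exact ⟨1, 0, by simp⟩
    | add x y _ _ hx hy =>
      obtain ⟨a, b, rfl⟩ := hx
      obtain ⟨c, d, rfl⟩ := hy
      exact ⟨a + c, b + d, by push_cast; ring⟩
    | neg x _ hx =>
      obtain ⟨a, b, rfl⟩ := hx
      exact ⟨-a, -b, by push_cast; ring⟩
    | mul x y _ _ hx hy =>
      obtain ⟨a, b, rfl⟩ := hx
      obtain ⟨c, d, rfl⟩ := hy
      exact ⟨a * c - b * d, a * d + b * c - b * d, by
        push_cast; linear_combination (b * d : ℂ) * rho3_sq_add⟩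
  · rintro ⟨a, b, rfl⟩
    exact add_mem (intCast_mem O3 a) (mul_mem (intCast_mem O3 b) rho3_mem)

theorem conj_mem_O3 {z : ℂ} (hz : z ∈ O3) : (starRingEnd ℂ) z ∈ O3 := by
  obtain ⟨a, b, rfl⟩ := mem_O3_iff.1 hz
  simp only [map_add, map_mul, map_intCast, conj_rho3]
  exact add_mem (intCast_mem O3 a) (mul_mem (intCast_mem O3 b) (pow_mem rho3_mem 2))

theorem add_mul_conj (a b : ℤ) : ((a : ℂ) + b * ρ3) * (starRingEnd ℂ) (a + b * ρ3) =
    ((a ^ 2 - a * b + b ^ 2 : ℤ) : ℂ) := by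
  simp only [map_add, map_mul, map_intCast, conj_rho3]
  push_cast
  linear_combination (a * b : ℂ) * rho3_sq_add + (b ^ 2 : ℂ) * rho3_cube

theorem exists_normSq_eq {z : ℂ} (hz : z ∈ O3) : ∃ n : ℤ, Complex.normSq z = n := by
  obtain ⟨a, b, rfl⟩ := mem_O3_iff.1 hz
  refine ⟨a ^ 2 - a * b + b ^ 2, ?_⟩
  have := add_mul_conj a b
  rw [Complex.mul_conj] at this
  exact_mod_cast this

theorem eq_zero_of_normSq_lt_one {z : ℂ} (hz : z ∈ O3) (h : Complex.normSq z < 1) : z = 0 := by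
  obtain ⟨n, hn⟩ := exists_normSq_eq hz
  have h0 := Complex.normSq_nonneg z
  rw [hn] at h h0
  have : n = 0 := by
    have h1 : n < 1 := by exact_mod_cast h
    have h2 : 0 ≤ n := by exact_mod_cast h0
    omega
  rw [this] at hn
  exact Complex.normSq_eq_zero.1 (by exact_mod_cast hn)

/-- The data of a prime of `ℤ[ρ]` of degree one with its coordinates. -/
structure SplitPrime (p : ℕ) (π : ℂ) (a b : ℤ) : Prop where
  prime : p.Prime
  norm : (p : ℂ) = π * (starRingEnd ℂ) π
  eq : π = a + b * ρ3

namespace SplitPrime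

variable {p : ℕ} {π : ℂ} {a b : ℤ} (h : SplitPrime p π a b)
include h

theorem norm_int : (p : ℤ) = a ^ 2 - a * b + b ^ 2 := by
  have := h.norm
  rw [h.eq, add_mul_conj] at this
  exact_mod_cast this

theorem not_dvd_b : ¬ (p : ℤ) ∣ b := by
  intro hb
  have hp := Nat.prime_iff_prime_int.1 h.prime
  have e := h.norm_int
  have ha : (p : ℤ) ∣ a := by
    refine hp.dvd_of_dvd_pow (n := 2) ?_
    rw [show a ^ 2 = p + b * (a - b) by rw [e]; ring]
    exact dvd_add dvd_rfl (hb.mul_right _)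
  obtain ⟨c, rfl⟩ := ha
  obtain ⟨d, rfl⟩ := hb
  have h1 : (p : ℤ) * 1 = p * (p * (c ^ 2 - c * d + d ^ 2)) := by rw [mul_one]; nth_rw 1 [e]; ring
  have h2 := mul_left_cancel₀ hp.ne_zero h1
  exact hp.not_isUnit (IsUnit.of_mul_eq_one _ h2.symm)

theorem mem : π ∈ O3 := mem_O3_iff.2 ⟨a, b, h.eq⟩

theorem ne_zero : π ≠ 0 := by
  rintro rfl
  have := h.norm
  rw [zero_mul] at this
  exact h.prime.ne_zero (by exact_mod_cast this)

theorem conj_sub_sq : (π - (starRingEnd ℂ) π) ^ 2 = -3 * (b : ℂ) ^ 2 := by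
  rw [h.eq]
  simp only [map_add, map_mul, map_intCast, conj_rho3]
  linear_combination (b : ℂ) ^ 2 * ((ρ3 ^ 2 - 3 * ρ3 + 3) * rho3_sq_add)

theorem exists_int_congr {z : ℂ} (hz : z ∈ O3) : ∃ k : ℤ, ECong z k π := by
  obtain ⟨c, hc⟩ : ∃ c : ℤ, (p : ℤ) ∣ b * c - 1 := by
    have : IsCoprime (p : ℤ) b :=
      ((Nat.prime_iff_prime_int.1 h.prime).coprime_iff_not_dvd).2 h.not_dvd_b
    obtain ⟨u, v, huv⟩ := this
    exact ⟨v, -u, by linear_combination huv⟩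
  obtain ⟨m, hm⟩ := hc
  have hm' : (b * c - 1 : ℂ) = p * m := by exact_mod_cast hm
  obtain ⟨r, s, rfl⟩ := mem_O3_iff.1 hz
  refine ⟨r - s * (a * c), s * (c - (starRingEnd ℂ) π * (m * ρ3)), ?_, ?_⟩
  · exact mul_mem (intCast_mem O3 s) (sub_mem (intCast_mem O3 c)
      (mul_mem (conj_mem_O3 h.mem) (mul_mem (intCast_mem O3 m) rho3_mem)))
  · push_cast
    have e := h.norm
    have e2 := h.eq
    linear_combination (-(s : ℂ) * ρ3) * hm' - (s : ℂ) * m * ρ3 * e - (s : ℂ) * c * e2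

theorem exists_nat_congr {z : ℂ} (hz : z ∈ O3) : ∃ k < p, ECong z (k : ℂ) π := by
  obtain ⟨k, d, hd, e⟩ := h.exists_int_congr hz
  have hp0 : (0 : ℤ) < p := by exact_mod_cast h.prime.pos
  refine ⟨(k % p).toNat, ?_, d + (starRingEnd ℂ) π * ((k / p : ℤ) : ℂ),
    add_mem hd (mul_mem (conj_mem_O3 h.mem) (intCast_mem O3 _)), ?_⟩
  · have := Int.emod_lt_of_pos k hp0
    have := Int.emod_nonneg k hp0.ne'
    omega
  · have h1 : (((k % p).toNat : ℕ) : ℂ) = ((k % p : ℤ) : ℂ) := by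
      have := Int.toNat_of_nonneg (Int.emod_nonneg k hp0.ne')
      exact_mod_cast congrArg (fun z : ℤ => (z : ℂ)) this
    have h2 : (k : ℂ) = ((k % p : ℤ) : ℂ) + (p : ℂ) * ((k / p : ℤ) : ℂ) := by
      exact_mod_cast congrArg (fun z : ℤ => (z : ℂ)) (Int.emod_add_mul_ediv k p).symm
    rw [h1]
    linear_combination e + h2 + ((k / p : ℤ) : ℂ) * h.norm

theorem exists_valuationSubring :
    ∃ A : ValuationSubring ℂ, (∀ z ∈ O3, z ∈ A) ∧ A.valuation π < 1 := by
  have hI : Ideal.span {(⟨π, h.mem⟩ : O3)} ≠ ⊤ := by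
    intro e
    obtain ⟨⟨u, hu⟩, hu1⟩ := Ideal.mem_span_singleton'.1 ((Ideal.eq_top_iff_one _).1 e)
    have e1 : u * π = 1 := congrArg Subtype.val hu1
    have e2 : u * (starRingEnd ℂ) u * p = 1 * (starRingEnd ℂ) 1 := by
      rw [h.norm, ← e1, map_mul]; ring
    obtain ⟨n, hn⟩ := exists_normSq_eq hu
    rw [Complex.mul_conj, hn] at e2
    have e3 : (n : ℤ) * p = 1 := by
      rw [map_one, mul_one] at e2; exact_mod_cast e2
    exact (Nat.prime_iff_prime_int.1 h.prime).not_isUnit (IsUnit.of_mul_eq_one_right _ e3)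
  obtain ⟨A, hA, hI'⟩ := Ideal.image_subset_nonunits_valuationSubring _ hI
  refine ⟨A, fun z hz => hA hz, ?_⟩
  exact (ValuationSubring.mem_nonunits_iff _).1
    (hI' ⟨⟨π, h.mem⟩, Ideal.mem_span_singleton_self _, rfl⟩)

section Valuation

variable {A : ValuationSubring ℂ} (hA : ∀ z ∈ O3, z ∈ A) (hπ : A.valuation π < 1)
include hA hπ

theorem valuation_p_lt : A.valuation (p : ℂ) < 1 := by
  rw [h.norm, map_mul]
  exact mul_lt_one_of_lt_of_le hπ ((A.valuation_le_one_iff _).2 (hA _ (conj_mem_O3 h.mem)))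

theorem resid_congr {z w : ℂ} (hw : w ∈ O3) (hzw : ECong z w π) : resid A z = resid A w := by
  obtain ⟨d, hd, e⟩ := hzw
  have hz : z = w + π * d := by linear_combination e
  have m := mul_mem h.mem hd
  rw [hz, resid_add (hA _ hw) (hA _ m), resid_mul (hA _ h.mem) (hA _ hd), resid_eq_zero hπ,
    zero_mul, add_zero]

theorem intCast_valuation_lt {k : ℤ} (hk : A.valuation (k : ℂ) < 1) : (p : ℤ) ∣ k := by
  have := charP_residueField (A := A) h.prime (h.valuation_p_lt hA hπ)
  refine (CharP.intCast_eq_zero_iff (IsLocalRing.ResidueField A) p k).1 ?_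
  rw [← resid_intCast, resid_eq_zero hk]

theorem cong_zero_of_valuation_lt {z : ℂ} (hz : z ∈ O3) (hv : A.valuation z < 1) :
    ECong z 0 π := by
  obtain ⟨k, hk⟩ := h.exists_int_congr hz
  have e := h.resid_congr hA hπ (intCast_mem O3 k) hk
  rw [resid_eq_zero hv] at e
  obtain ⟨m, rfl⟩ := h.intCast_valuation_lt hA hπ
    ((resid_eq_zero_iff (hA _ (intCast_mem O3 k))).1 e.symm)
  obtain ⟨d, hd, e⟩ := hk
  refine ⟨d + (starRingEnd ℂ) π * m, add_mem hd (mul_mem (conj_mem_O3 h.mem) (intCast_mem O3 m)), ?_⟩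
  push_cast at e
  linear_combination e + m * h.norm

theorem valuation_conj (h3 : p ≠ 3) : A.valuation ((starRingEnd ℂ) π) = 1 := by
  have hm := hA _ (conj_mem_O3 h.mem)
  refine (resid_ne_zero_iff hm).1 fun e => ?_
  have hv := (resid_eq_zero_iff hm).1 e
  have e2 : A.valuation ((-3 * b ^ 2 : ℤ) : ℂ) < 1 := by
    have := h.conj_sub_sq
    push_cast
    rw [← this, map_pow]
    exact pow_lt_one₀ zero_le (Valuation.map_sub_lt _ hπ hv) (by norm_num)
  have hp := Nat.prime_iff_prime_int.1 h.prime
  rcases hp.dvd_or_dvd (h.intCast_valuation_lt hA hπ e2) with h' | h'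
  · have : (p : ℤ) ∣ (3 : ℕ) := by simpa using h'
    exact h3 ((Nat.prime_dvd_prime_iff_eq h.prime Nat.prime_three).1 (by exact_mod_cast this))
  · exact h.not_dvd_b (hp.dvd_of_dvd_pow h')

theorem coprime_iff {z : ℂ} (hz : z ∈ O3) : ECoprime z π ↔ A.valuation z = 1 := by
  rw [← resid_ne_zero_iff (hA z hz)]
  constructor
  · rintro ⟨u, hu, v, hv, e⟩ hz0
    have := congrArg (resid A) e
    rw [resid_add (hA _ (mul_mem hu hz)) (hA _ (mul_mem hv h.mem)), resid_mul (hA _ hu) (hA _ hz),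
      resid_mul (hA _ hv) (hA _ h.mem), hz0, resid_eq_zero hπ, resid_one] at this
    simp at this
  · intro hz0
    obtain ⟨k, d, hd, e⟩ := h.exists_int_congr hz
    have hk : ¬ (p : ℤ) ∣ k := by
      rintro ⟨m, rfl⟩
      apply hz0
      rw [h.resid_congr hA hπ (zero_mem O3) (z := z)
        ⟨d + (starRingEnd ℂ) π * m, add_mem hd (mul_mem (conj_mem_O3 h.mem) (intCast_mem O3 m)), ?_⟩,
        resid_zero]
      push_cast at e
      linear_combination e + m * h.norm
    obtain ⟨u, v, huv⟩ := ((Nat.prime_iff_prime_int.1 h.prime).coprime_iff_not_dvd).2 hk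
    have huv' : (u * p + v * k : ℂ) = 1 := by exact_mod_cast huv
    refine ⟨v, intCast_mem O3 v, u * (starRingEnd ℂ) π - v * d, sub_mem (mul_mem (intCast_mem O3 u)
      (conj_mem_O3 h.mem)) (mul_mem (intCast_mem O3 v) hd), ?_⟩
    linear_combination huv' + v * e - u * h.norm

end Valuation

end SplitPrime

end

section

theorem mem_O3_of_cube_eq_one {z : ℂ} (hz : z ^ 3 = 1) : z ∈ O3 := by
  have e : (z - 1) * ((z - ρ3) * (z - ρ3 ^ 2)) = 0 := by
    linear_combination hz + (z - z ^ 2) * rho3_sq_add + (z - 1) * rho3_cube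
  rcases mul_eq_zero.1 e with e | e
  · rw [sub_eq_zero.1 e]; exact one_mem O3
  rcases mul_eq_zero.1 e with e | e
  · rw [sub_eq_zero.1 e]; exact rho3_mem
  · rw [sub_eq_zero.1 e]; exact pow_mem rho3_mem 2

theorem isPrimitiveRoot_rho3 : IsPrimitiveRoot ρ3 3 := by
  have h1 : ρ3 ≠ 1 := fun e => by
    have := rho3_sq_add
    rw [e] at this
    norm_num at this
  have := orderOf_eq_prime rho3_cube h1
  exact this ▸ IsPrimitiveRoot.orderOf ρ3

theorem IsCubicChar.mem_O3 {p : ℕ} {π : ℂ} {χ : ℂ → ℂ} (hχ : IsCubicChar π p χ) (k : ℕ) : χ k ∈ O3 := by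
  by_cases hk : ECoprime (k : ℂ) π
  · exact mem_O3_of_cube_eq_one (hχ.cube _ (natCast_mem O3 k) hk)
  · rw [hχ.resChar.vanish _ (natCast_mem O3 k) hk]; exact zero_mem O3

namespace SplitPrime

variable {p : ℕ} {π : ℂ} {a b : ℤ} (h : SplitPrime p π a b)
include h

theorem cong_natCast {k l : ℕ} (e : (k : ZMod p) = l) : ECong (k : ℂ) (l : ℂ) π := by
  have : (p : ℤ) ∣ (k - l : ℤ) := by
    rw [← ZMod.intCast_zmod_eq_zero_iff_dvd]; push_cast; rw [e, sub_self]
  obtain ⟨m, hm⟩ := this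
  refine ⟨(starRingEnd ℂ) π * m, mul_mem (conj_mem_O3 h.mem) (intCast_mem O3 m), ?_⟩
  have hm' : (k - l : ℂ) = p * m := by exact_mod_cast hm
  rw [hm', h.norm]; ring

variable {χ : ℂ → ℂ} (hχ : IsCubicChar π p χ)
include hχ

theorem resid_char {A : ValuationSubring ℂ} (hA : ∀ z ∈ O3, z ∈ A) (hπ : A.valuation π < 1)
    (h3 : p % 3 = 1) (k : ℕ) : resid A (χ k) = (k : IsLocalRing.ResidueField A) ^ ((p - 1) / 3) := by
  by_cases hk : ECoprime (k : ℂ) π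
  · rw [h.resid_congr hA hπ (pow_mem (natCast_mem O3 k) _) (hχ.euler _ (natCast_mem O3 k) hk),
      resid_pow (natCast_mem A k), resid_natCast]
  · have hp := h.prime.two_le
    rw [hχ.resChar.vanish _ (natCast_mem O3 k) hk, resid_zero]
    rw [h.coprime_iff hA hπ (natCast_mem O3 k), ← resid_ne_zero_iff (natCast_mem A k), not_not,
      resid_natCast] at hk
    rw [hk, zero_pow]
    omega

end SplitPrime

/-- The cubic residue character as a multiplicative character of `ℤ/p`. -/
noncomputable def cubicMulChar {p : ℕ} {π : ℂ} {a b : ℤ} (h : SplitPrime p π a b) {χ : ℂ → ℂ}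
    (hχ : IsCubicChar π p χ) : MulChar (ZMod p) ℂ where
  toFun c := χ (c.val : ℂ)
  map_one' := by
    have := Fact.mk h.prime
    rw [ZMod.val_one, Nat.cast_one, hχ.resChar.map_one]
  map_mul' c d := by
    have := NeZero.mk h.prime.ne_zero
    rw [← hχ.resChar.map_mul _ (natCast_mem O3 _) _ (natCast_mem O3 _), ← Nat.cast_mul]
    refine hχ.resChar.periodic _ (natCast_mem O3 _) _ (natCast_mem O3 _) (h.cong_natCast ?_)
    simp
  map_nonunit' c hc := by
    have := Fact.mk h.prime
    rw [isUnit_iff_ne_zero, not_not] at hc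
    rw [hc, ZMod.val_zero, Nat.cast_zero]
    refine hχ.resChar.vanish _ (zero_mem O3) ?_
    obtain ⟨A, hA, hπ⟩ := h.exists_valuationSubring
    rw [h.coprime_iff hA hπ (zero_mem O3)]
    simp

namespace SplitPrime

variable {p : ℕ} {π : ℂ} {a b : ℤ} (h : SplitPrime p π a b) {χ : ℂ → ℂ}
  (hχ : IsCubicChar π p χ)

theorem cubicMulChar_apply (c : ZMod p) : cubicMulChar h hχ c = χ (c.val : ℂ) := rfl

theorem gaussSum_cubicMulChar [NeZero p] :
    gaussSum (cubicMulChar h hχ) ZMod.stdAddChar = G3sum p χ := by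
  have hp := h.prime.pos
  have h0 : Finset.range p = insert 0 (Finset.Icc 1 (p - 1)) := by
    ext s; simp; omega
  rw [gaussSum, ← sum_range_natCast_zmod, h0, Finset.sum_insert (by simp), Nat.cast_zero,
    MulChar.map_nonunit _ (by have := Fact.mk h.prime; simp), zero_mul, zero_add, G3sum]
  refine Finset.sum_congr rfl fun s hs => ?_
  have hs' : s < p := by simp at hs; omega
  have e := ZMod.stdAddChar_coe (N := p) (s : ℤ)
  rw [Int.cast_natCast] at e
  rw [cubicMulChar_apply, ZMod.val_cast_of_lt hs', e]
  push_cast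
  rfl

theorem cubicMulChar_pow_three : cubicMulChar h hχ ^ 3 = 1 := by
  have := Fact.mk h.prime
  ext c
  rw [MulChar.pow_apply_coe, MulChar.one_apply_coe, cubicMulChar_apply]
  obtain ⟨A, hA, hπ⟩ := h.exists_valuationSubring
  refine hχ.cube _ (natCast_mem O3 _) ?_
  have := charP_residueField (A := A) h.prime (h.valuation_p_lt hA hπ)
  rw [h.coprime_iff hA hπ (natCast_mem O3 _), ← resid_ne_zero_iff (natCast_mem A _), resid_natCast,
    Ne, CharP.cast_eq_zero_iff _ p, ← ZMod.natCast_eq_zero_iff, ZMod.natCast_zmod_val]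
  exact c.ne_zero

theorem resid_cubicMulChar {A : ValuationSubring ℂ} (hA : ∀ z ∈ O3, z ∈ A)
    (hπ : A.valuation π < 1) (h3 : p % 3 = 1) [CharP (IsLocalRing.ResidueField A) p]
    (c : ZMod p) : resid A (cubicMulChar h hχ c) =
      ZMod.castHom dvd_rfl (IsLocalRing.ResidueField A) (c ^ ((p - 1) / 3)) := by
  have := NeZero.mk h.prime.ne_zero
  rw [cubicMulChar_apply, h.resid_char hχ hA hπ h3, map_pow]
  congr 1
  rw [ZMod.castHom_apply, ZMod.natCast_val]

theorem cubicMulChar_ne_one (h3 : p % 3 = 1) : cubicMulChar h hχ ≠ 1 := by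
  intro e
  have := Fact.mk h.prime
  have h2 := h.prime.two_le
  obtain ⟨A, hA, hπ⟩ := h.exists_valuationSubring
  have := charP_residueField (A := A) h.prime (h.valuation_p_lt hA hπ)
  have key (c : ZMod p) (hc : c ≠ 0) : c ^ ((p - 1) / 3) = 1 := by
    have e1 := h.resid_cubicMulChar hχ hA hπ h3 c
    rw [e, MulChar.one_apply hc.isUnit, resid_one] at e1
    exact (RingHom.injective _ (e1.symm.trans (map_one _).symm))
  have e2 := FiniteField.sum_pow_lt_card_sub_one (K := ZMod p) ((p - 1) / 3)
    (by rw [ZMod.card]; omega)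
  have e3 := FiniteField.sum_pow_lt_card_sub_one (K := ZMod p) 0 (by rw [ZMod.card]; omega)
  rw [← Finset.add_sum_erase _ _ (Finset.mem_univ 0)] at e2 e3
  rw [Finset.sum_congr rfl fun c hc => key c (Finset.ne_of_mem_erase hc), zero_pow (by omega)] at e2
  simp only [pow_zero, zero_add] at e2 e3
  rw [e2] at e3
  simp at e3

theorem jacobiSum_cubicMulChar (h3 : p % 3 = 1) (hprim : ECong π 1 3) [Fact p.Prime] :
    jacobiSum (cubicMulChar h hχ) (cubicMulChar h hχ) = -π := by
  set X := cubicMulChar h hχ with hX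
  have hp7 : 7 ≤ p := by
    have h2 := h.prime.two_le
    have : p ≠ 4 := by rintro rfl; exact absurd h.prime (by norm_num)
    omega
  obtain ⟨A, hA, hπ⟩ := h.exists_valuationSubring
  have := charP_residueField (A := A) h.prime (h.valuation_p_lt hA hπ)
  have hmem (c : ZMod p) : X c ∈ O3 := hχ.mem_O3 _
  have hJ : jacobiSum X X ∈ O3 := sum_mem fun c _ => mul_mem (hmem _) (hmem _)
  have hres : resid A (jacobiSum X X) = 0 := by
    rw [jacobiSum, resid_sum _ _ fun c _ => mul_mem (hA _ (hmem _)) (hA _ (hmem _))]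
    have e1 (c : ZMod p) : resid A (X c * X (1 - c)) = ZMod.castHom dvd_rfl
        (IsLocalRing.ResidueField A) ((Polynomial.X ^ ((p - 1) / 3) *
          (1 - Polynomial.X) ^ ((p - 1) / 3) : Polynomial (ZMod p)).eval c) := by
      rw [resid_mul (hA _ (hmem _)) (hA _ (hmem _)), h.resid_cubicMulChar hχ hA hπ h3,
        h.resid_cubicMulChar hχ hA hπ h3, ← map_mul]
      simp
    have hd : (Polynomial.X ^ ((p - 1) / 3) *
          (1 - Polynomial.X) ^ ((p - 1) / 3) : Polynomial (ZMod p)).natDegree < p - 1 := by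
      have d1 : (1 - Polynomial.X : Polynomial (ZMod p)).natDegree ≤ 1 := by
        compute_degree
      have d2 := Polynomial.natDegree_pow_le_of_le ((p - 1) / 3) d1
      have d3 := Polynomial.natDegree_mul_le_of_le
        (Polynomial.natDegree_X_pow_le (R := ZMod p) ((p - 1) / 3)) d2
      omega
    rw [Finset.sum_congr rfl fun c _ => e1 c, ← map_sum, sum_eval_eq_neg_coeff _ hd.le,
      Polynomial.coeff_eq_zero_of_natDegree_lt hd, neg_zero, map_zero]
  obtain ⟨d, hd, ed⟩ := h.cong_zero_of_valuation_lt hA hπ hJ ((resid_eq_zero_iff (hA _ hJ)).1 hres)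
  rw [sub_zero] at ed
  have hne := h.cubicMulChar_ne_one hχ h3
  have hX3 := h.cubicMulChar_pow_three hχ
  rw [← hX] at hne hX3
  have hconj : X.ringHomComp (starRingEnd ℂ) = X⁻¹ := by
    rw [← MulChar.star_eq_inv]; rfl
  have hnorm := jacobiSum_mul_jacobiSum_inv (χ := X) (φ := X) (by
      rw [ZMod.ringChar_zmod_n, ringChar.eq_zero]; exact h.prime.ne_zero.symm) hne hne (by
      intro e
      rw [pow_succ, pow_two, e, one_mul] at hX3
      exact hne hX3)
  rw [← hconj, jacobiSum_ringHomComp, ed, ZMod.card, map_mul] at hnorm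
  have hd1 : Complex.normSq d = 1 := by
    have : d * (starRingEnd ℂ) d = 1 := by
      have hp0 : (p : ℂ) ≠ 0 := by exact_mod_cast h.prime.ne_zero
      refine mul_left_cancel₀ hp0 ?_
      rw [mul_one]
      nth_rw 1 [h.norm]
      rw [← hnorm]; ring
    rw [Complex.mul_conj] at this
    exact_mod_cast this
  obtain ⟨z, hz, ez⟩ := exists_jacobiSum_eq_neg_one_add (n := 3) (by norm_num) hX3 hX3
    (by rw [ZMod.card]; omega) isPrimitiveRoot_rho3
  have hz' : z ∈ O3 := by
    clear ez
    induction hz using Algebra.adjoin_induction with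
    | mem x hx => rw [hx]; exact rho3_mem
    | algebraMap r => exact intCast_mem O3 r
    | add x y _ _ hx hy => exact add_mem hx hy
    | mul x y _ _ hx hy => exact mul_mem hx hy
  obtain ⟨w, hw, ew⟩ := hprim
  have key : d + 1 = 3 * (-(ρ3 * z) - w * d) := by
    linear_combination -ed + ez - d * ew + z * rho3_sq_add
  have he : -(ρ3 * z) - w * d = 0 := by
    refine eq_zero_of_normSq_lt_one (sub_mem (neg_mem (mul_mem rho3_mem hz')) (mul_mem hw hd)) ?_
    have e1 := congrArg Complex.normSq key
    rw [map_mul, Complex.normSq_apply 3] at e1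
    norm_num at e1
    have e2 : ‖d‖ = 1 := by
      rw [Complex.normSq_eq_norm_sq] at hd1
      nlinarith [norm_nonneg d]
    have e3 := norm_add_le d 1
    rw [Complex.normSq_eq_norm_sq (d + 1)] at e1
    rw [e2, norm_one] at e3
    nlinarith [norm_nonneg (d + 1)]
  rw [he, mul_zero] at key
  rw [ed, eq_neg_of_add_eq_zero_left key, mul_neg_one]

include h hχ in
theorem G3sum_pow_three (h3 : p % 3 = 1) (hprim : ECong π 1 3) : G3sum p χ ^ 3 = -(p * π) := by
  have := Fact.mk h.prime
  set X := cubicMulChar h hχ with hX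
  have hne := h.cubicMulChar_ne_one hχ h3
  have hX3 := h.cubicMulChar_pow_three hχ
  rw [← hX] at hne hX3
  have ho : orderOf X = 3 := orderOf_eq_prime hX3 hne
  have e := gaussSum_pow_eq_prod_jacobiSum (χ := X) (by rw [ho]; norm_num)
    (ZMod.isPrimitive_stdAddChar p)
  have h1 : X (-1) = 1 := by
    have : X (-1) = (X ^ 3) (-1) := by
      rw [MulChar.pow_apply' _ three_ne_zero, ← map_pow]; congr 1; ring
    rw [this, hX3, MulChar.one_apply isUnit_one.neg]
  rw [ho, h.gaussSum_cubicMulChar hχ, h1, ZMod.card] at e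
  rw [e]
  simp only [Nat.add_one_sub_one, Nat.Ico_succ_singleton, Finset.prod_singleton, pow_one, one_mul]
  rw [hX, h.jacobiSum_cubicMulChar hχ h3 hprim]; ring

end SplitPrime

end

section

namespace SplitPrime

variable {p : ℕ} {π : ℂ} {a b : ℤ} (h : SplitPrime p π a b)
include h

theorem exists_rep : ∃ rep : ℂ → ℕ, ∀ z ∈ O3, rep z < p ∧ ECong z (rep z : ℂ) π := by
  have : ∀ z : ℂ, ∃ k : ℕ, z ∈ O3 → k < p ∧ ECong z (k : ℂ) π := by
    intro z
    by_cases hz : z ∈ O3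
    · obtain ⟨k, hk, e⟩ := h.exists_nat_congr hz
      exact ⟨k, fun _ => ⟨hk, e⟩⟩
    · exact ⟨0, fun hz' => absurd hz' hz⟩
  choose rep hrep using this
  exact ⟨rep, hrep⟩

variable {A : ValuationSubring ℂ} (hA : ∀ z ∈ O3, z ∈ A) (hπ : A.valuation π < 1)
include hA hπ

theorem cong_iff_resid {z w : ℂ} (hz : z ∈ O3) (hw : w ∈ O3) :
    ECong z w π ↔ resid A z = resid A w := by
  refine ⟨h.resid_congr hA hπ hw, fun e => ?_⟩
  rw [resid_eq_iff (hA _ hz) (hA _ hw)] at e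
  obtain ⟨d, hd, e⟩ := h.cong_zero_of_valuation_lt hA hπ (sub_mem hz hw) e
  exact ⟨d, hd, by linear_combination e⟩

theorem coprime_iff_resid {z : ℂ} (hz : z ∈ O3) : ECoprime z π ↔ resid A z ≠ 0 := by
  rw [h.coprime_iff hA hπ hz, resid_ne_zero_iff (hA z hz)]

theorem coprime_natCast_iff {k : ℕ} : ECoprime (k : ℂ) π ↔ ¬ p ∣ k := by
  have := charP_residueField (A := A) h.prime (h.valuation_p_lt hA hπ)
  rw [h.coprime_iff_resid hA hπ (natCast_mem O3 k), resid_natCast, Ne, CharP.cast_eq_zero_iff _ p]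

theorem bijOn_rep {S : Finset ℂ} (hS : IsThirdSet π S) {rep : ℂ → ℕ}
    (hrep : ∀ z ∈ O3, rep z < p ∧ ECong z (rep z : ℂ) π) :
    Set.BijOn (fun q : ℂ × ℕ => rep (ρ3 ^ q.2 * q.1)) (S ×ˢ Finset.range 3 : Finset (ℂ × ℕ))
      (Finset.Icc 1 (p - 1) : Finset ℕ) := by
  have hmem : ∀ ν ∈ S, ∀ j : ℕ, ρ3 ^ j * ν ∈ O3 := fun ν hν j =>
    mul_mem (pow_mem rho3_mem j) (hS.1 ν hν).1
  have hres : ∀ z ∈ O3, resid A z = rep z := fun z hz => by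
    rw [← resid_natCast]; exact h.resid_congr hA hπ (natCast_mem O3 _) (hrep z hz).2
  have hε : ∀ j < 3, ρ3 ^ j ∈ ({1, ρ3, ρ3 ^ 2} : Set ℂ) := by
    intro j hj; interval_cases j <;> simp
  have hchar := charP_residueField (A := A) h.prime (h.valuation_p_lt hA hπ)
  refine ⟨?_, ?_, ?_⟩
  · rintro ⟨ν, j⟩ hq
    simp only [Finset.coe_product, Set.mem_prod, Finset.mem_coe, Finset.mem_range] at hq
    have h1 := (hrep _ (hmem ν hq.1 j)).1
    have h2 : rep (ρ3 ^ j * ν) ≠ 0 := by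
      intro e
      have e1 := hres _ (hmem ν hq.1 j)
      have hν := (h.coprime_iff_resid hA hπ (hS.1 ν hq.1).1).1 (hS.1 ν hq.1).2
      have hρ : resid A ρ3 ^ 3 = 1 := by rw [← resid_pow (hA _ rho3_mem), rho3_cube, resid_one]
      rw [e, resid_mul (hA _ (pow_mem rho3_mem j)) (hA _ (hS.1 ν hq.1).1),
        resid_pow (hA _ rho3_mem), Nat.cast_zero] at e1
      refine mul_ne_zero (pow_ne_zero _ ?_) hν e1
      intro e0; simp [e0] at hρ
    simp only [Finset.coe_Icc, Set.mem_Icc]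
    omega
  · rintro ⟨ν, j⟩ hq ⟨μ, k⟩ hq' e
    simp only [Finset.coe_product, Set.mem_prod, Finset.mem_coe, Finset.mem_range] at hq hq'
    have e' : rep (ρ3 ^ j * ν) = rep (ρ3 ^ k * μ) := e
    have e1 : ECong (ρ3 ^ j * ν) (ρ3 ^ k * μ) π := by
      rw [h.cong_iff_resid hA hπ (hmem ν hq.1 j) (hmem μ hq'.1 k), hres _ (hmem ν hq.1 j),
        hres _ (hmem μ hq'.1 k), e']
    obtain ⟨e2, e3⟩ := hS.2.2 ν hq.1 μ hq'.1 _ (hε j hq.2) _ (hε k hq'.2) e1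
    rw [e2, isPrimitiveRoot_rho3.pow_inj hq.2 hq'.2 e3]
  · intro s hs
    simp only [Finset.coe_Icc, Set.mem_Icc] at hs
    have hps : ¬ p ∣ s := Nat.not_dvd_of_pos_of_lt hs.1 (by omega)
    obtain ⟨ν, hν, ε, he, e⟩ := hS.2.1 s (natCast_mem O3 s)
      ((h.coprime_natCast_iff hA hπ).2 hps)
    obtain ⟨j, hj, rfl⟩ : ∃ j < 3, ε = ρ3 ^ j := by
      rcases he with rfl | rfl | rfl
      · exact ⟨0, by norm_num, by simp⟩
      · exact ⟨1, by norm_num, by simp⟩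
      · exact ⟨2, by norm_num, rfl⟩
    refine ⟨(ν, j), by simp [hν, hj], ?_⟩
    have e1 := h.resid_congr hA hπ (hmem ν hν j) e
    rw [hres _ (hmem ν hν j), resid_natCast] at e1
    have e2 := (CharP.natCast_eq_natCast (IsLocalRing.ResidueField A) p).1 e1
    exact (Nat.ModEq.eq_of_lt_of_lt e2 (by omega) (hrep _ (hmem ν hν j)).1).symm

theorem card_thirdSet {S : Finset ℂ} (hS : IsThirdSet π S) : S.card * 3 = p - 1 := by
  obtain ⟨rep, hrep⟩ := h.exists_rep
  have := h.bijOn_rep hA hπ hS hrep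
  have e := Finset.card_nbij _ this.mapsTo this.injOn this.surjOn
  simpa using e

theorem prod_thirdSet {S : Finset ℂ} (hS : IsThirdSet π S) {f : ℂ → ℂ}
    (hper : ∀ z w, ECong z w π → f z = f w) (hrot : ∀ z, f (ρ3 * z) = ρ3 * f z) :
    ∏ s ∈ Finset.Icc 1 (p - 1), f s = (∏ ν ∈ S, f ν) ^ 3 := by
  obtain ⟨rep, hrep⟩ := h.exists_rep
  have := h.bijOn_rep hA hπ hS hrep
  rw [← Finset.prod_nbij _ this.mapsTo this.injOn this.surjOn
    (f := fun q => f (ρ3 ^ q.2 * q.1)) (g := fun s : ℕ => f s), Finset.prod_product,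
    ← Finset.prod_pow]
  · refine Finset.prod_congr rfl fun ν hν => ?_
    simp only [Finset.prod_range_succ, Finset.prod_range_zero, pow_zero, one_mul, pow_one, pow_two,
      mul_assoc, hrot]
    linear_combination f ν ^ 3 * rho3_cube
  · rintro ⟨ν, j⟩ hq
    simp only [Finset.mem_product] at hq
    exact hper _ _ (hrep _ (mul_mem (pow_mem rho3_mem j) (hS.1 ν hq.1).1)).2

theorem thirdSet_cube_injOn {S : Finset ℂ} (hS : IsThirdSet π S) :
    Set.InjOn (fun ν => resid A ν ^ 3) (S : Set ℂ) := by
  intro ν hν μ hμ e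
  simp only [Finset.mem_coe] at hν hμ e
  have m := hA _ rho3_mem
  have hω : resid A ρ3 ^ 2 + resid A ρ3 + 1 = 0 := by
    rw [← resid_pow m, ← resid_one (A := A), ← resid_add (pow_mem m 2) m,
      ← resid_add (add_mem (pow_mem m 2) m) (one_mem A), rho3_sq_add, resid_zero]
  have e1 : (resid A ν - resid A μ) * ((resid A ν - resid A ρ3 * resid A μ) *
      (resid A ν - resid A ρ3 ^ 2 * resid A μ)) = 0 := by
    linear_combination e + (resid A ν * resid A μ ^ 2 * resid A ρ3 - resid A ν ^ 2 * resid A μ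
      - resid A μ ^ 3 * (resid A ρ3 - 1)) * hω
  have key (ε : ℂ) (hε : ε ∈ ({1, ρ3, ρ3 ^ 2} : Set ℂ)) (hm : ε ∈ O3)
      (e2 : resid A ν = resid A ε * resid A μ) : ν = μ := by
    refine (hS.2.2 ν hν μ hμ 1 (by simp) ε hε ?_).1
    rw [h.cong_iff_resid hA hπ (mul_mem (one_mem O3) (hS.1 ν hν).1) (mul_mem hm (hS.1 μ hμ).1),
      one_mul, resid_mul (hA _ hm) (hA _ (hS.1 μ hμ).1), e2]
  rcases mul_eq_zero.1 e1 with e1 | e1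
  · exact key 1 (by simp) (one_mem O3) (by rw [resid_one, one_mul]; exact sub_eq_zero.1 e1)
  rcases mul_eq_zero.1 e1 with e1 | e1
  · exact key ρ3 (by simp) rho3_mem (sub_eq_zero.1 e1)
  · exact key (ρ3 ^ 2) (by simp) (pow_mem rho3_mem 2)
      (by rw [resid_pow m]; exact sub_eq_zero.1 e1)

end SplitPrime

end

section

theorem natCast_pow_sub_one {p : ℕ} (hp : p.Prime) {F : Type*} [Field F] [CharP F p] {k : ℕ}
    (hk : (k : F) ≠ 0) : (k : F) ^ (p - 1) = 1 := by
  have := Fact.mk hp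
  have h1 : (k : ZMod p) ≠ 0 := fun e => hk (by
    have := congrArg (ZMod.castHom dvd_rfl F) e
    rwa [map_natCast, map_zero] at this)
  have := congrArg (ZMod.castHom dvd_rfl F) (ZMod.pow_card_sub_one_eq_one h1)
  rwa [map_pow, map_natCast, map_one] at this

/-- The properties of the function `φ` on torsion points which determine the cubic Gauss sum. -/
structure TorsionData (p : ℕ) (π : ℂ) (b : ℤ) (f : ℂ → ℂ) (y : ℕ → ℂ) : Prop where
  group : FermatGroup p (fun s => f (s / π)) y
  period : ∀ u, ∀ w ∈ O3, f (u + w) = f u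
  rotate : ∀ u, f (ρ3 * u) = ρ3 * f u
  conj : ∀ u, (starRingEnd ℂ) (f u) = f ((starRingEnd ℂ) u)
  prod : ∃ F : ℂ, F ^ 3 = 1 ∧ ∏ s ∈ Finset.Icc 1 (p - 1), f (s / π) = π * F ∧
    F * ∏ s ∈ Finset.Icc 1 (p - 1), y s = 1
  fourier : ∀ m : ℕ, ∑ s ∈ Finset.range p, Complex.exp (2 * Real.pi * I * (3 * b * m * s) / p) *
    f (s / π) = -π * f (m / (starRingEnd ℂ) π)

theorem conj_inv_of_cube {γ : ℂ} (hγ : γ ^ 3 = 1) : (starRingEnd ℂ) γ⁻¹ = γ := by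
  have h1 : ‖γ‖ = 1 := by
    have := congrArg norm hγ
    rw [norm_pow, norm_one] at this
    exact (pow_eq_one_iff_of_nonneg (norm_nonneg γ) three_ne_zero).1 this
  rw [Complex.inv_eq_conj h1, Complex.conj_conj]

theorem TorsionData.fourier_natCast {p : ℕ} {π : ℂ} {b : ℤ} {f : ℂ → ℂ} {y : ℕ → ℂ}
    (hf : TorsionData p π b f y) (hp : p ≠ 0) {B : ℕ} (hB : (B : ZMod p) = ((3 * b : ℤ) : ZMod p))
    (m : ℕ) : ∑ s ∈ Finset.range p, Complex.exp (2 * Real.pi * I / p) ^ (B * m * s) *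
      f (s / π) = -π * f (m / (starRingEnd ℂ) π) := by
  rw [← hf.fourier m]
  refine Finset.sum_congr rfl fun s _ => ?_
  congr 1
  have : (p : ℤ) ∣ (B - 3 * b : ℤ) := by
    rw [← ZMod.intCast_zmod_eq_zero_iff_dvd]; push_cast at hB ⊢; rw [hB, sub_self]
  obtain ⟨k, hk⟩ := this
  have hk' : (B : ℂ) = 3 * b + p * k := by
    have : (B - 3 * b : ℂ) = p * k := by exact_mod_cast hk
    linear_combination this
  have hp' : (p : ℂ) ≠ 0 := by exact_mod_cast hp
  rw [← Complex.exp_nat_mul, Complex.exp_eq_exp_iff_exists_int]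
  refine ⟨k * m * s, ?_⟩
  push_cast
  rw [hk']
  field_simp

namespace SplitPrime

variable {p : ℕ} {π : ℂ} {a b : ℤ} (h : SplitPrime p π a b)
include h

theorem G3sum_eq_of_torsionData (h3 : p % 3 = 1) (hprim : ECong π 1 3) {χ : ℂ → ℂ}
    (hχ : IsCubicChar π p χ) {S : Finset ℂ} (hS : IsThirdSet π S) {γ : ℂ}
    (hγ : IsGamma3 π S γ) {f : ℂ → ℂ} {y : ℕ → ℂ} (hf : TorsionData p π b f y) {πt : ℂ}
    (hπt : πt = γ⁻¹ * ∏ ν ∈ S, f (ν / π)) :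
    G3sum p χ = -(χ 3) * πt ^ 2 * (starRingEnd ℂ) πt := by
  obtain ⟨A, hA, hπ⟩ := h.exists_valuationSubring
  have hp := h.prime
  have hpA := h.valuation_p_lt hA hπ
  have hchar := charP_residueField (A := A) hp hpA
  set κ := IsLocalRing.ResidueField A
  obtain ⟨F, hF, hFx, hFy⟩ := hf.prod
  obtain ⟨hk, rfl⟩ := hf.group.kernel_of_prod hp h3 hpA h.ne_zero hπ hF hFx hFy
  rw [mul_one] at hFx
  set x : ℕ → ℂ := fun s => f (s / π) with hxdef
  obtain ⟨n, hn⟩ : ∃ n, p = 3 * n + 1 := ⟨p / 3, by omega⟩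
  have hn3 : (p - 1) / 3 = n := by omega
  have hp1 : p - 1 = 3 * n := by omega
  have h7 := hk.seven_le
  have hev : Even n := by
    have := hp.even_sub_one (by omega)
    rw [hp1] at this
    exact (Nat.even_mul.1 this).resolve_left (by decide)
  set c := (starRingEnd ℂ) π with hc
  have hcm : c ∈ O3 := conj_mem_O3 h.mem
  have hQ : A.valuation c = 1 := h.valuation_conj hA hπ (by omega)
  set ζ := Complex.exp (2 * Real.pi * I / p) with hζdef
  have hζ : IsPrimitiveRoot ζ p := Complex.isPrimitiveRoot_exp p hp.ne_zero
  have hζ1 : ζ ≠ 1 := hζ.ne_one (by omega)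
  set t := x 1 with ht
  have ht0 : t ≠ 0 := hk.x_one_ne
  set δ := resid A ((ζ - 1) / t) with hδ
  have hδ0 : δ ≠ 0 := hk.resid_root_div_ne_zero h.norm hQ hFx hζ.pow_eq_one hζ1
  have hδc : δ ^ (3 * n) = resid A c := by
    rw [← hp1]; exact hk.resid_root_div_pow h.norm hQ hFx hζ.pow_eq_one hζ1
  have hPt : resid A (π / t ^ (3 * n)) = -1 := by rw [← hp1]; exact hk.resid_P_div hFx
  -- periodicity modulo `π`
  have hper : ∀ z w, ECong z w π → f (z / π) = f (w / π) := by
    rintro z w ⟨d, hd, e⟩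
    have : z / π = w / π + d := by
      have := h.ne_zero
      field_simp; linear_combination e
    rw [this, hf.period _ _ hd]
  have hper' : ∀ z w, ECong z w π → f ((starRingEnd ℂ) (z / π)) = f ((starRingEnd ℂ) (w / π)) := by
    intro z w hzw
    rw [← hf.conj, ← hf.conj, hper z w hzw]
  -- the cube of `πt`
  have hcube : πt ^ 3 = π := by
    have e := h.prod_thirdSet hA hπ hS (f := fun z => f (z / π)) hper
      (fun z => by rw [mul_div_assoc, hf.rotate])
    rw [hFx] at e
    rw [hπt, mul_pow, ← e, inv_pow, hγ.1, inv_one, one_mul]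
  obtain ⟨rep, hrep⟩ := h.exists_rep
  have hScard : S.card = n := by have := h.card_thirdSet hA hπ hS; omega
  have hres : ∀ ν ∈ S, resid A ν = rep ν := fun ν hν => by
    rw [← resid_natCast]
    exact h.resid_congr hA hπ (natCast_mem O3 _) (hrep ν (hS.1 ν hν).1).2
  have hrne : ∀ ν ∈ S, ¬ p ∣ rep ν := fun ν hν => by
    have := (h.coprime_iff_resid hA hπ (hS.1 ν hν).1).1 (hS.1 ν hν).2
    rwa [hres ν hν, Ne, CharP.cast_eq_zero_iff _ p] at this
  set R : κ := ∏ ν ∈ S, (rep ν : κ) with hR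
  have mγ : A.valuation γ = 1 := valuation_eq_one_of_pow three_ne_zero hγ.1
  have hγR : resid A γ = -R := by
    rw [h.resid_congr hA hπ (neg_mem (prod_mem fun ν hν => (hS.1 ν hν).1)) hγ.2,
      resid_neg (prod_mem fun ν hν => hA _ (hS.1 ν hν).1),
      resid_prod _ _ fun ν hν => hA _ (hS.1 ν hν).1, hR, Finset.prod_congr rfl hres]
  have hR3 : R ^ 3 = -1 := by
    have := congrArg (resid A) hγ.1
    rw [resid_pow (mem_of_valuation_eq_one mγ), hγR, resid_one] at this
    linear_combination -this
  have hR0 : R ≠ 0 := by intro e; rw [e] at hR3; norm_num at hR3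
  -- the residue of `πt`
  have hπtm : πt / t ^ n ∈ A ∧ resid A (πt / t ^ n) = -1 := by
    have e : πt / t ^ n = γ⁻¹ * ∏ ν ∈ S, x (rep ν) / t := by
      rw [Finset.prod_div_distrib, Finset.prod_const, hScard, hπt, mul_div_assoc]
      congr 2
      exact Finset.prod_congr rfl fun ν hν => hper _ _ (hrep ν (hS.1 ν hν).1).2
    have m1 := inv_mem_of_valuation_eq_one mγ
    have m2 : ∀ ν ∈ S, x (rep ν) / t ∈ A := fun ν _ => hk.div_mem _
    refine ⟨e ▸ mul_mem m1 (prod_mem m2), ?_⟩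
    rw [e, resid_mul m1 (prod_mem m2), resid_prod _ _ m2, resid_inv mγ, hγR,
      Finset.prod_congr rfl fun ν _ => hk.resid_div_natCast (rep ν), ← hR]
    field_simp
  -- the residue of the conjugate of `πt`
  obtain ⟨B, hB⟩ : ∃ B : ℕ, (B : ZMod p) = ((3 * b : ℤ) : ZMod p) := by
    have := NeZero.mk hp.ne_zero
    exact ⟨(((3 * b : ℤ) : ZMod p)).val, by simp⟩
  have hBκ : (B : κ) = 3 * b := by
    have := congrArg (ZMod.castHom dvd_rfl κ) hB
    rw [map_natCast, map_intCast] at this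
    rw [this]; push_cast; ring
  have h3κ : (3 : κ) ≠ 0 := by
    intro e
    have : ((3 : ℕ) : κ) = 0 := by exact_mod_cast e
    rw [CharP.cast_eq_zero_iff κ p] at this
    have := Nat.le_of_dvd (by norm_num) this
    omega
  have hbκ : (b : κ) ≠ 0 := by
    rw [Ne, CharP.intCast_eq_zero_iff κ p]; exact h.not_dvd_b
  have hpB : ¬ p ∣ B := by
    rw [← CharP.cast_eq_zero_iff κ p, hBκ]; exact mul_ne_zero h3κ hbκ
  have hB2 : (B : κ) ^ 2 = -3 * resid A c ^ 2 := by
    have e := congrArg (resid A) h.conj_sub_sq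
    have mc := hA _ hcm
    have mp := hA _ h.mem
    have e3 : (-3 * (b : ℂ) ^ 2) = ((-3 * b ^ 2 : ℤ) : ℂ) := by push_cast; ring
    rw [resid_pow (sub_mem mp mc), resid_sub mp mc, resid_eq_zero hπ, e3, resid_intCast] at e
    push_cast at e
    rw [hBκ]; linear_combination 3 * e
  let r : Fin n → ℕ := fun i => rep ((S.equivFinOfCardEq hScard).symm i)
  have hprodr {M : Type} [CommMonoid M] (g : ℕ → M) : ∏ i, g (r i) = ∏ ν ∈ S, g (rep ν) := by
    rw [← Finset.prod_coe_sort S (fun ν => g (rep ν))]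
    exact Equiv.prod_comp (S.equivFinOfCardEq hScard).symm (fun ν : S => g (rep ν))
  have hrS (i : Fin n) : (((S.equivFinOfCardEq hScard).symm i : S) : ℂ) ∈ S :=
    ((S.equivFinOfCardEq hScard).symm i).2
  obtain ⟨hx'm, hx'⟩ := hk.resid_prod_conj h.norm hQ hFx hn hζ hpB
    (x' := fun m => f (m / c)) (hf.fourier_natCast hp.ne_zero hB) r (fun i => hrne _ (hrS i))
    (fun i j e => by
      have e1 := h.thirdSet_cube_injOn hA hπ hS (hrS i) (hrS j)
        (by simp only [hres _ (hrS i), hres _ (hrS j)]; exact e)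
      exact (S.equivFinOfCardEq hScard).symm.injective (Subtype.ext e1))
  rw [hprodr (fun k => resid A (f (k / c))), hprodr (fun k : ℕ => ((B : κ) * k * δ) ^ 2)] at hx'
  have hconjm : (starRingEnd ℂ) πt ∈ A ∧ resid A ((starRingEnd ℂ) πt) =
      -(9 ^ n * n.factorial * resid A c ^ (2 * n) * δ ^ (2 * n)) := by
    have e : (starRingEnd ℂ) πt = γ * ∏ ν ∈ S, f (rep ν / c) := by
      rw [hπt, map_mul, conj_inv_of_cube hγ.1, map_prod]
      congr 1
      refine Finset.prod_congr rfl fun ν hν => ?_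
      rw [hf.conj, hper' _ _ (hrep ν (hS.1 ν hν).1).2, map_div₀, map_natCast]
    have m1 := mem_of_valuation_eq_one mγ
    have m2 : ∀ ν ∈ S, f (rep ν / c) ∈ A := fun ν hν => hx'm _ (hrne ν hν)
    refine ⟨e ▸ mul_mem m1 (prod_mem m2), ?_⟩
    rw [e, resid_mul m1 (prod_mem m2), resid_prod _ _ m2, hγR]
    have e2 : ∏ ν ∈ S, ((B : κ) * rep ν * δ) ^ 2 = B ^ (2 * n) * R ^ 2 * δ ^ (2 * n) := by
      simp only [mul_pow, Finset.prod_mul_distrib, Finset.prod_const, hScard, hR, Finset.prod_pow,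
        pow_mul]
    have e3 : (B : κ) ^ (2 * n) = 3 ^ n * resid A c ^ (2 * n) := by
      rw [pow_mul, hB2, mul_pow, neg_pow, hev.neg_one_pow, one_mul, ← pow_mul]
    rw [e2, e3] at hx'
    have e9 : (9 : κ) ^ n = 3 ^ n * 3 ^ n := by rw [← mul_pow]; norm_num
    rw [e9]
    linear_combination R * hx' + 3 ^ n * n.factorial * (3 ^ n * resid A c ^ (2 * n)) *
      δ ^ (2 * n) * hR3
  -- the two sides divided by `t ^ (2 * n)`
  have hchi3 : resid A (χ 3) = 3 ^ n := by
    have := h.resid_char hχ hA hπ h3 3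
    rw [hn3] at this
    exact_mod_cast this
  have mchi3 : χ 3 ∈ A := by have := hA _ (hχ.mem_O3 3); exact_mod_cast this
  set RHS := -(χ 3) * πt ^ 2 * (starRingEnd ℂ) πt with hRHS
  have h27 : (27 : κ) ^ n = 1 := by
    have := natCast_pow_sub_one hp (F := κ) (k := 3) (by exact_mod_cast h3κ)
    rw [hp1, pow_mul] at this
    norm_num at this; exact this
  have hRHSm : RHS / t ^ (2 * n) ∈ A ∧ resid A (RHS / t ^ (2 * n)) =
      n.factorial * resid A c ^ (2 * n) * δ ^ (2 * n) := by
    have e : RHS / t ^ (2 * n) = -(χ 3) * (πt / t ^ n) ^ 2 * (starRingEnd ℂ) πt := by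
      rw [hRHS]; field_simp; ring
    have m := mul_mem (neg_mem mchi3) (pow_mem hπtm.1 2)
    refine ⟨e ▸ mul_mem m hconjm.1, ?_⟩
    rw [e, resid_mul m hconjm.1, resid_mul (neg_mem mchi3) (pow_mem hπtm.1 2), resid_neg mchi3,
      resid_pow hπtm.1, hπtm.2, hconjm.2, hchi3]
    have e27 : (27 : κ) ^ n = 3 ^ n * 9 ^ n := by rw [← mul_pow]; norm_num
    rw [e27] at h27
    linear_combination n.factorial * resid A c ^ (2 * n) * δ ^ (2 * n) * h27
  obtain ⟨hGm, hGr⟩ := hk.resid_gaussSum h.norm hQ hFx hn hζ (fun s => χ s) (by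
    intro s hs
    simp only [Finset.mem_Icc] at hs
    have hps : ¬ p ∣ s := Nat.not_dvd_of_pos_of_lt hs.1 (by omega)
    obtain ⟨d, hd, e⟩ := hχ.euler s (natCast_mem O3 s) ((h.coprime_natCast_iff hA hπ).2 hps)
    rw [hn3] at e
    rw [e, map_mul]
    exact mul_le_of_le_one_right' ((A.valuation_le_one_iff _).2 (hA _ hd)))
  have hG : ∑ s ∈ Finset.Icc 1 (p - 1), χ s * ζ ^ s = G3sum p χ := by
    refine Finset.sum_congr rfl fun s _ => ?_
    rw [hζdef, ← Complex.exp_nat_mul]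
    congr 2; ring
  rw [hG] at hGm hGr
  have hG3 := h.G3sum_pow_three hχ h3 hprim
  have hfact : (n.factorial : κ) ^ 3 * resid A c = -1 := by
    have e : (G3sum p χ / t ^ (2 * n)) ^ 3 = -((π / t ^ (3 * n)) ^ 2 * c) := by
      rw [div_pow, hG3, h.norm]; field_simp; ring
    have mπ : π / t ^ (3 * n) ∈ A := by
      by_contra hcon
      simp [resid, hcon] at hPt
    have e1 := congrArg (resid A) e
    rw [resid_pow hGm, hGr, resid_neg (mul_mem (pow_mem mπ 2) (hA _ hcm)),
      resid_mul (pow_mem mπ 2) (hA _ hcm), resid_pow mπ, hPt] at e1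
    have hc0 : resid A c ≠ 0 := (resid_ne_zero_iff (hA _ hcm)).2 hQ
    refine mul_right_cancel₀ hc0 ?_
    have e2 : (δ ^ (2 * n)) ^ 3 = resid A c ^ 2 := by rw [← hδc]; ring
    rw [mul_pow, e2] at e1
    linear_combination e1
  have hf0 : (n.factorial : κ) ≠ 0 := by intro e; rw [e] at hfact; simp at hfact
  have hcn : resid A c ^ n = 1 := by
    have e1 := natCast_pow_sub_one hp hf0
    rw [hp1, pow_mul] at e1
    have e2 := congrArg (· ^ n) hfact
    simp only [mul_pow] at e2
    rwa [e1, one_mul, hev.neg_one_pow] at e2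
  have hRr : resid A (RHS / t ^ (2 * n)) = resid A (G3sum p χ / t ^ (2 * n)) := by
    rw [hRHSm.2, hGr, mul_comm 2 n, pow_mul (resid A c), hcn, one_pow, mul_one]
  have hne : resid A (RHS / t ^ (2 * n)) ≠ 0 := by
    rw [hRr, hGr]; exact mul_ne_zero hf0 (pow_ne_zero _ hδ0)
  have hRHS3 : RHS ^ 3 = G3sum p χ ^ 3 := by
    have e1 : χ 3 ^ 3 = 1 := by
      have : ECoprime ((3 : ℕ) : ℂ) π :=
        (h.coprime_natCast_iff hA hπ).2 (Nat.not_dvd_of_pos_of_lt (by norm_num) (by omega))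
      have := hχ.cube _ (natCast_mem O3 3) this
      exact_mod_cast this
    have e2 : (starRingEnd ℂ) πt ^ 3 = c := by rw [← map_pow, hcube]
    have e4 : RHS ^ 3 = -(χ 3 ^ 3 * (πt ^ 3) ^ 2 * (starRingEnd ℂ) πt ^ 3) := by rw [hRHS]; ring
    rw [hG3, e4, e1, e2, hcube, h.norm]; ring
  have hv := (resid_ne_zero_iff hRHSm.1).1 hne
  have hRt0 : RHS / t ^ (2 * n) ≠ 0 := by intro e; rw [e] at hv; simp at hv
  have hR0' : RHS ≠ 0 := fun e => hRt0 (by rw [e, zero_div])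
  have key : G3sum p χ / RHS = 1 := by
    refine eq_one_of_resid_eq_one (A := A) ?_ h3κ ?_
    · rw [div_pow, hRHS3, div_self]; rw [← hRHS3]; exact pow_ne_zero _ hR0'
    · have e : G3sum p χ / RHS = (G3sum p χ / t ^ (2 * n)) * (RHS / t ^ (2 * n))⁻¹ := by
        field_simp
      rw [e, resid_mul hGm (inv_mem_of_valuation_eq_one hv), resid_inv hv, ← hRr,
        mul_inv_cancel₀ hne]
  exact (div_eq_one_iff_eq hR0').1 key

end SplitPrime

end

section

theorem countable_of_eventually_notMem {S : Set ℂ} (h : ∀ z, ∀ᶠ u in 𝓝[≠] z, u ∉ S) :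
    S.Countable := by
  have hS : Sᶜ ∈ codiscrete ℂ := by
    rw [mem_codiscrete]
    intro z
    rw [compl_compl, disjoint_principal_right]
    exact h z
  have h2 := (mem_codiscrete'.1 hS).2
  rw [compl_compl] at h2
  exact (HereditarilyLindelofSpace.isLindelof S).countable_of_isDiscrete h2

theorem isPreconnected_compl_of_eventually_notMem {S : Set ℂ}
    (h : ∀ z, ∀ᶠ u in 𝓝[≠] z, u ∉ S) : IsPreconnected Sᶜ :=
  ((countable_of_eventually_notMem h).isPathConnected_compl_of_one_lt_rank
    (by rw [Complex.rank_real_complex]; exact Nat.one_lt_ofNat)).isConnected.isPreconnected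

theorem isOpen_compl_of_eventually_notMem {S : Set ℂ}
    (h : ∀ z, ∀ᶠ u in 𝓝[≠] z, u ∉ S) : IsOpen Sᶜ := by
  have hS : Sᶜ ∈ codiscrete ℂ := by
    rw [mem_codiscrete]
    intro z
    rw [compl_compl, disjoint_principal_right]
    exact h z
  exact (mem_codiscrete'.1 hS).1

/-- A function whose Wronskian with `D` vanishes is zero as soon as it vanishes at a point
where `D` does not. -/
theorem eqOn_zero_of_wronskian {U : Set ℂ} (hU : IsOpen U) (hc : IsPreconnected U) {h D : ℂ → ℂ}
    (hh : DifferentiableOn ℂ h U) (hD : DifferentiableOn ℂ D U)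
    (hw : ∀ z ∈ U, deriv h z * D z = h z * deriv D z) {z₀ : ℂ} (hz : z₀ ∈ U) (h0 : h z₀ = 0)
    (hD0 : D z₀ ≠ 0) : ∀ z ∈ U, h z = 0 := by
  have hev : ∀ᶠ z in 𝓝 z₀, z ∈ U ∧ D z ≠ 0 :=
    (hU.eventually_mem hz).and ((hD.differentiableAt (hU.mem_nhds hz)).continuousAt.eventually_ne hD0)
  obtain ⟨r, hr, hball⟩ := Metric.eventually_nhds_iff_ball.1 hev
  have hq : ∀ z ∈ Metric.ball z₀ r, h z / D z = h z₀ / D z₀ := by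
    intro z hz'
    have hd : ∀ w ∈ Metric.ball z₀ r, HasDerivAt (fun z => h z / D z) 0 w := by
      intro w hw'
      obtain ⟨hwU, hwD⟩ := hball w hw'
      have h1 := (hh.differentiableAt (hU.mem_nhds hwU)).hasDerivAt.div
        (hD.differentiableAt (hU.mem_nhds hwU)).hasDerivAt hwD
      rw [hw w hwU, sub_self, zero_div] at h1
      exact h1
    exact Metric.isOpen_ball.is_const_of_deriv_eq_zero (convex_ball z₀ r).isPreconnected
      (fun w hw' => (hd w hw').differentiableAt.differentiableWithinAt)
      (fun w hw' => (hd w hw').deriv) hz' (Metric.mem_ball_self hr)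
  have hz0 : h =ᶠ[𝓝 z₀] 0 := by
    filter_upwards [Metric.ball_mem_nhds z₀ hr] with z hz'
    have := hq z hz'
    rw [h0, zero_div, div_eq_zero_iff] at this
    exact this.resolve_right (hball z hz').2
  exact fun z hz' =>
    (hh.analyticOnNhd hU).eqOn_zero_of_preconnected_of_eventuallyEq_zero hc hz hz0 hz'

end

section

theorem linearIndependent_one_rho3 : LinearIndependent ℝ ![(1 : ℂ), ρ3] := by
  rw [LinearIndependent.pair_iff]
  intro s t h
  rw [rho3_eq] at h
  have h1 := congrArg Complex.im h
  have h2 := congrArg Complex.re h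
  simp at h1 h2
  subst h1
  simpa using h2

/-- The pair of periods `1, ρ` of the lattice `ℤ[ρ]`. -/
noncomputable def eisensteinPair : PeriodPair := ⟨1, ρ3, linearIndependent_one_rho3⟩

/-- The Weierstrass function `℘` of the lattice `ℤ[ρ]`. -/
noncomputable abbrev wpE : ℂ → ℂ := eisensteinPair.weierstrassP

/-- The derivative of the Weierstrass function `℘` of the lattice `ℤ[ρ]`. -/
noncomputable abbrev wpE' : ℂ → ℂ := eisensteinPair.derivWeierstrassP

theorem mem_eisensteinPair_lattice {z : ℂ} : z ∈ eisensteinPair.lattice ↔ z ∈ O3 := by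
  rw [PeriodPair.mem_lattice, mem_O3_iff]
  simp only [eisensteinPair, mul_one, eq_comm]

theorem wpE_add {w : ℂ} (hw : w ∈ O3) (u : ℂ) : wpE (u + w) = wpE u :=
  eisensteinPair.weierstrassP_add_coe u ⟨w, mem_eisensteinPair_lattice.2 hw⟩

theorem wpE'_add {w : ℂ} (hw : w ∈ O3) (u : ℂ) : wpE' (u + w) = wpE' u :=
  eisensteinPair.derivWeierstrassP_add_coe u ⟨w, mem_eisensteinPair_lattice.2 hw⟩

/-- The permutation of the lattice `ℤ[ρ]` induced by multiplication by `ρ`. -/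
noncomputable def rhoEquiv : eisensteinPair.lattice ≃ eisensteinPair.lattice :=
  (Equiv.mulLeft₀ ρ3 rho3_ne_zero).subtypeEquiv fun z => by
    rw [mem_eisensteinPair_lattice, mem_eisensteinPair_lattice]
    refine ⟨fun h => mul_mem rho3_mem h, fun h => ?_⟩
    have := mul_mem (pow_mem rho3_mem 2) h
    rwa [show ρ3 ^ 2 * Equiv.mulLeft₀ ρ3 rho3_ne_zero z = z by
      change ρ3 ^ 2 * (ρ3 * z) = z
      linear_combination z * rho3_cube] at this

/-- The permutation of the lattice `ℤ[ρ]` induced by complex conjugation. -/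
noncomputable def conjLatticeEquiv : eisensteinPair.lattice ≃ eisensteinPair.lattice :=
  (starRingAut (R := ℂ)).toEquiv.subtypeEquiv fun z => by
    rw [mem_eisensteinPair_lattice, mem_eisensteinPair_lattice]
    refine ⟨fun h => conj_mem_O3 h, fun h => ?_⟩
    have := conj_mem_O3 h
    rwa [show (starRingEnd ℂ) ((starRingAut (R := ℂ)).toEquiv z) = z from Complex.conj_conj z]
      at this

theorem coe_rhoEquiv (l : eisensteinPair.lattice) : (rhoEquiv l : ℂ) = ρ3 * l := rfl

theorem coe_conjLatticeEquiv (l : eisensteinPair.lattice) :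
    (conjLatticeEquiv l : ℂ) = (starRingEnd ℂ) l := rfl

theorem wpE_rho (u : ℂ) : wpE (ρ3 * u) = ρ3 * wpE u := by
  rw [wpE, PeriodPair.weierstrassP, PeriodPair.weierstrassP, ← rhoEquiv.tsum_eq, ← tsum_mul_left]
  refine tsum_congr fun l => ?_
  have h : ∀ z : ℂ, 1 / (ρ3 * z) ^ 2 = ρ3 * (1 / z ^ 2) := fun z => by
    rw [mul_pow, one_div, mul_inv, one_div]
    congr 1
    exact inv_eq_of_mul_eq_one_right (by linear_combination rho3_cube)
  rw [coe_rhoEquiv, ← mul_sub, h, h, mul_sub]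

theorem wpE'_rho (u : ℂ) : wpE' (ρ3 * u) = wpE' u := by
  rw [wpE', PeriodPair.derivWeierstrassP, PeriodPair.derivWeierstrassP, ← rhoEquiv.tsum_eq]
  congr 1
  refine tsum_congr fun l => ?_
  rw [coe_rhoEquiv, ← mul_sub, mul_pow, rho3_cube, one_mul]

theorem wpE_conj (u : ℂ) : wpE ((starRingEnd ℂ) u) = (starRingEnd ℂ) (wpE u) := by
  rw [wpE, PeriodPair.weierstrassP, PeriodPair.weierstrassP, ← conjLatticeEquiv.tsum_eq,
    Complex.conj_tsum]
  refine tsum_congr fun l => ?_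
  simp [coe_conjLatticeEquiv]

theorem wpE'_conj (u : ℂ) : wpE' ((starRingEnd ℂ) u) = (starRingEnd ℂ) (wpE' u) := by
  rw [wpE', PeriodPair.derivWeierstrassP, PeriodPair.derivWeierstrassP,
    ← conjLatticeEquiv.tsum_eq, map_neg, Complex.conj_tsum]
  congr 1
  refine tsum_congr fun l => ?_
  simp [coe_conjLatticeEquiv, Complex.conj_ofNat]

theorem eisensteinPair_G_four : eisensteinPair.G 4 = 0 := by
  have h : eisensteinPair.G 4 = ρ3 ^ 2 * eisensteinPair.G 4 := by
    conv_lhs => rw [PeriodPair.G, ← rhoEquiv.tsum_eq]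
    rw [PeriodPair.G, ← tsum_mul_left]
    refine tsum_congr fun l => ?_
    rw [coe_rhoEquiv, mul_pow, mul_inv]
    congr 1
    exact inv_eq_of_mul_eq_one_right (by linear_combination (ρ3 ^ 3 + 1) * rho3_cube)
  have h2 : ρ3 ^ 2 ≠ 1 := fun e => by
    have := rho3_cube
    have h3 := rho3_sq_add
    have : ρ3 = 1 := by linear_combination rho3_cube - ρ3 * e
    rw [this] at h3; norm_num at h3
  have : (1 - ρ3 ^ 2) * eisensteinPair.G 4 = 0 := by linear_combination h
  exact (mul_eq_zero.1 this).resolve_left (sub_ne_zero.2 h2.symm)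

theorem conj_eisensteinPair_g₃ : (starRingEnd ℂ) eisensteinPair.g₃ = eisensteinPair.g₃ := by
  rw [PeriodPair.g₃, map_mul, PeriodPair.G, Complex.conj_tsum, ← conjLatticeEquiv.tsum_eq]
  simp [coe_conjLatticeEquiv, Complex.conj_ofNat]

theorem wpE'_sq {u : ℂ} (hu : u ∉ O3) : wpE' u ^ 2 = 4 * wpE u ^ 3 - eisensteinPair.g₃ := by
  rw [eisensteinPair.derivWeierstrassP_sq u (by rwa [mem_eisensteinPair_lattice]),
    PeriodPair.g₂, eisensteinPair_G_four]
  ring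

theorem eventually_notMem_O3 (z : ℂ) : ∀ᶠ u in 𝓝[≠] z, u ∉ O3 := by
  rw [eventually_nhdsWithin_iff]
  filter_upwards [eisensteinPair.compl_lattice_sdiff_singleton_mem_nhds z] with u hu hz h
  exact hu ⟨mem_eisensteinPair_lattice.2 h, hz⟩

theorem isOpen_compl_O3 : IsOpen ((O3 : Set ℂ)ᶜ) :=
  isOpen_compl_of_eventually_notMem eventually_notMem_O3

theorem hasDerivAt_wpE {u : ℂ} (hu : u ∉ O3) : HasDerivAt wpE (wpE' u) u := by
  have h : (eisensteinPair.lattice : Set ℂ) = O3 := Set.ext fun _ => mem_eisensteinPair_lattice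
  have h1 := eisensteinPair.differentiableOn_weierstrassP
  rw [h] at h1
  have := (h1.differentiableAt (isOpen_compl_O3.mem_nhds hu)).hasDerivAt
  rwa [PeriodPair.deriv_weierstrassP] at this

theorem differentiableAt_wpE' {u : ℂ} (hu : u ∉ O3) : DifferentiableAt ℂ wpE' u := by
  have h : (eisensteinPair.lattice : Set ℂ) = O3 := Set.ext fun _ => mem_eisensteinPair_lattice
  have h1 := eisensteinPair.differentiableOn_derivWeierstrassP
  rw [h] at h1
  exact h1.differentiableAt (isOpen_compl_O3.mem_nhds hu)

/-- The expansion of `℘` at the origin. -/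
theorem exists_sq_mul_wpE : ∃ A : ℂ → ℂ, AnalyticAt ℂ A 0 ∧ A 0 = 1 ∧
    ∀ u, u ≠ 0 → u ^ 2 * wpE u = A u := by
  refine ⟨fun u => u ^ 2 * eisensteinPair.weierstrassPExcept 0 u + 1, ?_, by simp, fun u hu => ?_⟩
  · have := eisensteinPair.analyticAt_weierstrassPExcept 0
    fun_prop
  · have := eisensteinPair.ite_eq_one_sub_sq_mul_weierstrassP 0 (zero_mem _) u
    rw [if_neg hu] at this
    simpa using this

/-- The expansion of `℘′` at the origin. -/
theorem exists_cube_mul_wpE' : ∃ A : ℂ → ℂ, AnalyticAt ℂ A 0 ∧ A 0 = -2 ∧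
    ∀ u, u ≠ 0 → u ^ 3 * wpE' u = A u := by
  refine ⟨fun u => u ^ 3 * eisensteinPair.derivWeierstrassPExcept 0 u - 2, ?_, by simp,
    fun u hu => ?_⟩
  · have := eisensteinPair.analyticAt_derivWeierstrassPExcept 0
    fun_prop
  · have := eisensteinPair.derivWeierstrassPExcept_sub 0 u
    simp only [ZeroMemClass.coe_zero, sub_zero] at this
    rw [wpE', ← this]
    field_simp

theorem isPreconnected_compl_O3 : IsPreconnected ((O3 : Set ℂ)ᶜ) :=
  isPreconnected_compl_of_eventually_notMem eventually_notMem_O3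

theorem eventually_wpE'_ne_zero : ∀ᶠ u in 𝓝[≠] (0 : ℂ), wpE' u ≠ 0 := by
  obtain ⟨A, hA, hA0, h⟩ := exists_cube_mul_wpE'
  have h1 : ∀ᶠ u in 𝓝 (0 : ℂ), A u ≠ 0 := hA.continuousAt.eventually_ne (by rw [hA0]; norm_num)
  filter_upwards [nhdsWithin_le_nhds h1, self_mem_nhdsWithin] with u hu hu0 h0
  exact hu (by rw [← h u hu0, h0, mul_zero])

theorem hasDerivAt_wpE' {u : ℂ} (hu : u ∉ O3) : HasDerivAt wpE' (6 * wpE u ^ 2) u := by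
  have key : ∀ v ∉ O3, (deriv wpE' v - 6 * wpE v ^ 2) * wpE' v = 0 := by
    intro v hv
    have h1 : HasDerivAt (fun z => wpE' z ^ 2) (2 * wpE' v * deriv wpE' v) v := by
      simpa using (differentiableAt_wpE' hv).hasDerivAt.fun_pow 2
    have h2 : HasDerivAt (fun z => 4 * wpE z ^ 3 - eisensteinPair.g₃)
        (4 * (3 * wpE v ^ 2 * wpE' v)) v := by
      simpa using (((hasDerivAt_wpE hv).fun_pow 3).const_mul 4).sub_const eisensteinPair.g₃
    have h3 : (fun z => wpE' z ^ 2) =ᶠ[𝓝 v] fun z => 4 * wpE z ^ 3 - eisensteinPair.g₃ := by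
      filter_upwards [isOpen_compl_O3.mem_nhds hv] with z hz using wpE'_sq hz
    have h4 := h1.unique (h2.congr_of_eventuallyEq h3)
    linear_combination h4 / 2
  have hd' : DifferentiableOn ℂ wpE' (O3 : Set ℂ)ᶜ :=
    fun v hv => (differentiableAt_wpE' hv).differentiableWithinAt
  have hd : DifferentiableOn ℂ wpE (O3 : Set ℂ)ᶜ :=
    fun v hv => (hasDerivAt_wpE hv).differentiableAt.differentiableWithinAt
  have h1 : AnalyticOnNhd ℂ (fun v => deriv wpE' v - 6 * wpE v ^ 2) (O3 : Set ℂ)ᶜ :=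
    (((hd'.deriv isOpen_compl_O3)).sub ((hd.pow 2).const_mul 6)).analyticOnNhd isOpen_compl_O3
  obtain ⟨z₀, hz₀, hne⟩ :=
    ((eventually_notMem_O3 0).and eventually_wpE'_ne_zero).exists
  have hev : (fun v => deriv wpE' v - 6 * wpE v ^ 2) =ᶠ[𝓝 z₀] 0 := by
    filter_upwards [isOpen_compl_O3.mem_nhds hz₀,
      (differentiableAt_wpE' hz₀).continuousAt.eventually_ne hne] with v hv hv'
    exact (mul_eq_zero.1 (key v hv)).resolve_right hv'
  have := h1.eqOn_zero_of_preconnected_of_eventuallyEq_zero isPreconnected_compl_O3 hz₀ hev hu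
  rw [← sub_eq_zero.1 (show deriv wpE' u - 6 * wpE u ^ 2 = 0 from this)]
  exact (differentiableAt_wpE' hu).hasDerivAt

theorem eisensteinPair_g₃_ne_zero : eisensteinPair.g₃ ≠ 0 := by
  intro hg
  obtain ⟨z₀, hz₀, hne⟩ := ((eventually_notMem_O3 0).and eventually_wpE'_ne_zero).exists
  set k := (2 * wpE z₀ + z₀ * wpE' z₀) / wpE' z₀
  have hF : ∀ u ∉ O3, HasDerivAt (fun v => 2 * wpE v + v * wpE' v - k * wpE' v)
      (2 * wpE' u + (1 * wpE' u + u * (6 * wpE u ^ 2)) - k * (6 * wpE u ^ 2)) u := fun u hu =>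
    (((hasDerivAt_wpE hu).const_mul 2).add ((hasDerivAt_id u).mul (hasDerivAt_wpE' hu))).sub
      ((hasDerivAt_wpE' hu).const_mul k)
  have h0 := eqOn_zero_of_wronskian isOpen_compl_O3 isPreconnected_compl_O3
    (fun u hu => (hF u hu).differentiableAt.differentiableWithinAt)
    (fun u hu => (differentiableAt_wpE' hu).differentiableWithinAt)
    (fun u hu => by
      rw [(hF u hu).deriv, (hasDerivAt_wpE' hu).deriv]
      have := wpE'_sq hu
      rw [hg] at this
      linear_combination 3 * this) hz₀ (by simp only [k]; field_simp; ring) hne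
  have h1 := h0 z₀ hz₀
  have h2 := h0 (z₀ + 1) (fun h => hz₀ (by simpa using sub_mem h (one_mem O3)))
  simp only [wpE_add (one_mem O3), wpE'_add (one_mem O3)] at h1 h2
  exact hne (by linear_combination h2 - h1)

end

section

/-- The positive real number `κ` with `g₃(ℤ[ρ]) = 27κ⁶`. -/
noncomputable def fermatScale : ℝ := (‖eisensteinPair.g₃‖ / 27) ^ ((1 : ℝ) / 6)

theorem fermatScale_pos : 0 < fermatScale :=
  Real.rpow_pos_of_pos (div_pos (norm_pos_iff.2 eisensteinPair_g₃_ne_zero) (by norm_num)) _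

theorem fermatScale_ne_zero : (fermatScale : ℂ) ≠ 0 := by
  exact_mod_cast fermatScale_pos.ne'

theorem conj_one_add_two_rho3 : (starRingEnd ℂ) (1 + 2 * ρ3) = -(1 + 2 * ρ3) := by
  simp only [map_add, map_one, map_mul, conj_rho3, Complex.conj_ofNat]
  linear_combination 2 * rho3_sq_add

theorem intCast_div_three_add_mem_O3 {m n : ℤ} (h : ((m : ℂ) + n * ρ3) / 3 ∈ O3) :
    (3 : ℤ) ∣ m ∧ (3 : ℤ) ∣ n := by
  obtain ⟨a, b, hab⟩ := mem_O3_iff.1 h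
  have h1 : ((m - 3 * a : ℤ) : ℂ) + ((n - 3 * b : ℤ) : ℂ) * ρ3 = 0 := by
    push_cast; linear_combination 3 * hab
  have h2 := LinearIndependent.pair_iff.1 linearIndependent_one_rho3 ((m - 3 * a : ℤ) : ℝ)
    ((n - 3 * b : ℤ) : ℝ) (by simpa using h1)
  have h3 : m - 3 * a = 0 := by exact_mod_cast h2.1
  have h4 : n - 3 * b = 0 := by exact_mod_cast h2.2
  exact ⟨⟨a, by linarith⟩, ⟨b, by linarith⟩⟩

/-- The point `1/√−3`, at which `℘` vanishes. -/
noncomputable def aPt : ℂ := -(1 + 2 * ρ3) / 3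

theorem aPt_notMem : aPt ∉ O3 := fun h => by
  have : (((-1 : ℤ) : ℂ) + ((-2 : ℤ) : ℂ) * ρ3) / 3 ∈ O3 := by
    convert h using 1; rw [aPt]; push_cast; ring
  have := (intCast_div_three_add_mem_O3 this).1
  omega

theorem rho3_ne_one : ρ3 ≠ 1 := fun e => by
  have h3 := rho3_sq_add
  rw [e] at h3; norm_num at h3

theorem wpE_aPt : wpE aPt = 0 := by
  have h : wpE (aPt + (1 + ρ3)) = ρ3 * wpE aPt := by
    rw [← wpE_rho]
    congr 1
    rw [aPt]
    linear_combination (2 / 3 : ℂ) * rho3_sq_add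
  rw [wpE_add (add_mem (one_mem O3) rho3_mem)] at h
  have : (1 - ρ3) * wpE aPt = 0 := by linear_combination h
  exact (mul_eq_zero.1 this).resolve_left (sub_ne_zero.2 rho3_ne_one.symm)

theorem eisensteinPair_g₃_eq : eisensteinPair.g₃ = 27 * (fermatScale : ℂ) ^ 6 := by
  obtain ⟨r, hr⟩ : ∃ r : ℝ, eisensteinPair.g₃ = r :=
    ⟨_, (Complex.conj_eq_iff_real.1 conj_eisensteinPair_g₃).choose_spec⟩
  have h1 := wpE'_sq aPt_notMem
  rw [wpE_aPt, hr] at h1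
  have hconj : (starRingEnd ℂ) (wpE' aPt) = -wpE' aPt := by
    rw [← wpE'_conj, ← eisensteinPair.derivWeierstrassP_neg]
    congr 1
    rw [aPt, map_div₀, map_neg, conj_one_add_two_rho3, Complex.conj_ofNat]
    ring
  have h2 : ((Complex.normSq (wpE' aPt) : ℝ) : ℂ) = r := by
    rw [Complex.normSq_eq_conj_mul_self, hconj]
    linear_combination -h1
  have h3 : Complex.normSq (wpE' aPt) = r := by exact_mod_cast h2
  have h4 : 0 ≤ r := h3 ▸ Complex.normSq_nonneg _
  have h5 : ‖eisensteinPair.g₃‖ = r := by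
    rw [hr, Complex.norm_real, Real.norm_of_nonneg h4]
  have h6 : fermatScale ^ 6 = r / 27 := by
    rw [fermatScale, h5, ← Real.rpow_natCast, ← Real.rpow_mul (by positivity)]
    norm_num
  rw [hr, ← Complex.ofReal_pow, h6]
  push_cast; ring

/-- The function `φ` normalised by the lattice `ℤ[ρ]`. -/
noncomputable def phiE (u : ℂ) : ℂ :=
  6 * fermatScale * wpE u / (9 * fermatScale ^ 3 + wpE' u)

open Classical in
/-- The function `ψ` normalised by the lattice `ℤ[ρ]`. -/
noncomputable def psiE (u : ℂ) : ℂ :=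
  if u ∈ O3 then -1 else (9 * fermatScale ^ 3 - wpE' u) / (9 * fermatScale ^ 3 + wpE' u)

/-- The common poles of `φ` and `ψ`. -/
def fermatPoles : Set ℂ := {u | u ∉ O3 ∧ wpE' u = -(9 * fermatScale ^ 3)}

theorem denom_ne_zero {u : ℂ} (hu : u ∉ O3) (hp : u ∉ fermatPoles) :
    9 * (fermatScale : ℂ) ^ 3 + wpE' u ≠ 0 :=
  fun h => hp ⟨hu, by linear_combination h⟩

theorem wpE'_sq_eq {u : ℂ} (hu : u ∉ O3) :
    wpE' u ^ 2 = 4 * wpE u ^ 3 - 27 * fermatScale ^ 6 := by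
  rw [wpE'_sq hu, eisensteinPair_g₃_eq]

theorem add_mem_O3_iff {u w : ℂ} (hw : w ∈ O3) : u + w ∈ O3 ↔ u ∈ O3 :=
  ⟨fun h => by simpa using sub_mem h hw, fun h => add_mem h hw⟩

theorem phiE_add {w : ℂ} (hw : w ∈ O3) (u : ℂ) : phiE (u + w) = phiE u := by
  rw [phiE, phiE, wpE_add hw, wpE'_add hw]

theorem psiE_add {w : ℂ} (hw : w ∈ O3) (u : ℂ) : psiE (u + w) = psiE u := by
  rw [psiE, psiE, wpE'_add hw, add_mem_O3_iff hw]

theorem fermatPoles_add {w : ℂ} (hw : w ∈ O3) (u : ℂ) :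
    u + w ∈ fermatPoles ↔ u ∈ fermatPoles := by
  rw [fermatPoles, Set.mem_ofPred_eq, Set.mem_ofPred_eq, wpE'_add hw, add_mem_O3_iff hw]

theorem rho_mul_mem_O3_iff {u : ℂ} : ρ3 * u ∈ O3 ↔ u ∈ O3 := by
  refine ⟨fun h => ?_, fun h => mul_mem rho3_mem h⟩
  rw [show u = ρ3 ^ 2 * (ρ3 * u) by linear_combination -u * rho3_cube]
  exact mul_mem (pow_mem rho3_mem 2) h

theorem phiE_rho (u : ℂ) : phiE (ρ3 * u) = ρ3 * phiE u := by
  rw [phiE, phiE, wpE_rho, wpE'_rho]; ring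

theorem phiE_conj (u : ℂ) : phiE ((starRingEnd ℂ) u) = (starRingEnd ℂ) (phiE u) := by
  simp [phiE, wpE_conj, wpE'_conj, Complex.conj_ofNat]

theorem psiE_of_mem {u : ℂ} (hu : u ∈ O3) : psiE u = -1 := if_pos hu

theorem psiE_of_notMem {u : ℂ} (hu : u ∉ O3) :
    psiE u = (9 * fermatScale ^ 3 - wpE' u) / (9 * fermatScale ^ 3 + wpE' u) := if_neg hu

theorem phiE_of_mem {u : ℂ} (hu : u ∈ O3) : phiE u = 0 := by
  have : wpE u = 0 := eisensteinPair.weierstrassP_coe ⟨u, mem_eisensteinPair_lattice.2 hu⟩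
  rw [phiE, this]; ring

theorem notMem_fermatPoles_of_mem {u : ℂ} (hu : u ∈ O3) : u ∉ fermatPoles := fun h => h.1 hu

theorem phiE_cube_sub {u : ℂ} (hp : u ∉ fermatPoles) : phiE u ^ 3 - psiE u ^ 3 = 1 := by
  by_cases hu : u ∈ O3
  · rw [phiE_of_mem hu, psiE_of_mem hu]; norm_num
  · have h := denom_ne_zero hu hp
    rw [psiE_of_notMem hu, phiE, div_pow, div_pow, ← sub_div, div_eq_one_iff_eq (pow_ne_zero 3 h)]
    linear_combination -54 * (fermatScale : ℂ) ^ 3 * wpE'_sq_eq hu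

theorem eq_of_psiE_eq_neg_one {u : ℂ} (hp : u ∉ fermatPoles) (h : psiE u = -1) : u ∈ O3 := by
  by_contra hu
  rw [psiE_of_notMem hu, div_eq_iff (denom_ne_zero hu hp)] at h
  have : (18 : ℂ) * fermatScale ^ 3 = 0 := by linear_combination h
  simp [fermatScale_pos.ne'] at this

theorem tendsto_sub_nhdsNE (z : ℂ) : Tendsto (fun u => u - z) (𝓝[≠] z) (𝓝[≠] 0) := by
  refine tendsto_nhdsWithin_iff.2 ⟨?_, ?_⟩
  · have : ContinuousAt (fun u : ℂ => u - z) z := by fun_prop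
    simpa using this.tendsto.mono_left nhdsWithin_le_nhds
  · filter_upwards [self_mem_nhdsWithin] with u hu using sub_ne_zero.2 hu

theorem eventually_notMem_fermatPoles (z : ℂ) : ∀ᶠ u in 𝓝[≠] z, u ∉ fermatPoles := by
  by_cases hz : z ∈ O3
  · have h0 : ∀ᶠ u in 𝓝[≠] (0 : ℂ), u ∉ fermatPoles := by
      obtain ⟨A, hA, hA0, h⟩ := exists_cube_mul_wpE'
      have h1 : ContinuousAt (fun u => u ^ 3 * (9 * (fermatScale : ℂ) ^ 3) + A u) 0 := by
        have := hA.continuousAt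
        fun_prop
      have h2 := h1.eventually_ne (show _ ≠ (0 : ℂ) by simp [hA0])
      filter_upwards [nhdsWithin_le_nhds h2, self_mem_nhdsWithin] with u hu hu0 hp
      refine hu ?_
      rw [← h u hu0, hp.2]; ring
    filter_upwards [(tendsto_sub_nhdsNE z).eventually h0] with u hu hp
    refine hu ?_
    rw [← fermatPoles_add hz]
    simpa using hp
  · have hd : AnalyticOnNhd ℂ (fun u => wpE' u + 9 * (fermatScale : ℂ) ^ 3) (O3 : Set ℂ)ᶜ := by
      refine DifferentiableOn.analyticOnNhd (fun v hv => ?_) isOpen_compl_O3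
      exact ((differentiableAt_wpE' hv).add_const _).differentiableWithinAt
    rcases (hd z hz).eventually_eq_zero_or_eventually_ne_zero with h | h
    · exfalso
      have h1 := hd.eqOn_zero_of_preconnected_of_eventuallyEq_zero isPreconnected_compl_O3 hz h
      have h2 : wpE' z + 9 * (fermatScale : ℂ) ^ 3 = 0 := h1 hz
      have h3 : wpE' (-z) + 9 * (fermatScale : ℂ) ^ 3 = 0 := h1 (fun e => hz (by simpa using e))
      rw [show wpE' (-z) = -wpE' z from eisensteinPair.derivWeierstrassP_neg z] at h3
      have : (18 : ℂ) * fermatScale ^ 3 = 0 := by linear_combination h2 + h3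
      simp [fermatScale_pos.ne'] at this
    · filter_upwards [h] with u hu hp
      exact hu (by rw [hp.2]; ring)

theorem hasDerivAt_fermat_zero : HasDerivAt phiE (-3 * fermatScale) 0 ∧ HasDerivAt psiE 0 0 := by
  obtain ⟨A, hA, hA0, hAe⟩ := exists_sq_mul_wpE
  obtain ⟨B, hB, hB0, hBe⟩ := exists_cube_mul_wpE'
  have hA' := hA.differentiableAt.hasDerivAt
  have hB' := hB.differentiableAt.hasDerivAt
  have hev : ∀ᶠ u in 𝓝 (0 : ℂ), u ≠ 0 → u ∉ O3 :=
    eventually_nhdsWithin_iff.1 (eventually_notMem_O3 0)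
  have hD : HasDerivAt (fun u : ℂ => 9 * (fermatScale : ℂ) ^ 3 * u ^ 3 + B u) (deriv B 0) 0 := by
    convert! ((hasDerivAt_pow 3 (0 : ℂ)).const_mul (9 * (fermatScale : ℂ) ^ 3)).add hB' using 1
    norm_num
  have hN : HasDerivAt (fun u : ℂ => 9 * (fermatScale : ℂ) ^ 3 * u ^ 3 - B u) (-deriv B 0) 0 := by
    convert! ((hasDerivAt_pow 3 (0 : ℂ)).const_mul (9 * (fermatScale : ℂ) ^ 3)).sub hB' using 1
    norm_num
  have hM : HasDerivAt (fun u : ℂ => u * (6 * fermatScale * A u)) (6 * fermatScale) 0 := by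
    convert! (hasDerivAt_id (0 : ℂ)).mul (hA'.const_mul (6 * (fermatScale : ℂ))) using 1
    simp [hA0]
  constructor
  · have h1 := hM.div hD (by simp [hB0])
    refine HasDerivAt.congr_of_eventuallyEq (f := fun u : ℂ => u * (6 * fermatScale * A u) /
      (9 * (fermatScale : ℂ) ^ 3 * u ^ 3 + B u)) ?_ ?_
    · convert! h1 using 1
      simp [hB0]; ring
    · filter_upwards [hev] with u hu
      by_cases h0 : u = 0
      · simp [h0, phiE_of_mem (zero_mem O3)]
      · rw [phiE, ← hAe u h0, ← hBe u h0, show u * (6 * (fermatScale : ℂ) * (u ^ 2 * wpE u)) =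
          u ^ 3 * (6 * fermatScale * wpE u) by ring, show 9 * (fermatScale : ℂ) ^ 3 * u ^ 3 +
          u ^ 3 * wpE' u = u ^ 3 * (9 * fermatScale ^ 3 + wpE' u) by ring,
          mul_div_mul_left _ _ (pow_ne_zero 3 h0)]
  · have h1 := hN.div hD (by simp [hB0])
    refine HasDerivAt.congr_of_eventuallyEq (f := fun u : ℂ =>
      (9 * (fermatScale : ℂ) ^ 3 * u ^ 3 - B u) /
      (9 * (fermatScale : ℂ) ^ 3 * u ^ 3 + B u)) ?_ ?_
    · convert! h1 using 1
      simp [hB0, mul_comm]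
    · filter_upwards [hev] with u hu
      by_cases h0 : u = 0
      · simp [h0, psiE_of_mem (zero_mem O3), hB0]
      · rw [psiE_of_notMem (hu h0), ← hBe u h0, show 9 * (fermatScale : ℂ) ^ 3 * u ^ 3 -
          u ^ 3 * wpE' u = u ^ 3 * (9 * fermatScale ^ 3 - wpE' u) by ring,
          show 9 * (fermatScale : ℂ) ^ 3 * u ^ 3 +
          u ^ 3 * wpE' u = u ^ 3 * (9 * fermatScale ^ 3 + wpE' u) by ring,
          mul_div_mul_left _ _ (pow_ne_zero 3 h0)]

theorem hasDerivAt_phiE {u : ℂ} (hp : u ∉ fermatPoles) :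
    HasDerivAt phiE (-3 * fermatScale * psiE u ^ 2) u := by
  by_cases hu : u ∈ O3
  · have h := HasDerivAt.comp_sub_const u u (by rw [sub_self]; exact hasDerivAt_fermat_zero.1)
    rw [psiE_of_mem hu]
    convert! h using 1
    · funext v
      rw [← phiE_add hu (v - u), sub_add_cancel]
    · ring
  · have hD := denom_ne_zero hu hp
    have h := ((hasDerivAt_wpE hu).const_mul (6 * (fermatScale : ℂ))).div
      ((hasDerivAt_wpE' hu).const_add (9 * (fermatScale : ℂ) ^ 3)) hD
    convert! h using 1
    rw [psiE_of_notMem hu, div_pow, ← mul_div_assoc]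
    congr 1
    linear_combination -9 * (fermatScale : ℂ) * wpE'_sq_eq hu

theorem hasDerivAt_psiE {u : ℂ} (hp : u ∉ fermatPoles) :
    HasDerivAt psiE (-3 * fermatScale * phiE u ^ 2) u := by
  by_cases hu : u ∈ O3
  · have h := HasDerivAt.comp_sub_const u u (by rw [sub_self]; exact hasDerivAt_fermat_zero.2)
    rw [phiE_of_mem hu]
    convert! h using 1
    · funext v
      rw [← psiE_add hu (v - u), sub_add_cancel]
    · ring
  · have hD := denom_ne_zero hu hp
    have h := ((hasDerivAt_wpE' hu).const_sub (9 * (fermatScale : ℂ) ^ 3)).div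
      ((hasDerivAt_wpE' hu).const_add (9 * (fermatScale : ℂ) ^ 3)) hD
    have h2 : psiE =ᶠ[𝓝 u] fun u =>
        (9 * (fermatScale : ℂ) ^ 3 - wpE' u) / (9 * fermatScale ^ 3 + wpE' u) := by
      filter_upwards [isOpen_compl_O3.mem_nhds hu] with v hv using psiE_of_notMem hv
    refine HasDerivAt.congr_of_eventuallyEq ?_ h2
    convert! h using 1
    rw [phiE, div_pow, ← mul_div_assoc]
    congr 1
    ring

end

section

theorem tendsto_const_sub_nhdsNE (w z : ℂ) : Tendsto (fun u => w - u) (𝓝[≠] z) (𝓝[≠] (w - z)) := by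
  refine tendsto_nhdsWithin_iff.2 ⟨?_, ?_⟩
  · have : ContinuousAt (fun u : ℂ => w - u) z := by fun_prop
    exact this.tendsto.mono_left nhdsWithin_le_nhds
  · filter_upwards [self_mem_nhdsWithin] with u hu h
    exact hu (sub_right_injective h)

theorem eventually_notMem_fermatPoles_union (w z : ℂ) :
    ∀ᶠ u in 𝓝[≠] z, u ∉ fermatPoles ∪ {u | w - u ∈ fermatPoles} := by
  filter_upwards [eventually_notMem_fermatPoles z,
    (tendsto_const_sub_nhdsNE w z).eventually (eventually_notMem_fermatPoles (w - z))]
    with u h1 h2 h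
  exact h.elim h1 h2

theorem fermat_add_aux {w : ℂ} (hw : w ∉ fermatPoles) {N : ℂ → ℂ → ℂ → ℂ → ℂ} {c : ℂ}
    (h0 : N 0 (-1) (phiE w) (psiE w) = c)
    (hd : ∀ f g f' g' : ℂ → ℂ, ∀ k u : ℂ, HasDerivAt f (k * g u ^ 2) u →
      HasDerivAt g (k * f u ^ 2) u → HasDerivAt f' (-k * g' u ^ 2) u →
      HasDerivAt g' (-k * f' u ^ 2) u → f u ^ 3 - g u ^ 3 = 1 → f' u ^ 3 - g' u ^ 3 = 1 →
      ∃ n : ℂ, HasDerivAt (fun v => N (f v) (g v) (f' v) (g' v)) n u ∧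
        n * (1 - f u ^ 3 * f' u ^ 3) = N (f u) (g u) (f' u) (g' u) *
          (-(3 * f u ^ 2 * (k * g u ^ 2) * f' u ^ 3 + f u ^ 3 * (3 * f' u ^ 2 *
            (-k * g' u ^ 2))))) {u : ℂ} (hu : u ∉ fermatPoles) (hu' : w - u ∉ fermatPoles) :
    N (phiE u) (psiE u) (phiE (w - u)) (psiE (w - u)) =
      c * (1 - phiE u ^ 3 * phiE (w - u) ^ 3) := by
  have hS := eventually_notMem_fermatPoles_union w
  have hder : ∀ v ∈ (fermatPoles ∪ {u | w - u ∈ fermatPoles})ᶜ,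
      HasDerivAt (fun v => 1 - phiE v ^ 3 * phiE (w - v) ^ 3)
      (-(3 * phiE v ^ 2 * (-3 * fermatScale * psiE v ^ 2) * phiE (w - v) ^ 3 + phiE v ^ 3 *
      (3 * phiE (w - v) ^ 2 * (-(-3 * fermatScale) * psiE (w - v) ^ 2)))) v ∧
      ∃ n : ℂ, HasDerivAt (fun v => N (phiE v) (psiE v) (phiE (w - v)) (psiE (w - v))) n v ∧
        n * (1 - phiE v ^ 3 * phiE (w - v) ^ 3) = N (phiE v) (psiE v) (phiE (w - v)) (psiE (w - v)) *
        (-(3 * phiE v ^ 2 * (-3 * fermatScale * psiE v ^ 2) * phiE (w - v) ^ 3 + phiE v ^ 3 *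
      (3 * phiE (w - v) ^ 2 * (-(-3 * fermatScale) * psiE (w - v) ^ 2)))) := by
    intro v hv
    have hv1 : v ∉ fermatPoles := fun h => hv (Or.inl h)
    have hv2 : w - v ∉ fermatPoles := fun h => hv (Or.inr h)
    have e1 := hasDerivAt_phiE hv1
    have e2 := hasDerivAt_psiE hv1
    have e3 : HasDerivAt (fun v => phiE (w - v)) (-(-3 * fermatScale) * psiE (w - v) ^ 2) v := by
      convert! (hasDerivAt_phiE hv2).comp_const_sub w v using 1; ring
    have e4 : HasDerivAt (fun v => psiE (w - v)) (-(-3 * fermatScale) * phiE (w - v) ^ 2) v := by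
      convert! (hasDerivAt_psiE hv2).comp_const_sub w v using 1; ring
    refine ⟨?_, ?_⟩
    · simpa using ((e1.fun_pow 3).mul (e3.fun_pow 3)).const_sub 1
    · exact hd _ _ _ _ _ v e1 e2 e3 e4 (phiE_cube_sub hv1) (phiE_cube_sub hv2)
  have hz : (0 : ℂ) ∈ (fermatPoles ∪ {u | w - u ∈ fermatPoles})ᶜ := by
    rintro (h | h)
    · exact h.1 (zero_mem O3)
    · exact hw (by simpa using h)
  have key := eqOn_zero_of_wronskian (isOpen_compl_of_eventually_notMem hS)
    (isPreconnected_compl_of_eventually_notMem hS)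
    (h := fun v => N (phiE v) (psiE v) (phiE (w - v)) (psiE (w - v)) -
      c * (1 - phiE v ^ 3 * phiE (w - v) ^ 3)) (D := fun v => 1 - phiE v ^ 3 * phiE (w - v) ^ 3)
    (fun v hv => by
      obtain ⟨h1, n, h2, -⟩ := hder v hv
      exact (h2.sub (h1.const_mul c)).differentiableAt.differentiableWithinAt)
    (fun v hv => (hder v hv).1.differentiableAt.differentiableWithinAt)
    (fun v hv => by
      obtain ⟨h1, n, h2, h3⟩ := hder v hv
      rw [(h2.fun_sub (h1.const_mul c)).deriv, h1.deriv]
      linear_combination h3) hz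
    (by simp [phiE_of_mem, psiE_of_mem, zero_mem, h0]) (by simp [phiE_of_mem, zero_mem])
  refine sub_eq_zero.1 (key u ?_)
  exact fun h => h.elim hu hu'

/-- The addition theorem for `φ`. -/
theorem phiE_add_formula {u v : ℂ} (hu : u ∉ fermatPoles) (hv : v ∉ fermatPoles)
    (huv : u + v ∉ fermatPoles) :
    phiE (u + v) * (1 - phiE u ^ 3 * phiE v ^ 3) =
      phiE u * psiE v ^ 2 + phiE v * psiE u ^ 2 - phiE u ^ 2 * phiE v ^ 2 * psiE u * psiE v := by
  have := fermat_add_aux huv (N := fun x₁ y₁ x₂ y₂ =>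
    x₁ * y₂ ^ 2 + x₂ * y₁ ^ 2 - x₁ ^ 2 * x₂ ^ 2 * y₁ * y₂) (c := phiE (u + v)) (by ring)
    (fun f g f' g' k u hf hg hf' hg' h h' => by
      refine ⟨_, ((hf.fun_mul (hg'.fun_pow 2)).fun_add (hf'.fun_mul (hg.fun_pow 2))).fun_sub
        ((((hf.fun_pow 2).fun_mul (hf'.fun_pow 2)).fun_mul hg).fun_mul hg'), ?_⟩
      have e : f u ^ 3 = 1 + g u ^ 3 := by linear_combination h
      have e' : f' u ^ 3 = 1 + g' u ^ 3 := by linear_combination h'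
      simp only [Nat.cast_ofNat, Nat.add_one_sub_one, pow_one]
      grind) hu (by rwa [add_sub_cancel_left])
  rw [add_sub_cancel_left] at this
  exact this.symm

/-- The addition theorem for `ψ`. -/
theorem psiE_add_formula {u v : ℂ} (hu : u ∉ fermatPoles) (hv : v ∉ fermatPoles)
    (huv : u + v ∉ fermatPoles) :
    psiE (u + v) * (1 - phiE u ^ 3 * phiE v ^ 3) =
      -(psiE u * psiE v) + phiE u ^ 2 * phiE v * psiE v ^ 2 +
        phiE u * phiE v ^ 2 * psiE u ^ 2 := by
  have := fermat_add_aux huv (N := fun x₁ y₁ x₂ y₂ =>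
    -(y₁ * y₂) + x₁ ^ 2 * x₂ * y₂ ^ 2 + x₁ * x₂ ^ 2 * y₁ ^ 2) (c := psiE (u + v)) (by ring)
    (fun f g f' g' k u hf hg hf' hg' h h' => by
      refine ⟨_, ((hg.fun_mul hg').fun_neg.fun_add (((hf.fun_pow 2).fun_mul hf').fun_mul
        (hg'.fun_pow 2))).fun_add ((hf.fun_mul (hf'.fun_pow 2)).fun_mul (hg.fun_pow 2)), ?_⟩
      have e : f u ^ 3 = 1 + g u ^ 3 := by linear_combination h
      have e' : f' u ^ 3 = 1 + g' u ^ 3 := by linear_combination h'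
      simp only [Nat.cast_ofNat, Nat.add_one_sub_one, pow_one]
      grind) hu (by rwa [add_sub_cancel_left])
  rw [add_sub_cancel_left] at this
  exact this.symm

end

section

theorem tendsto_add_const_nhdsNE (v : ℂ) : Tendsto (fun u => u + v) (𝓝[≠] 0) (𝓝[≠] v) := by
  refine tendsto_nhdsWithin_iff.2 ⟨?_, ?_⟩
  · have : ContinuousAt (fun u : ℂ => u + v) 0 := by fun_prop
    simpa using this.tendsto.mono_left nhdsWithin_le_nhds
  · filter_upwards [self_mem_nhdsWithin] with u hu h
    exact hu (by simpa using h)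

theorem eventually_add_notMem_fermatPoles (v : ℂ) : ∀ᶠ u in 𝓝[≠] 0, u + v ∉ fermatPoles :=
  (tendsto_add_const_nhdsNE v).eventually (eventually_notMem_fermatPoles v)

theorem fermat_add_psi_zero {u v : ℂ} (hv : v ∉ fermatPoles) (h0 : psiE v = 0)
    (hu : u ∉ fermatPoles) (huv : u + v ∉ fermatPoles) (hy : psiE u ≠ 0) :
    phiE (u + v) = -phiE v / psiE u ∧ psiE (u + v) = -(phiE v ^ 2 * phiE u) / psiE u := by
  have hx := phiE_cube_sub hv
  rw [h0] at hx
  have hx1 := phiE_cube_sub hu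
  have h1 := phiE_add_formula hu hv huv
  have h2 := psiE_add_formula hu hv huv
  rw [h0] at h1 h2
  have h3 : 1 - phiE u ^ 3 * phiE v ^ 3 = -psiE u ^ 3 := by
    linear_combination -hx1 - phiE u ^ 3 * hx
  rw [h3] at h1 h2
  constructor
  · rw [eq_div_iff hy]
    refine mul_right_cancel₀ (pow_ne_zero 2 hy) ?_
    linear_combination -h1
  · rw [eq_div_iff hy]
    refine mul_right_cancel₀ (pow_ne_zero 2 hy) ?_
    linear_combination -h2

theorem three_mul_mem_of_psiE_eq_zero {v : ℂ} (hv : v ∉ fermatPoles) (h0 : psiE v = 0) :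
    3 * v ∈ O3 := by
  have hx := phiE_cube_sub hv
  rw [h0] at hx
  have hx0 : phiE v ≠ 0 := by rintro h; simp [h] at hx
  have h00 := notMem_fermatPoles_of_mem (zero_mem O3)
  have hy1 : ∀ᶠ u in 𝓝[≠] (0 : ℂ), psiE u ≠ 0 := nhdsWithin_le_nhds
    ((hasDerivAt_psiE h00).continuousAt.eventually_ne (by simp [psiE_of_mem, zero_mem]))
  have hx1 : ∀ᶠ u in 𝓝[≠] (0 : ℂ), phiE u ≠ 0 := by
    refine (hasDerivAt_phiE h00).eventually_ne ?_
    simp [psiE_of_mem, zero_mem, fermatScale_pos.ne']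
  have hper : ∀ᶠ u in 𝓝[≠] (0 : ℂ), psiE (u + 3 * v) = psiE u := by
    have hp0 := eventually_add_notMem_fermatPoles 0
    simp only [add_zero] at hp0
    filter_upwards [hx1, hy1, hp0, eventually_add_notMem_fermatPoles v,
      eventually_add_notMem_fermatPoles (v + v), eventually_add_notMem_fermatPoles (v + v + v)]
      with u hx1 hy1 hp0 hp1 hp2 hp3
    rw [← add_assoc] at hp2 hp3
    rw [← add_assoc] at hp3
    obtain ⟨h1, h1'⟩ := fermat_add_psi_zero hv h0 hp0 hp1 hy1
    obtain ⟨h2, h2'⟩ := fermat_add_psi_zero hv h0 hp1 hp2 (by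
      rw [h1']; exact div_ne_zero (neg_ne_zero.2 (mul_ne_zero (pow_ne_zero 2 hx0) hx1)) hy1)
    obtain ⟨h3, h3'⟩ := fermat_add_psi_zero hv h0 hp2 hp3 (by
      rw [h2', h1, h1']
      refine div_ne_zero (neg_ne_zero.2 (mul_ne_zero (pow_ne_zero 2 hx0)
        (div_ne_zero (neg_ne_zero.2 hx0) hy1)))
        (div_ne_zero (neg_ne_zero.2 (mul_ne_zero (pow_ne_zero 2 hx0) hx1)) hy1))
    rw [show u + 3 * v = u + v + v + v by ring, h3', h2, h2', h1, h1']
    field_simp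
  have hlim : Tendsto (fun u => psiE (u + 3 * v)) (𝓝[≠] 0) (𝓝 (-1)) := by
    have := (hasDerivAt_psiE h00).continuousAt.tendsto.mono_left
      (nhdsWithin_le_nhds (s := {0}ᶜ))
    rw [psiE_of_mem (zero_mem O3)] at this
    exact this.congr' (by filter_upwards [hper] with u hu using hu.symm)
  have hadd : Tendsto (fun u => u + 3 * v) (𝓝[≠] 0) (𝓝 (3 * v)) :=
    (tendsto_add_const_nhdsNE (3 * v)).mono_right nhdsWithin_le_nhds
  by_contra hmem
  by_cases hp : 3 * v ∈ fermatPoles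
  · have hc := (differentiableAt_wpE' hmem).continuousAt.tendsto.comp hadd
    rw [hp.2] at hc
    have h1 := hlim.mul (hc.const_add (9 * (fermatScale : ℂ) ^ 3))
    have h2 := hc.const_sub (9 * (fermatScale : ℂ) ^ 3)
    have h3 := tendsto_nhds_unique_of_eventuallyEq h1 h2 (by
      filter_upwards [eventually_add_notMem_fermatPoles (3 * v),
        (tendsto_add_const_nhdsNE (3 * v)).eventually (eventually_notMem_O3 _)] with u hu hu'
      rw [Function.comp_apply, psiE_of_notMem hu', div_mul_cancel₀ _ (denom_ne_zero hu' hu)])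
    have : (18 : ℂ) * fermatScale ^ 3 = 0 := by linear_combination -h3
    simp [fermatScale_pos.ne'] at this
  · have := tendsto_nhds_unique ((hasDerivAt_psiE hp).continuousAt.tendsto.comp hadd) hlim
    exact hmem (eq_of_psiE_eq_neg_one hp this)

theorem three_mul_mem_of_wpE' {v : ℂ} (hv : v ∉ O3) (h : wpE' v = 9 * fermatScale ^ 3) :
    3 * v ∈ O3 := by
  have hp : v ∉ fermatPoles := fun hp => by
    have : (18 : ℂ) * fermatScale ^ 3 = 0 := by linear_combination hp.2 - h
    simp [fermatScale_pos.ne'] at this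
  exact three_mul_mem_of_psiE_eq_zero hp (by rw [psiE_of_notMem hv, h, sub_self, zero_div])

theorem wpE'_neg (u : ℂ) : wpE' (-u) = -wpE' u := eisensteinPair.derivWeierstrassP_neg u

theorem three_mul_mem_of_mem_fermatPoles {v : ℂ} (hv : v ∈ fermatPoles) : 3 * v ∈ O3 := by
  have := three_mul_mem_of_wpE' (v := -v) (fun h => hv.1 (by simpa using h))
    (by rw [wpE'_neg, hv.2, neg_neg])
  simpa using neg_mem this

theorem ofReal_mem_O3 {t : ℝ} (h : (t : ℂ) ∈ O3) : ∃ n : ℤ, t = n := by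
  obtain ⟨a, b, hab⟩ := mem_O3_iff.1 h
  rw [rho3_eq] at hab
  have h1 := congrArg Complex.im hab
  have h2 := congrArg Complex.re hab
  simp at h1 h2
  subst h1
  exact ⟨a, by simpa using h2⟩

theorem ofReal_notMem_O3 {t : ℝ} {n : ℤ} (h0 : n < t) (h1 : t < n + 1) : (t : ℂ) ∉ O3 := by
  intro h
  obtain ⟨k, rfl⟩ := ofReal_mem_O3 h
  have h2 : n < k := by exact_mod_cast h0
  have h3 : k < n + 1 := by exact_mod_cast h1
  omega

theorem wpE'_ofReal (t : ℝ) : wpE' t = ((wpE' t).re : ℂ) := by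
  have := wpE'_conj t
  rw [Complex.conj_ofReal] at this
  exact (Complex.conj_eq_iff_re.1 this.symm).symm

theorem wpE'_third : wpE' (1 / 3) = -(9 * fermatScale ^ 3) := by
  obtain ⟨B, hB, hB0, hBe⟩ := exists_cube_mul_wpE'
  have hev : ∀ᶠ t : ℝ in 𝓝[>] 0, (B t).re + 9 * fermatScale ^ 3 * t ^ 3 < 0 := by
    have h1 : ContinuousAt (fun t : ℝ => (B t).re + 9 * fermatScale ^ 3 * t ^ 3) 0 := by
      have h2 : ContinuousAt (fun t : ℝ => B t) 0 :=
        ContinuousAt.comp (g := B) (by simpa using hB.continuousAt)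
          Complex.continuous_ofReal.continuousAt
      fun_prop
    refine nhdsWithin_le_nhds (h1.eventually_lt continuousAt_const ?_)
    simp [hB0]
  obtain ⟨ε, ⟨hε, hε0⟩, hε1⟩ := ((hev.and self_mem_nhdsWithin).and
    (nhdsWithin_le_nhds (eventually_lt_nhds (show (0 : ℝ) < 1 / 2 by norm_num)))).exists
  have hε0 : (0 : ℝ) < ε := hε0
  have hcont : ContinuousOn (fun t : ℝ => (wpE' t).re) (Set.Icc ε (1 / 2)) := by
    intro t ht
    have hm : (t : ℂ) ∉ O3 :=
      ofReal_notMem_O3 (n := 0) (by push_cast; linarith [ht.1]) (by push_cast; linarith [ht.2])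
    have h1 : ContinuousAt (fun t : ℝ => wpE' t) t :=
      ContinuousAt.comp (g := wpE') (differentiableAt_wpE' hm).continuousAt
        Complex.continuous_ofReal.continuousAt
    have : ContinuousAt (fun t : ℝ => (wpE' t).re) t :=
      Complex.continuous_re.continuousAt.comp h1
    exact this.continuousWithinAt
  have hhalf : wpE' ((1 / 2 : ℝ) : ℂ) = 0 := by
    have h1 : wpE' (-((1 / 2 : ℝ) : ℂ) + 1) = wpE' (-((1 / 2 : ℝ) : ℂ)) := wpE'_add (one_mem O3) _
    rw [wpE'_neg, show (-((1 / 2 : ℝ) : ℂ) + 1) = ((1 / 2 : ℝ) : ℂ) by push_cast; ring] at h1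
    linear_combination h1 / 2
  have hlow : (wpE' ε).re < -(9 * fermatScale ^ 3) := by
    rw [← hBe ε (by exact_mod_cast hε0.ne'), ← Complex.ofReal_pow, Complex.re_ofReal_mul] at hε
    by_contra! hcon
    have := mul_le_mul_of_nonneg_left hcon (pow_pos hε0 3).le
    linarith
  obtain ⟨t, ht, hte⟩ := intermediate_value_Icc hε1.le hcont
    (show -(9 * fermatScale ^ 3) ∈ Set.Icc _ _ from ⟨hlow.le, by
      have := fermatScale_pos
      rw [hhalf, Complex.zero_re]; nlinarith [pow_pos this 3]⟩)
  have hte' : wpE' t = -(9 * fermatScale ^ 3) := by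
    rw [wpE'_ofReal]
    exact_mod_cast hte
  have hm : (t : ℂ) ∉ O3 :=
    ofReal_notMem_O3 (n := 0) (by push_cast; linarith [ht.1]) (by push_cast; linarith [ht.2])
  have h3 := three_mul_mem_of_mem_fermatPoles (v := t) ⟨hm, hte'⟩
  obtain ⟨n, hn⟩ := ofReal_mem_O3 (t := 3 * t) (by exact_mod_cast h3)
  have hn0 : 0 < n := by
    have : (0 : ℝ) < n := by rw [← hn]; linarith [ht.1]
    exact_mod_cast this
  have hn2 : n < 2 := by
    have : (n : ℝ) < 2 := by rw [← hn]; linarith [ht.2]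
    exact_mod_cast this
  obtain rfl : n = 1 := by omega
  have : t = 1 / 3 := by push_cast at hn; linarith
  rw [this] at hte'
  simpa using hte'

theorem exists_rho_pow_of_mem_fermatPoles {u : ℂ} (hu : u ∈ fermatPoles) :
    ∃ j : ℕ, u - ρ3 ^ j / 3 ∈ O3 := by
  obtain ⟨m, n, hmn⟩ := mem_O3_iff.1 (three_mul_mem_of_mem_fermatPoles hu)
  have hk : (fermatScale : ℂ) ≠ 0 := fermatScale_ne_zero
  obtain ⟨m', n', r, s, hr0, hr3, hs0, hs3, hu2⟩ : ∃ m' n' r s : ℤ, 0 ≤ r ∧ r < 3 ∧ 0 ≤ s ∧ s < 3 ∧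
      u = (r + s * ρ3) / 3 + (m' + n' * ρ3) := by
    refine ⟨m / 3, n / 3, m % 3, n % 3, Int.emod_nonneg _ (by norm_num), Int.emod_lt_of_pos _
      (by norm_num), Int.emod_nonneg _ (by norm_num), Int.emod_lt_of_pos _ (by norm_num), ?_⟩
    have e1 : (m : ℂ) = 3 * (m / 3 : ℤ) + (m % 3 : ℤ) := by
      exact_mod_cast (Int.mul_ediv_add_emod m 3).symm
    have e2 : (n : ℂ) = 3 * (n / 3 : ℤ) + (n % 3 : ℤ) := by
      exact_mod_cast (Int.mul_ediv_add_emod n 3).symm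
    rw [e1, e2] at hmn
    linear_combination hmn / 3
  have hmem : ∀ a b : ℤ, (a + b * ρ3 : ℂ) ∈ O3 := fun a b => mem_O3_iff.2 ⟨a, b, rfl⟩
  have hpos : ∀ j : ℕ, wpE' (ρ3 ^ j * (1 / 3)) = -(9 * fermatScale ^ 3) := by
    intro j
    induction j with
    | zero => rw [pow_zero, one_mul, wpE'_third]
    | succ k ih => rw [pow_succ', mul_assoc, wpE'_rho, ih]
  have hneg : ∀ j : ℕ, ¬ u + ρ3 ^ j / 3 ∈ O3 := fun j h => by
    have h1 := wpE'_add h (-u)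
    rw [show -u + (u + ρ3 ^ j / 3) = ρ3 ^ j * (1 / 3) by ring, hpos, wpE'_neg, hu.2] at h1
    have : (18 : ℂ) * fermatScale ^ 3 = 0 := by linear_combination -h1
    simp [fermatScale_pos.ne'] at this
  have ha : wpE u ≠ 0 := fun h => by
    have h1 := wpE'_sq_eq hu.1
    rw [h, hu.2] at h1
    have : (108 : ℂ) * fermatScale ^ 6 = 0 := by linear_combination h1
    simp [fermatScale_pos.ne'] at this
  have hap : ¬ u - aPt ∈ O3 := fun h => ha (by
    have := wpE_add h aPt
    rwa [add_sub_cancel, wpE_aPt] at this)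
  have han : ¬ u + aPt ∈ O3 := fun h => ha (by
    have := wpE_add h (-aPt)
    rwa [show -aPt + (u + aPt) = u by ring, show wpE (-aPt) = wpE aPt from
      eisensteinPair.weierstrassP_neg _, wpE_aPt] at this)
  have h2 := rho3_sq_add
  interval_cases r <;> interval_cases s
  · exact absurd (by rw [hu2]; simpa using hmem m' n') hu.1
  · exact ⟨1, by convert hmem m' n' using 1; rw [hu2]; push_cast; ring⟩
  · exact absurd (by convert hmem m' (n' + 1) using 1; rw [hu2]; push_cast; ring) (hneg 1)
  · exact ⟨0, by convert hmem m' n' using 1; rw [hu2]; push_cast; ring⟩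
  · exact absurd (by
      convert hmem m' n' using 1; rw [hu2]; push_cast; linear_combination h2 / 3) (hneg 2)
  · exact absurd (by convert hmem m' n' using 1; rw [hu2, aPt]; push_cast; ring) han
  · exact absurd (by convert hmem (m' + 1) n' using 1; rw [hu2]; push_cast; ring) (hneg 0)
  · exact absurd (by
      convert hmem (m' + 1) (n' + 1) using 1; rw [hu2, aPt]; push_cast; ring) hap
  · exact ⟨2, by
      convert hmem (m' + 1) (n' + 1) using 1; rw [hu2]; push_cast; linear_combination -h2 / 3⟩

end

section

theorem psiE_conj (u : ℂ) : psiE ((starRingEnd ℂ) u) = (starRingEnd ℂ) (psiE u) := by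
  have h : (starRingEnd ℂ) u ∈ O3 ↔ u ∈ O3 :=
    ⟨fun h => by simpa using conj_mem_O3 h, conj_mem_O3⟩
  rw [psiE, psiE, h]
  split_ifs <;> simp [wpE'_conj, Complex.conj_ofNat]

theorem neg_third_notMem_O3 : (-(1 / 3) : ℂ) ∉ O3 := by
  have := ofReal_notMem_O3 (t := -(1 / 3)) (n := -1) (by norm_num) (by norm_num)
  simpa using this

theorem wpE'_neg_third : wpE' (-(1 / 3)) = 9 * fermatScale ^ 3 := by
  rw [wpE'_neg, wpE'_third, neg_neg]

theorem neg_third_notMem_fermatPoles : (-(1 / 3) : ℂ) ∉ fermatPoles := fun h => by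
  have h1 := h.2
  rw [wpE'_neg_third] at h1
  have : (18 : ℂ) * fermatScale ^ 3 = 0 := by linear_combination h1
  simp [fermatScale_pos.ne'] at this

theorem psiE_neg_third : psiE (-(1 / 3)) = 0 := by
  rw [psiE_of_notMem neg_third_notMem_O3, wpE'_neg_third, sub_self, zero_div]

theorem phiE_ofReal (t : ℝ) : phiE t = ((phiE t).re : ℂ) := by
  have := phiE_conj t
  rw [Complex.conj_ofReal] at this
  exact (Complex.conj_eq_iff_re.1 this.symm).symm

theorem psiE_ofReal (t : ℝ) : psiE t = ((psiE t).re : ℂ) := by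
  have := psiE_conj t
  rw [Complex.conj_ofReal] at this
  exact (Complex.conj_eq_iff_re.1 this.symm).symm

theorem phiE_neg_third : phiE (-(1 / 3)) = 1 := by
  have h := phiE_cube_sub neg_third_notMem_fermatPoles
  have h1 := phiE_ofReal (-(1 / 3))
  rw [psiE_neg_third] at h
  push_cast at h1
  rw [h1] at h
  have h2 : (phiE (-(1 / 3))).re ^ 3 = 1 := by
    have : ((phiE (-(1 / 3))).re : ℂ) ^ 3 = 1 := by linear_combination h
    exact_mod_cast this
  rw [h1, (pow_eq_one_iff_of_ne_zero three_ne_zero).1 h2 |>.resolve_right (by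
    rintro ⟨-, h⟩; exact absurd h (by decide))]
  norm_num

theorem neg_ofReal_notMem_fermatPoles {t : ℝ} (ht : t ∈ Set.Icc 0 (1 / 3 : ℝ)) :
    (-t : ℂ) ∉ fermatPoles := by
  intro h
  have h1 := three_mul_mem_of_mem_fermatPoles h
  obtain ⟨n, hn⟩ := ofReal_mem_O3 (t := -(3 * t)) (by push_cast; convert h1 using 1; ring)
  have h2 : n ≤ 0 := by
    have : (n : ℝ) ≤ 0 := by rw [← hn]; linarith [ht.1]
    exact_mod_cast this
  have h3 : -1 ≤ n := by
    have : (-1 : ℝ) ≤ n := by rw [← hn]; linarith [ht.2]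
    exact_mod_cast this
  obtain rfl | rfl : n = 0 ∨ n = -1 := by omega
  · have : t = 0 := by push_cast at hn; linarith
    subst this
    exact h.1 (by simp)
  · have : t = 1 / 3 := by push_cast at hn; linarith
    subst this
    exact neg_third_notMem_fermatPoles (by simpa using h)

theorem psiE_neg_ofReal_ne_zero {t : ℝ} (ht : t ∈ Set.Ioo 0 (1 / 3 : ℝ)) : psiE (-t) ≠ 0 := by
  intro h
  have h1 := three_mul_mem_of_psiE_eq_zero
    (neg_ofReal_notMem_fermatPoles (Set.Ioo_subset_Icc_self ht)) h
  obtain ⟨n, hn⟩ := ofReal_mem_O3 (t := -(3 * t)) (by push_cast; convert h1 using 1; ring)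
  have h2 : n < 0 := by
    have : (n : ℝ) < 0 := by rw [← hn]; linarith [ht.1]
    exact_mod_cast this
  have h3 : -1 < n := by
    have : (-1 : ℝ) < n := by rw [← hn]; linarith [ht.2]
    exact_mod_cast this
  omega

theorem hasDerivAt_re_phiE_neg {t : ℝ} (ht : t ∈ Set.Icc 0 (1 / 3 : ℝ)) :
    HasDerivAt (fun t : ℝ => (phiE (-t)).re) (3 * fermatScale * (psiE (-t)).re ^ 2) t := by
  have h1 := hasDerivAt_phiE (neg_ofReal_notMem_fermatPoles ht)
  have h2 : HasDerivAt (fun z : ℂ => phiE (-z)) (3 * fermatScale * psiE (-t) ^ 2) t := by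
    convert! h1.comp (t : ℂ) (hasDerivAt_neg (t : ℂ)) using 1
    ring
  have h3 := psiE_ofReal (-t)
  push_cast at h3
  convert h2.real_of_complex using 1
  rw [h3, ← Complex.ofReal_pow, ← Complex.ofReal_ofNat, ← Complex.ofReal_mul,
    ← Complex.ofReal_mul, Complex.ofReal_re, Complex.ofReal_re]

theorem varpi1_eq : varpi1 = fermatScale := by
  set X : ℝ → ℝ := fun t => (phiE (-t)).re with hX
  have hd : ∀ t ∈ Set.Icc 0 (1 / 3 : ℝ), HasDerivAt X (3 * fermatScale * (psiE (-t)).re ^ 2) t :=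
    fun t ht => hasDerivAt_re_phiE_neg ht
  have hXc : ∀ t : ℝ, phiE (-t) = X t := fun t => by
    have := phiE_ofReal (-t)
    push_cast at this
    exact this
  have hYc : ∀ t : ℝ, psiE (-t) = ((psiE (-t)).re : ℝ) := fun t => by
    have := psiE_ofReal (-t)
    push_cast at this
    exact this
  have hX0 : X 0 = 0 := by simp [hX, phiE_of_mem, zero_mem]
  have hX1 : X (1 / 3) = 1 := by
    have := phiE_neg_third
    simp only [hX]
    push_cast
    rw [this, Complex.one_re]
  have hcont : ContinuousOn X (Set.Icc 0 (1 / 3)) :=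
    fun t ht => (hd t ht).continuousAt.continuousWithinAt
  have hY : ∀ t ∈ Set.Ioo 0 (1 / 3 : ℝ), (psiE (-t)).re ≠ 0 := fun t ht h => by
    refine psiE_neg_ofReal_ne_zero ht ?_
    rw [hYc, h, Complex.ofReal_zero]
  have hmono : StrictMonoOn X (Set.Icc 0 (1 / 3)) := by
    refine strictMonoOn_of_deriv_pos (convex_Icc _ _) hcont fun t ht => ?_
    rw [interior_Icc] at ht
    rw [(hd t (Set.Ioo_subset_Icc_self ht)).deriv]
    have := hY t ht
    have := fermatScale_pos
    positivity
  have h01 : (0 : ℝ) ≤ 1 / 3 := by norm_num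
  have hmaps : ∀ t ∈ Set.Ioo 0 (1 / 3 : ℝ), X t ∈ Set.Ioo 0 1 := fun t ht =>
    ⟨hX0 ▸ hmono ⟨le_rfl, h01⟩ (Set.Ioo_subset_Icc_self ht) ht.1,
      hX1 ▸ hmono (Set.Ioo_subset_Icc_self ht) ⟨h01, le_rfl⟩ ht.2⟩
  have himage : X '' Set.Ioo 0 (1 / 3) = Set.Ioo 0 1 := by
    refine Set.Subset.antisymm (Set.image_subset_iff.2 hmaps) ?_
    have := intermediate_value_Ioo h01 hcont
    rwa [hX0, hX1] at this
  have hsub := MeasureTheory.integral_image_eq_integral_abs_deriv_smul measurableSet_Ioo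
    (fun t ht => (hd t (Set.Ioo_subset_Icc_self ht)).hasDerivWithinAt)
    (hmono.injOn.mono Set.Ioo_subset_Icc_self) (fun x => (1 - x ^ 3) ^ (-(2 : ℝ) / 3))
  rw [himage] at hsub
  rw [varpi1, intervalIntegral.integral_of_le zero_le_one, MeasureTheory.integral_Ioc_eq_integral_Ioo,
    hsub, MeasureTheory.setIntegral_congr_fun (g := fun _ => 3 * fermatScale) measurableSet_Ioo,
    MeasureTheory.setIntegral_const]
  · simp
  · intro t ht
    have hc := phiE_cube_sub (neg_ofReal_notMem_fermatPoles (Set.Ioo_subset_Icc_self ht))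
    rw [hXc, hYc] at hc
    have hc' : 1 - X t ^ 3 = (-(psiE (-t)).re) ^ 3 := by
      have : (X t) ^ 3 - (psiE (-t)).re ^ 3 = 1 := by exact_mod_cast hc
      linear_combination -this
    have hpos : 0 < -(psiE (-t)).re := by
      have h1 : 0 < (-(psiE (-t)).re) ^ 3 := by
        rw [← hc']
        have := pow_lt_one₀ (hmaps t ht).1.le (hmaps t ht).2 three_ne_zero
        linarith
      exact (Odd.pow_pos_iff (by decide)).1 h1
    have hne := hY t ht
    have hκ := fermatScale_pos
    change |3 * fermatScale * (psiE (-t)).re ^ 2| • (1 - X t ^ 3) ^ (-(2 : ℝ) / 3) = 3 * fermatScale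
    rw [hc', ← Real.rpow_natCast (-(psiE (-t)).re) 3, ← Real.rpow_mul hpos.le,
      abs_of_pos (by positivity), smul_eq_mul, show ((3 : ℕ) : ℝ) * (-2 / 3) = -((2 : ℕ) : ℝ) by
        norm_num, Real.rpow_neg hpos.le, Real.rpow_natCast, neg_sq, mul_assoc,
        mul_inv_cancel₀ (pow_ne_zero 2 hne), mul_one]

theorem varpi1_ne_zero : (varpi1 : ℂ) ≠ 0 := by rw [varpi1_eq]; exact fermatScale_ne_zero

theorem omega3_eq (m : ℤ × ℤ) :
    ω3 m = varpi1 * (eisensteinPair.latticeEquivProd.symm m : eisensteinPair.lattice) := by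
  rw [PeriodPair.latticeEquiv_symm_apply, ω3]
  simp [eisensteinPair]

theorem wp3_eq (u : ℂ) : wp3 (varpi1 * u) = (varpi1 ^ 2 : ℂ)⁻¹ * wpE u := by
  have hw := varpi1_ne_zero
  have h1 := (eisensteinPair.hasSum_weierstrassP u)
  rw [← eisensteinPair.latticeEquivProd.symm.toEquiv.hasSum_iff] at h1
  have h2 := (h1.mul_left (varpi1 ^ 2 : ℂ)⁻¹)
  have h3 := h2.summable.tsum_eq_add_tsum_ite 0
  rw [h2.tsum_eq] at h3
  rw [wpE, h3, wp3]
  congr 1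
  · simp [mul_pow, mul_comm]
  · refine tsum_congr fun m => ?_
    split_ifs
    · rfl
    · rw [omega3_eq, ← mul_sub, mul_pow, mul_pow, mul_inv, mul_inv, ← mul_sub]
      simp

theorem wp3'_eq (u : ℂ) : wp3' (varpi1 * u) = (varpi1 ^ 3 : ℂ)⁻¹ * wpE' u := by
  rw [wpE', PeriodPair.derivWeierstrassP, ← tsum_neg, ← tsum_mul_left,
    ← eisensteinPair.latticeEquivProd.symm.toEquiv.tsum_eq, wp3']
  refine tsum_congr fun m => ?_
  rw [omega3_eq, ← mul_sub, mul_pow, mul_inv, div_eq_mul_inv]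
  simp only [LinearEquiv.coe_toEquiv]
  ring

theorem phi3_eq : phi3 = phiE := by
  funext u
  have hw := varpi1_ne_zero
  rw [phi3, phiE, wp3_eq, wp3'_eq, ← varpi1_eq]
  rw [← mul_div_mul_left _ _ (pow_ne_zero 3 hw)]
  congr 1 <;> field_simp

end

section

theorem dense_compl_of_eventually_notMem {S : Set ℂ} (hS : ∀ z, ∀ᶠ u in 𝓝[≠] z, u ∉ S) :
    Dense Sᶜ := fun z => mem_closure_iff_frequently.2
  ((hS z).frequently.filter_mono nhdsWithin_le_nhds)

/-- The multipliers of a function that is quasi-periodic off `ℤ[ρ]`. -/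
def unitaryPeriods (f : ℂ → ℂ) : AddSubgroup ℂ where
  carrier := {w | w ∈ O3 ∧ ∃ μ : ℂ, ‖μ‖ = 1 ∧ ∀ u ∉ O3, f (u + w) = μ * f u}
  zero_mem' := ⟨zero_mem _, 1, by simp, by simp⟩
  add_mem' := by
    rintro v w ⟨hv, μ, hμ, h⟩ ⟨hw, ν, hν, h'⟩
    refine ⟨add_mem hv hw, ν * μ, by simp [hμ, hν], fun u hu => ?_⟩
    rw [← add_assoc, h' _ (by rwa [add_mem_O3_iff hv]), h u hu, mul_assoc]
  neg_mem' := by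
    rintro w ⟨hw, μ, hμ, h⟩
    refine ⟨neg_mem hw, μ⁻¹, by simp [hμ], fun u hu => ?_⟩
    have h0 : μ ≠ 0 := by rintro rfl; simp at hμ
    have := h (u + -w) (by rwa [add_mem_O3_iff (neg_mem hw)])
    rw [neg_add_cancel_right] at this
    rw [this, inv_mul_cancel_left₀ h0]

theorem mem_unitaryPeriods {f : ℂ → ℂ} {α β : ℂ} (hα : ‖α‖ = 1) (hβ : ‖β‖ = 1)
    (h1 : ∀ u ∉ O3, f (u + 1) = α * f u) (h2 : ∀ u ∉ O3, f (u + ρ3) = β * f u) {w : ℂ}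
    (hw : w ∈ O3) : w ∈ unitaryPeriods f := by
  obtain ⟨m, n, rfl⟩ := mem_O3_iff.1 hw
  have a1 : (1 : ℂ) ∈ unitaryPeriods f := ⟨one_mem _, α, hα, h1⟩
  have a2 : ρ3 ∈ unitaryPeriods f := ⟨rho3_mem, β, hβ, h2⟩
  simpa using add_mem (zsmul_mem a1 m) (zsmul_mem a2 n)

theorem exists_sub_mem_O3_norm_le (u : ℂ) : ∃ w ∈ O3, ‖u - w‖ ≤ 2 := by
  have h3 : Real.sqrt 3 ≠ 0 := by positivity
  obtain ⟨y, hy⟩ : ∃ y : ℝ, u.im = y * (Real.sqrt 3 / 2) :=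
    ⟨u.im / (Real.sqrt 3 / 2), by field_simp⟩
  obtain ⟨x, hx⟩ : ∃ x : ℝ, u.re = x - y / 2 := ⟨u.re + y / 2, by ring⟩
  have hu : u = x + y * ρ3 := by
    rw [rho3_eq]
    apply Complex.ext
    · simp [hx]; ring
    · simp [hy]
  refine ⟨⌊x⌋ + ⌊y⌋ * ρ3, mem_O3_iff.2 ⟨_, _, rfl⟩, ?_⟩
  have h : u - (⌊x⌋ + ⌊y⌋ * ρ3) = (Int.fract x : ℝ) + (Int.fract y : ℝ) * ρ3 := by
    rw [hu, Int.fract, Int.fract]; push_cast; ring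
  have hr : ‖ρ3‖ = 1 := by
    have := congrArg norm rho3_cube
    rw [norm_pow, norm_one] at this
    exact (pow_eq_one_iff_of_nonneg (norm_nonneg _) (by norm_num)).1 this
  rw [h]
  refine (norm_add_le _ _).trans ?_
  rw [norm_mul, hr, Complex.norm_real, Complex.norm_real, Real.norm_of_nonneg (Int.fract_nonneg _),
    Real.norm_of_nonneg (Int.fract_nonneg _)]
  linarith [Int.fract_lt_one x, Int.fract_lt_one y]

theorem eq_zero_of_quasiPeriodic {f : ℂ → ℂ} {α β : ℂ} (hα : ‖α‖ = 1) (hβ : ‖β‖ = 1) (hα1 : α ≠ 1)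
    (hd : ∀ u ∉ O3, DifferentiableAt ℂ f u) (h0 : Tendsto (fun u => u * f u) (𝓝[≠] 0) (𝓝 0))
    (h1 : ∀ u ∉ O3, f (u + 1) = α * f u) (h2 : ∀ u ∉ O3, f (u + ρ3) = β * f u) {u : ℂ}
    (hu : u ∉ O3) : f u = 0 := by
  classical
  have hper : ∀ w ∈ O3, ∃ μ : ℂ, ‖μ‖ = 1 ∧ ∀ u ∉ O3, f (u + w) = μ * f u := fun w hw =>
    (mem_unitaryPeriods hα hβ h1 h2 hw).2
  set F : ℂ → ℂ := fun u => if u ∈ O3 then limUnder (𝓝[≠] u) f else f u with hF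
  have hFf : ∀ u ∉ O3, F u = f u := fun u hu => if_neg hu
  have hlim : ∀ w ∈ O3, Tendsto (fun u => (u - w) * f u) (𝓝[≠] w) (𝓝 0) := by
    intro w hw
    obtain ⟨μ, -, hμ⟩ := hper w hw
    have := ((h0.comp (tendsto_sub_nhdsNE w)).const_mul μ)
    rw [mul_zero] at this
    refine this.congr' ?_
    filter_upwards [eventually_notMem_O3 w] with u hu
    have h' := hμ (u - w) (fun h => hu (by simpa using add_mem h hw))
    rw [sub_add_cancel] at h'
    rw [h', Function.comp]; ring
  have hFd : Differentiable ℂ F := by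
    intro z
    by_cases hz : z ∈ O3
    · have hev := eventually_nhdsWithin_iff.1 (eventually_notMem_O3 z)
      set s := {u : ℂ | u ∈ ({z}ᶜ : Set ℂ) → u ∉ O3} with hs
      have hd' : DifferentiableOn ℂ f (s \ {z}) := fun u hu =>
        (hd u (hu.1 hu.2)).differentiableWithinAt
      have ho : (fun u => f u - f z) =o[𝓝[≠] z] fun u => (u - z)⁻¹ := by
        rw [Asymptotics.isLittleO_iff_tendsto']
        · have t1 : Tendsto (fun u : ℂ => (u - z) * f z) (𝓝[≠] z) (𝓝 0) := by
            have := ((tendsto_sub_nhdsNE z).mono_right nhdsWithin_le_nhds).mul_const (f z)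
            simpa using this
          have := (hlim z hz).sub t1
          rw [sub_zero] at this
          refine this.congr fun u => ?_
          rw [div_inv_eq_mul]; ring
        · filter_upwards [self_mem_nhdsWithin] with u hu hu'
          exact absurd (sub_eq_zero.1 (inv_eq_zero.1 hu')) hu
      have := Complex.differentiableOn_update_limUnder_of_isLittleO hev hd' ho
      refine (this.differentiableAt hev).congr_of_eventuallyEq ?_
      filter_upwards [hev] with u hu
      by_cases huz : u = z
      · subst huz; simp [hF, hz]
      · rw [hFf u (hu huz), Function.update_of_ne huz]
    · refine (hd z hz).congr_of_eventuallyEq ?_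
      filter_upwards [isOpen_compl_O3.mem_nhds hz] with u hu using hFf u hu
  have hdense : Dense ((O3 : Set ℂ)ᶜ) := dense_compl_of_eventually_notMem eventually_notMem_O3
  have hFper : ∀ w ∈ O3, ∀ μ : ℂ, (∀ u ∉ O3, f (u + w) = μ * f u) → ∀ u, F (u + w) = μ * F u := by
    intro w hw μ hμ u
    have hc : Continuous F := hFd.continuous
    refine congrFun (Continuous.ext_on (f := fun u => F (u + w)) (g := fun u => μ * F u) hdense
      (by fun_prop) (by fun_prop) fun v hv => ?_) u
    show F (v + w) = μ * F v
    rw [hFf v hv, hFf _ (by rwa [add_mem_O3_iff hw]), hμ v hv]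
  obtain ⟨C, hC⟩ := (isCompact_closedBall (0 : ℂ) 2).exists_bound_of_continuousOn
    hFd.continuous.continuousOn
  have hbd : Bornology.IsBounded (Set.range F) := by
    refine isBounded_iff_forall_norm_le.2 ⟨C, ?_⟩
    rintro _ ⟨u, rfl⟩
    obtain ⟨w, hw, hle⟩ := exists_sub_mem_O3_norm_le u
    obtain ⟨μ, hμ1, hμ⟩ := hper w hw
    have := hFper w hw μ hμ (u - w)
    rw [sub_add_cancel] at this
    rw [this, norm_mul, hμ1, one_mul]
    exact hC _ (by simpa using hle)
  have hconst := hFd.apply_eq_apply_of_bounded hbd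
  have h := hFper 1 (one_mem _) α h1 u
  rw [hconst (u + 1) u] at h
  rw [← hFf u hu]
  have h' : (α - 1) * F u = 0 := by linear_combination -h
  exact (mul_eq_zero.1 h').resolve_left (sub_ne_zero.2 hα1)

/-- Two functions with the same nontrivial unitary multipliers for the lattice `ω ℤ[ρ]` and at most
simple poles at `c + ω ℤ[ρ]` are proportional. -/
theorem mul_eq_mul_of_quasiPeriodic {f g : ℂ → ℂ} {α β ω c r s : ℂ} (hα : ‖α‖ = 1) (hβ : ‖β‖ = 1)
    (hα1 : α ≠ 1) (hω : ω ≠ 0)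
    (hf : ∀ u, (u - c) / ω ∉ O3 → DifferentiableAt ℂ f u)
    (hg : ∀ u, (u - c) / ω ∉ O3 → DifferentiableAt ℂ g u)
    (hfr : Tendsto (fun u => u * f (u + c)) (𝓝[≠] 0) (𝓝 r))
    (hgs : Tendsto (fun u => u * g (u + c)) (𝓝[≠] 0) (𝓝 s))
    (hf1 : ∀ u, (u - c) / ω ∉ O3 → f (u + ω) = α * f u)
    (hg1 : ∀ u, (u - c) / ω ∉ O3 → g (u + ω) = α * g u)
    (hf2 : ∀ u, (u - c) / ω ∉ O3 → f (u + ρ3 * ω) = β * f u)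
    (hg2 : ∀ u, (u - c) / ω ∉ O3 → g (u + ρ3 * ω) = β * g u) {u : ℂ} (hu : (u - c) / ω ∉ O3) :
    s * f u = r * g u := by
  have hmem : ∀ v ∉ O3, (v * ω + c - c) / ω ∉ O3 := fun v hv => by
    rwa [add_sub_cancel_right, mul_div_cancel_right₀ _ hω]
  have key := eq_zero_of_quasiPeriodic (f := fun v => s * f (v * ω + c) - r * g (v * ω + c))
    (u := (u - c) / ω) hα hβ hα1 ?_ ?_ ?_ ?_ hu
  · rw [div_mul_cancel₀ _ hω, sub_add_cancel] at key
    exact sub_eq_zero.1 key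
  · intro v hv
    have h1 := (hf _ (hmem v hv)).comp (f := fun v : ℂ => v * ω + c) v (by fun_prop)
    have h2 := (hg _ (hmem v hv)).comp (f := fun v : ℂ => v * ω + c) v (by fun_prop)
    exact (h1.const_mul s).sub (h2.const_mul r)
  · have ht : Tendsto (fun v : ℂ => v * ω) (𝓝[≠] 0) (𝓝[≠] 0) := by
      refine tendsto_nhdsWithin_iff.2 ⟨?_, ?_⟩
      · have : ContinuousAt (fun v : ℂ => v * ω) 0 := by fun_prop
        simpa using this.tendsto.mono_left nhdsWithin_le_nhds
      · filter_upwards [self_mem_nhdsWithin] with v hv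
        exact mul_ne_zero hv hω
    have h1 := (((hfr.comp ht).const_mul s).sub ((hgs.comp ht).const_mul r)).const_mul ω⁻¹
    rw [mul_comm s r, sub_self, mul_zero] at h1
    refine h1.congr fun v => ?_
    simp only [Function.comp]
    field_simp
  · intro v hv
    rw [show (v + 1) * ω + c = v * ω + c + ω by ring, hf1 _ (hmem v hv), hg1 _ (hmem v hv)]
    ring
  · intro v hv
    rw [show (v + ρ3) * ω + c = v * ω + c + ρ3 * ω by ring, hf2 _ (hmem v hv), hg2 _ (hmem v hv)]
    ring

end

section

theorem aPt_mul : aPt * (1 + 2 * ρ3) = 1 := by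
  rw [aPt]; linear_combination (-4 / 3 : ℂ) * rho3_sq_add

theorem aPt_ne_zero : aPt ≠ 0 := left_ne_zero_of_mul_eq_one aPt_mul

theorem div_aPt (z : ℂ) : z / aPt = z * (1 + 2 * ρ3) := by
  rw [div_eq_iff aPt_ne_zero, mul_assoc, mul_comm (1 + 2 * ρ3), aPt_mul, mul_one]

theorem div_aPt_mem {w : ℂ} (hw : w ∈ O3) : w / aPt ∈ O3 := by
  rw [div_aPt]
  exact mul_mem hw (mem_O3_iff.2 ⟨1, 2, by push_cast; ring⟩)

theorem third_notMem_O3 : (1 / 3 : ℂ) ∉ O3 := fun h => by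
  have := neg_mem h
  exact neg_third_notMem_O3 this

theorem rho_pow_div_three_mem_fermatPoles (j : ℕ) : ρ3 ^ j / 3 ∈ fermatPoles := by
  induction j with
  | zero => exact ⟨by simpa using third_notMem_O3, by simpa using wpE'_third⟩
  | succ j ih =>
    rw [pow_succ', mul_div_assoc]
    exact ⟨by rw [rho_mul_mem_O3_iff]; exact ih.1, by rw [wpE'_rho]; exact ih.2⟩

theorem mem_fermatPoles_iff {u : ℂ} : u ∈ fermatPoles ↔ (u - 1 / 3) / aPt ∈ O3 := by
  constructor
  · intro hu
    obtain ⟨j, hj⟩ := exists_rho_pow_of_mem_fermatPoles hu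
    have h : ∀ j : ℕ, (ρ3 ^ j / 3 - 1 / 3) / aPt ∈ O3 := by
      intro j
      induction j with
      | zero => simp
      | succ j ih =>
        have : (ρ3 ^ (j + 1) / 3 - 1 / 3) / aPt =
            ρ3 * ((ρ3 ^ j / 3 - 1 / 3) / aPt) - (1 + ρ3) := by
          rw [div_aPt, div_aPt, pow_succ]
          linear_combination (2 / 3 : ℂ) * rho3_sq_add
        rw [this]
        exact sub_mem (mul_mem rho3_mem ih) (add_mem (one_mem _) rho3_mem)
    have := add_mem (div_aPt_mem hj) (h j)
    rwa [← add_div, sub_add_sub_cancel] at this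
  · intro hu
    obtain ⟨m, n, hmn⟩ := mem_O3_iff.1 hu
    rw [div_eq_iff aPt_ne_zero, aPt] at hmn
    obtain ⟨k, t, hk, hmk⟩ : ∃ k t : ℤ, (k = 0 ∨ k = 1 ∨ k = 2) ∧ m = k - n + 3 * t :=
      ⟨(m + n) % 3, (m + n) / 3, by omega, by omega⟩
    obtain ⟨j, w, hw, hj⟩ : ∃ j : ℕ, ∃ w ∈ O3, u = ρ3 ^ j / 3 + w := by
      subst hmk
      push_cast at hmn
      rcases hk with rfl | rfl | rfl
      · refine ⟨0, ((n - t : ℤ) : ℂ) + (n - 2 * t : ℤ) * ρ3, mem_O3_iff.2 ⟨_, _, rfl⟩, ?_⟩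
        push_cast at hmn ⊢
        linear_combination hmn - (2 / 3 : ℂ) * n * rho3_sq_add
      · refine ⟨1, ((n - t : ℤ) : ℂ) + (n - 2 * t - 1 : ℤ) * ρ3, mem_O3_iff.2 ⟨_, _, rfl⟩, ?_⟩
        push_cast at hmn ⊢
        linear_combination hmn - (2 / 3 : ℂ) * n * rho3_sq_add
      · refine ⟨2, ((n - t : ℤ) : ℂ) + (n - 2 * t - 1 : ℤ) * ρ3, mem_O3_iff.2 ⟨_, _, rfl⟩, ?_⟩
        push_cast at hmn ⊢
        linear_combination hmn - (2 * n / 3 + 1 / 3 : ℂ) * rho3_sq_add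
    rw [hj, fermatPoles_add hw]
    exact rho_pow_div_three_mem_fermatPoles j

theorem fermatPoles_add_aPt_mul {w : ℂ} (hw : w ∈ O3) (u : ℂ) :
    u + w * aPt ∈ fermatPoles ↔ u ∈ fermatPoles := by
  rw [mem_fermatPoles_iff, mem_fermatPoles_iff, ← add_mem_O3_iff hw (u := (u - 1 / 3) / aPt),
    show u + w * aPt - 1 / 3 = u - 1 / 3 + w * aPt by ring, add_div,
    mul_div_cancel_right₀ _ aPt_ne_zero]

theorem phiE_of_mem_fermatPoles {u : ℂ} (hu : u ∈ fermatPoles) : phiE u = 0 := by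
  rw [phiE, hu.2, add_neg_cancel, div_zero]

theorem phiE_aPt : phiE aPt = 0 := by rw [phiE, wpE_aPt]; ring

theorem aPt_notMem_fermatPoles : aPt ∉ fermatPoles := fun h => by
  have := (fermatPoles_add_aPt_mul (one_mem O3) 0).1 (by simpa using h)
  exact this.1 (zero_mem _)

theorem psiE_aPt : psiE aPt = -ρ3 := by
  have h1 : phiE (-(1 / 3)) = phiE (ρ3 * -(1 / 3) + aPt) := by
    rw [← phiE_add rho3_mem (ρ3 * -(1 / 3) + aPt)]
    congr 1; rw [aPt]; ring
  have hp : ρ3 * -(1 / 3) ∉ fermatPoles := fun h =>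
    neg_third_notMem_fermatPoles ⟨by rw [← rho_mul_mem_O3_iff]; exact h.1,
      by rw [← wpE'_rho]; exact h.2⟩
  have h2 := phiE_add_formula hp aPt_notMem_fermatPoles
    (by have := fermatPoles_add_aPt_mul (one_mem O3) (ρ3 * -(1 / 3)); rw [one_mul] at this
        rwa [this])
  rw [← h1, phiE_rho, phiE_neg_third, phiE_aPt] at h2
  have h3 := phiE_cube_sub aPt_notMem_fermatPoles
  rw [phiE_aPt] at h3
  linear_combination psiE aPt * h2 - ρ3 * h3

theorem fermat_add_aPt {u : ℂ} (hu : u ∉ fermatPoles) :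
    phiE (u + aPt) = ρ3 ^ 2 * phiE u ∧ psiE (u + aPt) = ρ3 * psiE u := by
  have hu' : u + aPt ∉ fermatPoles := by
    have := fermatPoles_add_aPt_mul (one_mem O3) u
    rw [one_mul] at this
    rwa [this]
  have h1 := phiE_add_formula hu aPt_notMem_fermatPoles hu'
  have h2 := psiE_add_formula hu aPt_notMem_fermatPoles hu'
  rw [phiE_aPt, psiE_aPt] at h1 h2
  exact ⟨by linear_combination h1, by linear_combination h2⟩

theorem phiE_add_aPt (u : ℂ) : phiE (u + aPt) = ρ3 ^ 2 * phiE u := by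
  by_cases hu : u ∈ fermatPoles
  · rw [phiE_of_mem_fermatPoles hu, phiE_of_mem_fermatPoles, mul_zero]
    have := fermatPoles_add_aPt_mul (one_mem O3) u
    rw [one_mul] at this
    rwa [this]
  · exact (fermat_add_aPt hu).1

theorem phiE_add_rho_mul_aPt (u : ℂ) : phiE (u + ρ3 * aPt) = ρ3 ^ 2 * phiE u := by
  have h1 : u + ρ3 * aPt = ρ3 * (ρ3 ^ 2 * u + aPt) := by linear_combination -u * rho3_cube
  have h2 : ρ3 * phiE (ρ3 ^ 2 * u) = phiE u := by
    rw [← phiE_rho]; congr 1; linear_combination u * rho3_cube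
  rw [h1, phiE_rho, phiE_add_aPt, ← h2]; ring

theorem neg_mem_fermatPoles_of_psiE_eq_zero {u : ℂ} (hu : u ∉ fermatPoles) (h : psiE u = 0) :
    -u ∈ fermatPoles := by
  have hO : u ∉ O3 := fun hO => by rw [psiE_of_mem hO] at h; norm_num at h
  rw [psiE_of_notMem hO, div_eq_zero_iff] at h
  refine ⟨fun h' => hO (by simpa using neg_mem h'), ?_⟩
  rw [wpE'_neg]
  linear_combination h.resolve_right (denom_ne_zero hO hu)

theorem sub_third_mem_fermatPoles {u : ℂ} (h : -u ∈ fermatPoles) : u - 1 / 3 ∈ fermatPoles := by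
  rw [mem_fermatPoles_iff] at h ⊢
  have : (u - 1 / 3 - 1 / 3) / aPt = -((-u - 1 / 3) / aPt) - 1 / aPt := by ring
  rw [this]
  exact sub_mem (neg_mem h) (div_aPt_mem (one_mem _))

theorem phiE_add_third_mul {u : ℂ} (hu : u ∉ fermatPoles) (hu' : u + 1 / 3 ∉ fermatPoles) :
    phiE (u + 1 / 3) * phiE u = psiE u := by
  have hy : psiE (u + 1 / 3) ≠ 0 := fun h0 => hu (by
    have := sub_third_mem_fermatPoles (neg_mem_fermatPoles_of_psiE_eq_zero hu' h0)
    rwa [add_sub_cancel_right] at this)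
  have h := fermat_add_psi_zero neg_third_notMem_fermatPoles psiE_neg_third hu'
    (by rwa [add_neg_cancel_right]) hy
  rw [add_neg_cancel_right, phiE_neg_third] at h
  rw [h.1, h.2]
  field_simp

theorem phiE_sub_third {u : ℂ} (hu : u ∉ fermatPoles) (hu' : -u ∉ fermatPoles)
    (hu'' : u - 1 / 3 ∉ fermatPoles) : phiE (u - 1 / 3) = -(psiE u)⁻¹ := by
  have hy : psiE u ≠ 0 := fun h0 => hu' (neg_mem_fermatPoles_of_psiE_eq_zero hu h0)
  have h := fermat_add_psi_zero neg_third_notMem_fermatPoles psiE_neg_third hu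
    (by rwa [← sub_eq_add_neg]) hy
  rw [← sub_eq_add_neg, phiE_neg_third] at h
  rw [h.1, neg_div, one_div]

theorem phiE_zero : phiE 0 = 0 := phiE_of_mem (zero_mem _)

theorem tendsto_mul_phiE_add_third :
    Tendsto (fun u => u * phiE (u + 1 / 3)) (𝓝[≠] 0) (𝓝 (3 * fermatScale : ℂ)⁻¹) := by
  have h0 := notMem_fermatPoles_of_mem (zero_mem O3)
  have h1 := (hasDerivAt_iff_tendsto_slope.1 (hasDerivAt_phiE h0))
  have h2 := ((hasDerivAt_psiE h0).continuousAt.tendsto.mono_left (nhdsWithin_le_nhds (s := {0}ᶜ)))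
  rw [psiE_of_mem (zero_mem O3)] at h1 h2
  have hk := fermatScale_ne_zero
  have h3 := h2.div h1 (by simpa using hk)
  rw [show -1 / (-3 * (fermatScale : ℂ) * (-1) ^ 2) = (3 * fermatScale : ℂ)⁻¹ by field_simp] at h3
  refine h3.congr' ?_
  filter_upwards [eventually_notMem_fermatPoles 0, eventually_add_notMem_fermatPoles (1 / 3),
    h1.eventually_ne (b₂ := 0) (by simpa using hk), self_mem_nhdsWithin] with u hu hu' hne hu0
  rw [slope_def_field, phiE_zero, sub_zero, sub_zero] at hne
  have hu0' : u ≠ 0 := hu0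
  have hx : phiE u ≠ 0 := (div_ne_zero_iff.1 hne).1
  show psiE u / slope phiE 0 u = _
  rw [← phiE_add_third_mul hu hu', slope_def_field, phiE_zero, sub_zero, sub_zero]
  field_simp

theorem mem_fermatPoles_iff_sub {c : ℂ} (hc : c - 1 / 3 ∈ O3) {u : ℂ} :
    u ∈ fermatPoles ↔ (u - c) / aPt ∈ O3 := by
  rw [mem_fermatPoles_iff, ← add_mem_O3_iff (div_aPt_mem hc) (u := (u - c) / aPt), ← add_div,
    sub_add_sub_cancel]

theorem mul_eq_mul_of_fermatPoles {f g : ℂ → ℂ} {α β c r s : ℂ} (hc : c - 1 / 3 ∈ O3)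
    (hα : ‖α‖ = 1) (hβ : ‖β‖ = 1) (hα1 : α ≠ 1)
    (hf : ∀ u ∉ fermatPoles, DifferentiableAt ℂ f u)
    (hg : ∀ u ∉ fermatPoles, DifferentiableAt ℂ g u)
    (hfr : Tendsto (fun u => u * f (u + c)) (𝓝[≠] 0) (𝓝 r))
    (hgs : Tendsto (fun u => u * g (u + c)) (𝓝[≠] 0) (𝓝 s))
    (hf1 : ∀ u, f (u + aPt) = α * f u) (hg1 : ∀ u, g (u + aPt) = α * g u)
    (hf2 : ∀ u, f (u + ρ3 * aPt) = β * f u) (hg2 : ∀ u, g (u + ρ3 * aPt) = β * g u) {u : ℂ}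
    (hu : u ∉ fermatPoles) : s * f u = r * g u := by
  have h := fun u => (mem_fermatPoles_iff_sub hc (u := u)).not
  exact mul_eq_mul_of_quasiPeriodic hα hβ hα1 aPt_ne_zero (fun u hu => hf u ((h u).2 hu))
    (fun u hu => hg u ((h u).2 hu)) hfr hgs (fun u _ => hf1 u) (fun u _ => hg1 u)
    (fun u _ => hf2 u) (fun u _ => hg2 u) ((h u).1 hu)

end

section

namespace SplitPrime

variable {p : ℕ} {π : ℂ} {a b : ℤ} (h : SplitPrime p π a b)
include h

theorem sum_range_add {M : Type*} [AddCommMonoid M] {G : ℂ → M}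
    (hG : ∀ z, ∀ w ∈ O3, G (z + π * w) = G z) {ν : ℂ} (hν : ν ∈ O3) :
    ∑ s ∈ Finset.range p, G (s + ν) = ∑ s ∈ Finset.range p, G s := by
  have hk : ∀ k : ℕ, ∑ s ∈ Finset.range p, G (s + k) = ∑ s ∈ Finset.range p, G s := by
    intro k
    induction k with
    | zero => simp
    | succ k ih =>
      rw [← ih]
      have e : ∀ s : ℕ, G (s + (k + 1 : ℕ)) = G ((s + 1 : ℕ) + k) := fun s => by
        congr 1; push_cast; ring
      rw [Finset.sum_congr rfl fun s _ => e s]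
      have h1 := Finset.sum_range_succ (fun s : ℕ => G (s + k)) p
      have h2 := Finset.sum_range_succ' (fun s : ℕ => G (s + k)) p
      have h3 : G (p + k) = G ((0 : ℕ) + k) := by
        rw [Nat.cast_zero, zero_add, add_comm, h.norm, hG _ _ (conj_mem_O3 h.mem)]
      obtain ⟨q, hq⟩ : ∃ q, p = q + 1 := Nat.exists_eq_succ_of_ne_zero h.prime.ne_zero
      rw [hq, Finset.sum_range_succ, Finset.sum_range_succ']
      congr 1
      rw [← h3, hq]
  obtain ⟨k, -, w, hw, e⟩ := h.exists_nat_congr hν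
  rw [← hk k]
  refine Finset.sum_congr rfl fun s _ => ?_
  rw [← hG (s + k) w hw]
  congr 1
  linear_combination e

theorem prod_range_add {M : Type*} [CommMonoid M] {G : ℂ → M}
    (hG : ∀ z, ∀ w ∈ O3, G (z + π * w) = G z) {ν : ℂ} (hν : ν ∈ O3) :
    ∏ s ∈ Finset.range p, G (s + ν) = ∏ s ∈ Finset.range p, G s :=
  h.sum_range_add (M := Additive M) hG hν

theorem prod_range_eq {M : Type*} [CommMonoid M] (g : ℕ → M) :
    ∏ s ∈ Finset.range p, g s = g 0 * ∏ s ∈ Finset.Icc 1 (p - 1), g s := by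
  have := h.prime.pos
  have e : Finset.range p = insert 0 (Finset.Icc 1 (p - 1)) := by
    ext k; simp only [Finset.mem_range, Finset.mem_insert, Finset.mem_Icc]; omega
  rw [e, Finset.prod_insert (by simp)]

theorem dvd_of_mul_sqrt_mem (h3 : p % 3 = 1) {s : ℕ} (hs : (s / π : ℂ) / aPt ∈ O3) : p ∣ s := by
  obtain ⟨n, hn⟩ := exists_normSq_eq hs
  have e : (s : ℂ) * (1 + 2 * ρ3) = (s / π : ℂ) / aPt * π := by
    rw [div_aPt]; field_simp [h.ne_zero]
  have e2 : 3 * (s : ℂ) ^ 2 = n * p := by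
    have h1 : ((s / π : ℂ) / aPt) * (starRingEnd ℂ) ((s / π : ℂ) / aPt) = n := by
      rw [Complex.mul_conj, hn]; simp
    have h2 := congrArg (starRingEnd ℂ) e
    rw [map_mul, map_mul, conj_one_add_two_rho3, map_natCast] at h2
    rw [← h1, h.norm]
    have h4 : 3 * (s : ℂ) ^ 2 = (s * (1 + 2 * ρ3)) * (s * -(1 + 2 * ρ3)) := by
      linear_combination 4 * (s : ℂ) ^ 2 * rho3_sq_add
    rw [h4, e, h2]; ring
  have e3 : (3 * s ^ 2 : ℤ) = n * p := by exact_mod_cast e2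
  have hd : (p : ℤ) ∣ ((3 * s ^ 2 : ℕ) : ℤ) := ⟨n, by push_cast; linarith⟩
  rcases (h.prime.dvd_mul).1 (Int.natCast_dvd_natCast.1 hd) with h' | h'
  · have := (Nat.prime_dvd_prime_iff_eq h.prime Nat.prime_three).1 h'
    omega
  · exact h.prime.dvd_of_dvd_pow h'

theorem div_notMem_fermatPoles (hprim : ECong π 1 3) {s : ℂ} (hs : s ∈ O3) :
    s / π ∉ fermatPoles := by
  intro hm
  obtain ⟨d, hd, e⟩ := hprim
  rw [mem_fermatPoles_iff] at hm
  have h0 := h.ne_zero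
  have e1 : aPt = -(s / aPt) + d / aPt + π * ((s / π - 1 / 3) / aPt) := by
    have h1 : π * (s / π - 1 / 3) = s - π / 3 := by field_simp
    rw [← mul_div_assoc, h1, ← neg_div, ← add_div, ← add_div,
      show -s + d + (s - π / 3) = -(1 / 3) by linear_combination (-1 / 3 : ℂ) * e, div_aPt, aPt]
    ring
  refine aPt_notMem ?_
  rw [e1]
  exact add_mem (add_mem (neg_mem (div_aPt_mem hs)) (div_aPt_mem hd)) (mul_mem h.mem hm)

theorem div_add_notMem_fermatPoles {u : ℂ} (hu : u ∉ fermatPoles) (hprim : ECong π 1 3) {s : ℂ}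
    (hs : s ∈ O3) : (u + s) / π ∉ fermatPoles := by
  obtain ⟨d, hd, e⟩ := hprim
  intro hm
  have h0 := h.ne_zero
  rw [mem_fermatPoles_iff] at hm hu
  refine hu ?_
  have h1 : π * ((u + s) / π - 1 / 3) = u + s - π / 3 := by field_simp
  have e1 : (u - 1 / 3) / aPt = π * (((u + s) / π - 1 / 3) / aPt) - s / aPt + d / aPt := by
    rw [← mul_div_assoc, h1, ← sub_div, ← add_div]
    congr 1
    linear_combination (1 / 3 : ℂ) * e
  rw [e1]
  exact add_mem (sub_mem (mul_mem h.mem hm) (div_aPt_mem hs)) (div_aPt_mem hd)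

end SplitPrime
end

section

theorem norm_rho3 : ‖ρ3‖ = 1 := by
  have := congrArg norm rho3_cube
  rw [norm_pow, norm_one] at this
  exact (pow_eq_one_iff_of_nonneg (norm_nonneg _) (by norm_num)).1 this

theorem tendsto_mul_phiE_div_add_third {π : ℂ} (hπ : π ≠ 0) :
    Tendsto (fun u => u * phiE (u / π + 1 / 3)) (𝓝[≠] 0) (𝓝 (π * (3 * fermatScale : ℂ)⁻¹)) := by
  have ht : Tendsto (fun u : ℂ => u / π) (𝓝[≠] 0) (𝓝[≠] 0) := by
    refine tendsto_nhdsWithin_iff.2 ⟨?_, ?_⟩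
    · have : ContinuousAt (fun u : ℂ => u / π) 0 := by fun_prop
      simpa using this.tendsto.mono_left nhdsWithin_le_nhds
    · filter_upwards [self_mem_nhdsWithin] with u hu using div_ne_zero hu hπ
  refine ((tendsto_mul_phiE_add_third.comp ht).const_mul π).congr fun u => ?_
  simp only [Function.comp]
  rw [← mul_assoc, mul_div_cancel₀ _ hπ]

theorem tendsto_mul_phiE_add {c : ℂ} (hc : c - 1 / 3 ∈ O3) :
    Tendsto (fun u => u * phiE (u + c)) (𝓝[≠] 0) (𝓝 (3 * fermatScale : ℂ)⁻¹) := by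
  refine tendsto_mul_phiE_add_third.congr fun u => ?_
  rw [← phiE_add hc (u + 1 / 3)]
  congr 2; ring

namespace SplitPrime

variable {p : ℕ} {π : ℂ} {a b : ℤ} (h : SplitPrime p π a b)
include h

theorem differentiableAt_phiE_div {u : ℂ} (hu : u ∉ fermatPoles) (hprim : ECong π 1 3) {s : ℂ}
    (hs : s ∈ O3) : DifferentiableAt ℂ (fun v => phiE ((v + s) / π)) u :=
  (hasDerivAt_phiE (h.div_add_notMem_fermatPoles hu hprim hs)).differentiableAt.comp
    (f := fun v => (v + s) / π) u (by fun_prop)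

theorem div_add_third_notMem_fermatPoles (h3 : p % 3 = 1) {s : ℕ} (hs : s ∈ Finset.Icc 1 (p - 1)) :
    (s / π + 1 / 3 : ℂ) ∉ fermatPoles := by
  rw [mem_fermatPoles_iff, add_sub_cancel_right]
  intro hm
  have := Nat.le_of_dvd (Finset.mem_Icc.1 hs).1 (h.dvd_of_mul_sqrt_mem h3 hm)
  have := Finset.mem_Icc.1 hs
  omega

theorem differentiableAt_phiE_div_third (h3 : p % 3 = 1) {s : ℕ} (hs : s ∈ Finset.Icc 1 (p - 1)) :
    DifferentiableAt ℂ (fun v => phiE ((v + π / 3 + s) / π)) 0 := by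
  have e : (0 + π / 3 + s) / π = s / π + 1 / 3 := by field_simp [h.ne_zero]; ring
  refine (hasDerivAt_phiE ?_).differentiableAt.comp (f := fun v => (v + π / 3 + s) / π) 0
    (by fun_prop)
  rw [e]
  exact h.div_add_third_notMem_fermatPoles h3 hs

theorem phiE_div_add_aPt {d w : ℂ} (e : π - 1 = 3 * d)
    (hw : ∀ u, phiE (u + w * aPt) = ρ3 ^ 2 * phiE u) (u s : ℂ) :
    phiE ((u + w * aPt + s) / π) = ρ3 ^ 2 * phiE ((u + (s + w * ((1 + 2 * ρ3) * d))) / π) := by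
  rw [← hw]
  congr 1
  have h0 := h.ne_zero
  field_simp
  rw [aPt]
  linear_combination w * (1 + 2 * ρ3) / 3 * e

theorem prod_phiE_add {d w : ℂ} (h3 : p % 3 = 1) (e : π - 1 = 3 * d) (hd : d ∈ O3) (hwO : w ∈ O3)
    (hw : ∀ u, phiE (u + w * aPt) = ρ3 ^ 2 * phiE u) (u : ℂ) :
    ∏ s ∈ Finset.range p, phiE ((u + w * aPt + s) / π) =
      ρ3 ^ 2 * ∏ s ∈ Finset.range p, phiE ((u + s) / π) := by
  rw [Finset.prod_congr rfl fun (s : ℕ) _ => h.phiE_div_add_aPt e hw u s, Finset.prod_mul_distrib,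
    Finset.prod_const, Finset.card_range]
  congr 1
  · obtain ⟨k, rfl⟩ : ∃ k, p = 3 * k + 1 := ⟨p / 3, by omega⟩
    rw [← pow_mul, show 2 * (3 * k + 1) = 3 * (2 * k) + 2 by ring, pow_add, pow_mul, rho3_cube,
      one_pow, one_mul]
  · refine h.prod_range_add (G := fun s => phiE ((u + s) / π)) (fun z v hv => ?_)
      (mul_mem hwO (mul_mem (mem_O3_iff.2 ⟨1, 2, by push_cast; ring⟩) hd))
    rw [← phiE_add hv ((u + z) / π)]
    congr 1
    have h0 := h.ne_zero
    field_simp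
    ring

theorem phiE_div_ne_zero (h3 : p % 3 = 1) (hprim : ECong π 1 3) {s : ℕ}
    (hs : s ∈ Finset.Icc 1 (p - 1)) : phiE (s / π) ≠ 0 := by
  intro h0
  have h1 := h.div_notMem_fermatPoles hprim (natCast_mem O3 s)
  have h2 := h.div_add_third_notMem_fermatPoles h3 hs
  have h4 := phiE_add_third_mul h1 h2
  have h5 := phiE_cube_sub h1
  rw [h0, mul_zero] at h4
  rw [h0, ← h4] at h5
  norm_num at h5

theorem prod_phiE_eq (h3 : p % 3 = 1) (hprim : ECong π 1 3) {u : ℂ} (hu : u ∉ fermatPoles) :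
    ∏ s ∈ Finset.range p, phiE ((u + s) / π) =
      π * (∏ s ∈ Finset.Icc 1 (p - 1), psiE (s / π) / phiE (s / π)) * phiE u := by
  have h0 := h.ne_zero
  have hk := fermatScale_ne_zero
  obtain ⟨d, hd, e⟩ := id hprim
  have hc : π / 3 - 1 / 3 ∈ O3 := by
    rwa [show π / 3 - 1 / 3 = d by linear_combination (1 / 3 : ℂ) * e]
  have key := mul_eq_mul_of_fermatPoles (c := π / 3) (α := ρ3 ^ 2) (β := ρ3 ^ 2)
    (f := fun u => ∏ s ∈ Finset.range p, phiE ((u + s) / π)) (g := phiE)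
    (r := π * (3 * fermatScale : ℂ)⁻¹ *
      ∏ s ∈ Finset.Icc 1 (p - 1), psiE (s / π) / phiE (s / π))
    (s := (3 * fermatScale : ℂ)⁻¹) hc (by simp [norm_rho3]) (by simp [norm_rho3])
    ?_ ?_ (fun u hu => (hasDerivAt_phiE hu).differentiableAt) ?_ (tendsto_mul_phiE_add hc)
    ?_ phiE_add_aPt ?_ phiE_add_rho_mul_aPt hu
  · have : (3 * fermatScale : ℂ)⁻¹ ≠ 0 := by simp [hk]
    refine mul_left_cancel₀ this (key.trans ?_)
    ring
  · intro h1
    exact rho3_ne_one (by linear_combination rho3_cube - ρ3 * h1)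
  · intro u hu
    exact DifferentiableAt.fun_finsetProd fun s _ =>
      h.differentiableAt_phiE_div hu hprim (natCast_mem O3 s)
  · have h1 : Tendsto (fun u : ℂ => ∏ s ∈ Finset.Icc 1 (p - 1), phiE ((u + π / 3 + s) / π))
        (𝓝[≠] 0) (𝓝 (∏ s ∈ Finset.Icc 1 (p - 1), psiE (s / π) / phiE (s / π))) := by
      refine tendsto_finsetProd _ fun s hs => ?_
      have h2 := (h.differentiableAt_phiE_div_third h3 hs).continuousAt.tendsto.mono_left
        (nhdsWithin_le_nhds (s := {0}ᶜ))
      have h4 : (0 + π / 3 + s) / π = s / π + 1 / 3 := by field_simp; ring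
      rw [h4] at h2
      rwa [← phiE_add_third_mul (h.div_notMem_fermatPoles hprim (natCast_mem O3 s))
        (h.div_add_third_notMem_fermatPoles h3 hs),
        mul_div_cancel_right₀ _ (h.phiE_div_ne_zero h3 hprim hs)]
    refine ((tendsto_mul_phiE_div_add_third h0).mul h1).congr fun u => ?_
    rw [h.prod_range_eq (fun s => phiE ((u + π / 3 + s) / π)), mul_assoc, Nat.cast_zero, add_zero,
      add_div, div_div_cancel_left' h0, one_div]
  · intro u
    simpa using h.prod_phiE_add h3 e hd (one_mem O3) (by simpa using phiE_add_aPt) u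
  · exact h.prod_phiE_add h3 e hd rho3_mem phiE_add_rho_mul_aPt

theorem exists_prod_phiE (h3 : p % 3 = 1) (hprim : ECong π 1 3) : ∃ F : ℂ, F ^ 3 = 1 ∧
    ∏ s ∈ Finset.Icc 1 (p - 1), phiE (s / π) = π * F ∧
      F * ∏ s ∈ Finset.Icc 1 (p - 1), psiE (s / π) = 1 := by
  have h0 := h.ne_zero
  have hk := fermatScale_ne_zero
  obtain ⟨d, hd, e⟩ := id hprim
  set F := π * ∏ s ∈ Finset.Icc 1 (p - 1), psiE (s / π) / phiE (s / π) with hF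
  set X := ∏ s ∈ Finset.Icc 1 (p - 1), phiE (s / π) with hX
  set Y := ∏ s ∈ Finset.Icc 1 (p - 1), psiE (s / π) with hY
  have hX0 : X ≠ 0 := Finset.prod_ne_zero_iff.2 fun s hs => h.phiE_div_ne_zero h3 hprim hs
  have h1 : F * X = π * Y := by
    rw [hF, Finset.prod_div_distrib, mul_assoc, div_mul_cancel₀ _ hX0]
  have h2 : X = π * F := by
    have hz := notMem_fermatPoles_of_mem (zero_mem O3)
    have d1 : HasDerivAt (fun u => phiE (u / π)) (-3 * fermatScale * psiE 0 ^ 2 * π⁻¹) 0 := by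
      have := (hasDerivAt_id (0 : ℂ)).div_const π
      rw [one_div] at this
      refine HasDerivAt.comp (h₂ := phiE) 0 ?_ this
      simpa using hasDerivAt_phiE hz
    have d2 : DifferentiableAt ℂ (fun u : ℂ => ∏ s ∈ Finset.Icc 1 (p - 1), phiE ((u + s) / π)) 0 :=
      DifferentiableAt.fun_finsetProd fun s _ =>
        h.differentiableAt_phiE_div hz hprim (natCast_mem O3 s)
    have d3 := d1.fun_mul d2.hasDerivAt
    have d4 := (hasDerivAt_phiE hz).const_mul F
    have hev : (fun u => phiE (u / π) * ∏ s ∈ Finset.Icc 1 (p - 1), phiE ((u + s) / π)) =ᶠ[𝓝 0]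
        fun u => F * phiE u := by
      have := eventually_nhdsWithin_iff.1 (eventually_notMem_fermatPoles 0)
      filter_upwards [this] with u hu
      have hu' : u ∉ fermatPoles := by
        by_cases hu0 : u = 0
        · rwa [hu0]
        · exact hu hu0
      rw [hF, ← h.prod_phiE_eq h3 hprim hu', h.prod_range_eq (fun s => phiE ((u + s) / π)),
        Nat.cast_zero, add_zero]
    have d5 := d3.unique (d4.congr_of_eventuallyEq hev)
    rw [psiE_of_mem (zero_mem O3)] at d5
    simp only [zero_add, zero_div, phiE_zero, zero_mul, add_zero, ← hX] at d5
    field_simp at d5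
    linear_combination -d5
  have h4 : F * Y = 1 := by
    have h5 := h.prod_phiE_eq h3 hprim neg_third_notMem_fermatPoles
    rw [phiE_neg_third, mul_one, ← hF] at h5
    have h6 := h.prod_range_add (G := fun s => phiE (s / π - 1 / 3)) (fun z v hv => by
      rw [← phiE_add hv (z / π - 1 / 3)]
      congr 1; field_simp; ring) hd
    have h7 : ∀ s : ℕ, phiE ((s + d) / π - 1 / 3) = phiE ((-(1 / 3) + s) / π) := fun s => by
      congr 1; field_simp; linear_combination -e
    simp only [h7] at h6
    rw [h5, h.prod_range_eq (fun s : ℕ => phiE (s / π - 1 / 3)), Nat.cast_zero, zero_div, zero_sub,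
      phiE_neg_third, one_mul] at h6
    have hns : ∀ s : ℕ, -(s / π : ℂ) ∉ fermatPoles := fun s => by
      rw [← neg_div]
      exact h.div_notMem_fermatPoles hprim (neg_mem (natCast_mem O3 s))
    have h8 : ∀ s ∈ Finset.Icc 1 (p - 1), phiE (s / π - 1 / 3) * psiE (s / π) = -1 := by
      intro s _
      have hn := h.div_notMem_fermatPoles hprim (natCast_mem O3 s)
      have hy : psiE (s / π) ≠ 0 := fun hy => hns s (neg_mem_fermatPoles_of_psiE_eq_zero hn hy)
      have := phiE_sub_third hn (hns s) ?_
      · rw [this]; field_simp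
      · intro hm
        refine hns s ?_
        rw [mem_fermatPoles_iff] at hm ⊢
        have e9 : (-(s / π) - 1 / 3 : ℂ) / aPt = -((s / π - 1 / 3 - 1 / 3) / aPt) - 1 / aPt := by
          ring
        rw [e9]
        exact sub_mem (neg_mem hm) (div_aPt_mem (one_mem _))
    have h9 := Finset.prod_congr rfl h8
    rw [Finset.prod_mul_distrib, Finset.prod_const, Nat.card_Icc, ← h6] at h9
    rw [h9]
    have hodd : Odd p := h.prime.odd_of_ne_two (by omega)
    refine Even.neg_one_pow ?_
    rw [add_tsub_cancel_right]
    exact hodd.tsub_odd odd_one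
  refine ⟨F, ?_, h2, h4⟩
  have h5 : F ^ 2 = Y := by
    rw [h2] at h1
    exact mul_left_cancel₀ h0 (by linear_combination h1)
  rw [pow_succ, h5, mul_comm, h4]

end SplitPrime
end

noncomputable section

/-- The infinite product `∏ (1 - q ^ k w)` over `k ≥ 1`. -/
def qProd (q w : ℂ) : ℂ := ∏' k : ℕ, (1 + -(q ^ (k + 1) * w))

theorem summable_norm_qProd {q : ℂ} (hq : ‖q‖ < 1) (w : ℂ) :
    Summable fun k : ℕ => ‖-(q ^ (k + 1) * w)‖ := by
  simp only [norm_neg, norm_mul, norm_pow]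
  exact ((summable_nat_add_iff 1).mpr
    (summable_geometric_of_lt_one (norm_nonneg _) hq)).mul_right _

theorem differentiable_qProd {q : ℂ} (hq : ‖q‖ < 1) : Differentiable ℂ (qProd q) := by
  have : HasProdLocallyUniformlyOn (fun (k : ℕ) (w : ℂ) => 1 + -(q ^ (k + 1) * w))
      (fun w => ∏' k : ℕ, (1 + -(q ^ (k + 1) * w))) Set.univ := by
    refine hasProdLocallyUniformlyOn_of_forall_compact isOpen_univ fun K _ hK => ?_
    obtain ⟨C, hC⟩ := hK.isBounded.exists_norm_le
    refine (((summable_nat_add_iff 1).mpr (summable_geometric_of_lt_one (norm_nonneg _)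
      hq)).mul_right C).hasProdUniformlyOn_nat_one_add hK (.of_forall fun n x hx => ?_)
      fun _ => by fun_prop
    rw [norm_neg, norm_mul, norm_pow]
    gcongr
    exact hC x hx
  exact differentiableOn_univ.1 (this.differentiableOn
    (.of_forall fun _ => by simpa [Finset.prod_fn] using
      DifferentiableOn.finsetProd (fun _ _ => by fun_prop)) isOpen_univ)

theorem qProd_eq {q : ℂ} (hq : ‖q‖ < 1) (w : ℂ) : qProd q w = (1 - q * w) * qProd q (q * w) := by
  have e : ∀ k : ℕ, 1 + -(q ^ (k + 1) * (q * w)) = 1 + -(q ^ (k + 1 + 1) * w) := fun k => by ring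
  have h := multipliable_one_add_of_summable (summable_norm_qProd hq (q * w))
  simp only [e] at h
  rw [qProd, tprod_eq_zero_mul' (f := fun k : ℕ => 1 + -(q ^ (k + 1) * w)) h, qProd]
  simp only [e]
  ring

theorem qProd_ne_zero {q w : ℂ} (hq : ‖q‖ < 1) (h : ∀ k : ℕ, q ^ (k + 1) * w ≠ 1) :
    qProd q w ≠ 0 :=
  tprod_one_add_ne_zero_of_summable (fun k e => h k (by linear_combination -e))
    (summable_norm_qProd hq w)

/-- The nome `exp (2πiρ)`. -/
def nomeE : ℂ := exp (2 * Real.pi * I * ρ3)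

theorem rho3_im_pos : 0 < ρ3.im := by
  rw [rho3_eq]
  simp

theorem norm_nomeE : ‖nomeE‖ < 1 := by
  have := UpperHalfPlane.norm_exp_two_pi_I_lt_one ⟨ρ3, rho3_im_pos⟩
  exact this

/-- The theta function of the lattice `ℤ[ρ]`, as a triple product. -/
def thetaE (V : ℂ) : ℂ :=
  (1 - exp (2 * Real.pi * I * V)) * qProd nomeE (exp (2 * Real.pi * I * V)) *
    qProd nomeE (exp (-(2 * Real.pi * I * V)))

theorem differentiable_thetaE : Differentiable ℂ thetaE := by
  have h := differentiable_qProd norm_nomeE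
  unfold thetaE
  exact ((by fun_prop : Differentiable ℂ fun V : ℂ => 1 - exp (2 * Real.pi * I * V)).mul
    (h.comp (by fun_prop))).mul (h.comp (by fun_prop))

theorem thetaE_add_one (V : ℂ) : thetaE (V + 1) = thetaE V := by
  have h1 : exp (2 * Real.pi * I * (V + 1)) = exp (2 * Real.pi * I * V) := by
    rw [mul_add, mul_one, exp_add, exp_two_pi_mul_I, mul_one]
  have h2 : exp (-(2 * Real.pi * I * (V + 1))) = exp (-(2 * Real.pi * I * V)) := by
    rw [exp_neg, h1, exp_neg]
  rw [thetaE, h1, h2, thetaE]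

theorem thetaE_add_rho (V : ℂ) :
    thetaE (V + ρ3) = -exp (-(2 * Real.pi * I * V)) * thetaE V := by
  set w := exp (2 * Real.pi * I * V) with hw
  have hw0 : w ≠ 0 := exp_ne_zero _
  have hq0 : nomeE ≠ 0 := exp_ne_zero _
  have hn : exp (-(2 * Real.pi * I * V)) = w⁻¹ := exp_neg _
  have h1 : exp (2 * Real.pi * I * (V + ρ3)) = nomeE * w := by
    rw [mul_add, exp_add, mul_comm]; rfl
  have h2 : exp (-(2 * Real.pi * I * (V + ρ3))) = nomeE⁻¹ * w⁻¹ := by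
    rw [exp_neg, h1, mul_inv]
  have e1 := qProd_eq norm_nomeE w
  have e2 := qProd_eq norm_nomeE (nomeE⁻¹ * w⁻¹)
  rw [mul_inv_cancel_left₀ hq0] at e2
  rw [thetaE, thetaE, h1, h2, hn, ← hw, e2, e1]
  field_simp
  ring

theorem thetaE_neg (V : ℂ) : thetaE (-V) = -exp (-(2 * Real.pi * I * V)) * thetaE V := by
  have hw0 : exp (2 * Real.pi * I * V) ≠ 0 := exp_ne_zero _
  rw [thetaE, thetaE, mul_neg, neg_neg, exp_neg]
  field_simp
  ring

theorem thetaE_ne_zero {V : ℂ} (hV : V ∉ O3) : thetaE V ≠ 0 := by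
  have key : ∀ k m : ℤ, ∀ V : ℂ, V ∉ O3 → 2 * Real.pi * I * (k * ρ3 + V) ≠ m * (2 * Real.pi * I) :=
    fun k m V hV h => hV <| by
      have : V = m - k * ρ3 := mul_left_cancel₀ two_pi_I_ne_zero (by linear_combination h)
      rw [this]
      exact sub_mem (intCast_mem _ m) (mul_mem (intCast_mem _ k) rho3_mem)
  have hq : ∀ V : ℂ, V ∉ O3 → qProd nomeE (exp (2 * Real.pi * I * V)) ≠ 0 := fun V hV =>
    qProd_ne_zero norm_nomeE fun k e => by
      rw [nomeE, ← exp_nat_mul, ← exp_add, exp_eq_one_iff] at e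
      obtain ⟨m, e⟩ := e
      refine key (k + 1) m V hV ?_
      push_cast at e ⊢
      linear_combination e
  refine mul_ne_zero (mul_ne_zero ?_ (hq V hV)) ?_
  · rw [sub_ne_zero]
    intro e
    obtain ⟨m, e⟩ := exp_eq_one_iff.1 e.symm
    exact key 0 m V hV (by push_cast; linear_combination e)
  · rw [← mul_neg]
    exact hq (-V) fun h => hV (by simpa using neg_mem h)

theorem thetaE_zero : thetaE 0 = 0 := by simp [thetaE]

theorem exists_tendsto_div_thetaE {c : ℂ} (hc : c ≠ 0) :
    ∃ L : ℂ, L ≠ 0 ∧ Tendsto (fun u => u / thetaE (c * u)) (𝓝[≠] 0) (𝓝 L) := by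
  have hQ : qProd nomeE 1 ≠ 0 := qProd_ne_zero norm_nomeE fun k e => by
    have h1 := congrArg norm e
    rw [mul_one, norm_pow, norm_one] at h1
    exact (pow_lt_one₀ (norm_nonneg _) norm_nomeE k.succ_ne_zero).ne h1
  have hd : HasDerivAt (fun u => thetaE (c * u))
      (-(2 * Real.pi * I * c) * qProd nomeE 1 * qProd nomeE 1) 0 := by
    have he : HasDerivAt (fun u : ℂ => 1 - exp (2 * Real.pi * I * (c * u)))
        (-(2 * Real.pi * I * c)) 0 := by
      have := ((((hasDerivAt_id (0 : ℂ)).const_mul c).const_mul (2 * Real.pi * I)).cexp).const_sub 1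
      simpa [mul_assoc] using this
    have h := differentiable_qProd norm_nomeE
    have h1 : DifferentiableAt ℂ (fun u : ℂ => qProd nomeE (exp (2 * Real.pi * I * (c * u)))) 0 :=
      (h _).comp (0 : ℂ) (by fun_prop)
    have h2 : DifferentiableAt ℂ (fun u : ℂ => qProd nomeE (exp (-(2 * Real.pi * I * (c * u))))) 0 :=
      (h _).comp (0 : ℂ) (by fun_prop)
    have := (he.mul h1.hasDerivAt).mul h2.hasDerivAt
    exact this.congr_deriv (by simp)
  have hne : -(2 * Real.pi * I * c) * qProd nomeE 1 * qProd nomeE 1 ≠ 0 :=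
    mul_ne_zero (mul_ne_zero (neg_ne_zero.2 (mul_ne_zero two_pi_I_ne_zero hc)) hQ) hQ
  refine ⟨_, inv_ne_zero hne, ((hasDerivAt_iff_tendsto_slope.1 hd).inv₀ hne).congr fun u => ?_⟩
  simp [slope_def_field, thetaE_zero]

end

noncomputable section

/-- The additive character `z ↦ exp (2πim √-3 (z/π - conj (z/π)))`. -/
def latticeChar (π : ℂ) (m : ℕ) (z : ℂ) : ℂ :=
  exp (2 * Real.pi * I * m * ((1 + 2 * ρ3) * (z / π - (starRingEnd ℂ) (z / π))))

theorem latticeChar_add (π : ℂ) (m : ℕ) (z w : ℂ) :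
    latticeChar π m (z + w) = latticeChar π m z * latticeChar π m w := by
  rw [latticeChar, latticeChar, latticeChar, ← exp_add, add_div, map_add]
  congr 1; ring

theorem latticeChar_zero (π : ℂ) (m : ℕ) : latticeChar π m 0 = 1 := by simp [latticeChar]

theorem latticeChar_ne_zero (π : ℂ) (m : ℕ) (z : ℂ) : latticeChar π m z ≠ 0 := exp_ne_zero _

theorem norm_latticeChar (π : ℂ) (m : ℕ) (z : ℂ) : ‖latticeChar π m z‖ = 1 := by
  rw [latticeChar, norm_exp, Real.exp_eq_one_iff]
  set e := 2 * Real.pi * I * m * ((1 + 2 * ρ3) * (z / π - (starRingEnd ℂ) (z / π))) with he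
  have h : (starRingEnd ℂ) e = -e := by
    rw [he]
    simp only [map_mul (starRingEnd ℂ) _ ((1 + 2 * ρ3) * _), map_mul (starRingEnd ℂ) (1 + 2 * ρ3),
      map_sub, conj_one_add_two_rho3, conj_conj]
    simp only [map_mul, conj_I, conj_ofReal, map_natCast, map_ofNat]
    ring
  have := congrArg re h
  rw [conj_re, neg_re] at this
  linarith

/-- A quotient of translates of `thetaE ((1 + 2ρ) u)` with the same poles as `phiE`. -/
def thetaQuot (g z u : ℂ) : ℂ :=
  exp (g * ((1 + 2 * ρ3) * u)) * (thetaE ((1 + 2 * ρ3) * u - z) /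
    thetaE ((1 + 2 * ρ3) * u - (1 + 2 * ρ3) / 3))

theorem sub_third_mem_iff {u : ℂ} :
    (1 + 2 * ρ3) * u - (1 + 2 * ρ3) / 3 ∈ O3 ↔ u ∈ fermatPoles := by
  rw [mem_fermatPoles_iff, div_aPt]
  ring_nf

theorem differentiableAt_thetaQuot (g z : ℂ) {u : ℂ} (hu : u ∉ fermatPoles) :
    DifferentiableAt ℂ (thetaQuot g z) u := by
  have h : ∀ c : ℂ, DifferentiableAt ℂ (fun u => thetaE ((1 + 2 * ρ3) * u - c)) u := fun c =>
    (differentiable_thetaE _).comp u (by fun_prop)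
  exact (by fun_prop : DifferentiableAt ℂ (fun u => exp (g * ((1 + 2 * ρ3) * u))) u).mul
    ((h z).div (h _) (thetaE_ne_zero (mt sub_third_mem_iff.1 hu)))

theorem thetaQuot_add_aPt (g z u : ℂ) :
    thetaQuot g z (u + aPt) = exp g * thetaQuot g z u := by
  have e : (1 + 2 * ρ3) * (u + aPt) = (1 + 2 * ρ3) * u + 1 := by linear_combination aPt_mul
  rw [thetaQuot, thetaQuot, e, mul_add, mul_one, exp_add, add_sub_right_comm, add_sub_right_comm,
    thetaE_add_one, thetaE_add_one]
  ring

theorem thetaQuot_add_rho_mul_aPt (g z u : ℂ) :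
    thetaQuot g z (u + ρ3 * aPt) =
      exp (g * ρ3 + 2 * Real.pi * I * (z - (1 + 2 * ρ3) / 3)) * thetaQuot g z u := by
  have e : (1 + 2 * ρ3) * (u + ρ3 * aPt) = (1 + 2 * ρ3) * u + ρ3 := by
    linear_combination ρ3 * aPt_mul
  have e2 : exp (2 * Real.pi * I * (z - (1 + 2 * ρ3) / 3)) =
      (-exp (-(2 * Real.pi * I * ((1 + 2 * ρ3) * u - z)))) /
        (-exp (-(2 * Real.pi * I * ((1 + 2 * ρ3) * u - (1 + 2 * ρ3) / 3)))) := by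
    rw [neg_div_neg_eq, ← exp_sub]
    congr 1; ring
  rw [thetaQuot, thetaQuot, e, mul_add, exp_add, exp_add, add_sub_right_comm, add_sub_right_comm,
    thetaE_add_rho, thetaE_add_rho, mul_div_mul_comm, e2]
  ring

theorem tendsto_mul_thetaQuot {L : ℂ}
    (hL : Tendsto (fun u => u / thetaE ((1 + 2 * ρ3) * u)) (𝓝[≠] 0) (𝓝 L)) (g z : ℂ) :
    Tendsto (fun u => u * thetaQuot g z (u + 1 / 3)) (𝓝[≠] 0)
      (𝓝 (exp (g * ((1 + 2 * ρ3) / 3)) * thetaE ((1 + 2 * ρ3) / 3 - z) * L)) := by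
  have h : Tendsto (fun u => exp (g * ((1 + 2 * ρ3) * (u + 1 / 3))) *
      thetaE ((1 + 2 * ρ3) * (u + 1 / 3) - z)) (𝓝[≠] 0)
      (𝓝 (exp (g * ((1 + 2 * ρ3) / 3)) * thetaE ((1 + 2 * ρ3) / 3 - z))) := by
    have hc : Continuous fun u => exp (g * ((1 + 2 * ρ3) * (u + 1 / 3))) *
        thetaE ((1 + 2 * ρ3) * (u + 1 / 3) - z) :=
      (by fun_prop : Continuous fun u => exp (g * ((1 + 2 * ρ3) * (u + 1 / 3)))).mul
        (differentiable_thetaE.continuous.comp (by fun_prop))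
    have := (hc.tendsto 0).mono_left (nhdsWithin_le_nhds (s := {0}ᶜ))
    simpa only [zero_add, mul_one_div] using this
  refine (h.mul hL).congr fun u => ?_
  rw [thetaQuot, show (1 + 2 * ρ3) * (u + 1 / 3) - (1 + 2 * ρ3) / 3 = (1 + 2 * ρ3) * u by ring]
  ring

theorem exp_four_pi_I_div_three : exp (4 * Real.pi * I / 3) = ρ3 ^ 2 := by
  rw [ρ3, ← exp_nat_mul]
  congr 1; push_cast; ring

theorem rho3_sq_eq_exp : exp (-(2 * Real.pi * I / 3)) = ρ3 ^ 2 := by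
  rw [exp_neg, ← ρ3, inv_eq_iff_eq_inv]
  exact eq_inv_of_mul_eq_one_left (by linear_combination rho3_cube)

theorem rho3_sq_ne_one : ρ3 ^ 2 ≠ 1 := fun e => by
  have h1 : ρ3 = 1 := by linear_combination rho3_cube - ρ3 * e
  have h2 := rho3_sq_add
  rw [h1] at h2
  norm_num at h2

/-- The theta quotient expression of `phiE`. -/
theorem phiE_eq_thetaQuot {L : ℂ}
    (hL : Tendsto (fun u => u / thetaE ((1 + 2 * ρ3) * u)) (𝓝[≠] 0) (𝓝 L)) {u : ℂ}
    (hu : u ∉ fermatPoles) :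
    exp (4 * Real.pi * I / 3 * ((1 + 2 * ρ3) / 3)) * thetaE ((1 + 2 * ρ3) / 3) * L * phiE u =
      (3 * fermatScale : ℂ)⁻¹ * thetaQuot (4 * Real.pi * I / 3) 0 u := by
  have hα : ‖ρ3 ^ 2‖ = 1 := by rw [norm_pow, norm_rho3, one_pow]
  have := tendsto_mul_thetaQuot hL (4 * Real.pi * I / 3) 0
  rw [sub_zero] at this
  refine mul_eq_mul_of_fermatPoles (c := 1 / 3) (by rw [sub_self]; exact zero_mem _) hα hα rho3_sq_ne_one
    (fun u hu => (hasDerivAt_phiE hu).differentiableAt)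
    (fun u hu => differentiableAt_thetaQuot _ _ hu) tendsto_mul_phiE_add_third this
    phiE_add_aPt (fun u => ?_) phiE_add_rho_mul_aPt (fun u => ?_) hu
  · rw [thetaQuot_add_aPt, exp_four_pi_I_div_three]
  · rw [thetaQuot_add_rho_mul_aPt, ← rho3_sq_eq_exp]
    congr 2; ring

end

noncomputable section

/-- The twisted trace of `phiE` from the period lattice `πO3` to `O3`. -/
def twistedTrace (p : ℕ) (π : ℂ) (m : ℕ) (u : ℂ) : ℂ :=
  ∑ s ∈ Finset.range p, latticeChar π m s * phiE ((u + s) / π)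

namespace SplitPrime

variable {p : ℕ} {π : ℂ} {a b : ℤ} (h : SplitPrime p π a b)
include h

theorem conj : SplitPrime p ((starRingEnd ℂ) π) (a - b) (-b) where
  prime := h.prime
  norm := by rw [conj_conj, mul_comm]; exact h.norm
  eq := by
    rw [h.eq]
    simp only [map_add, map_mul, map_intCast, conj_rho3]
    push_cast
    linear_combination (b : ℂ) * rho3_sq_add

theorem sub_conj : π - (starRingEnd ℂ) π = b * (1 + 2 * ρ3) := by
  rw [h.conj.eq]
  nth_rw 1 [h.eq]
  push_cast; ring

theorem latticeChar_mul (m : ℕ) {w : ℂ} (hw : w ∈ O3) : latticeChar π m (π * w) = 1 := by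
  obtain ⟨r, s, rfl⟩ := mem_O3_iff.1 hw
  rw [latticeChar, mul_div_cancel_left₀ _ h.ne_zero, exp_eq_one_iff]
  refine ⟨-(3 * m * s), ?_⟩
  simp only [map_add, map_mul, map_intCast, conj_rho3]
  push_cast
  linear_combination (2 * Real.pi * I * m) * s * (3 - 2 * ρ3) * rho3_sq_add

theorem latticeChar_natCast (m s : ℕ) :
    latticeChar π m s = exp (2 * Real.pi * I * (3 * b * m * s) / p) := by
  have h0 := h.ne_zero
  have h0' := h.conj.ne_zero
  have e := h.sub_conj
  rw [latticeChar, h.norm, map_div₀, map_natCast]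
  congr 1
  field_simp
  linear_combination (-(m * s : ℂ) * (1 + 2 * ρ3)) * e - (m * s : ℂ) * b * 4 * rho3_sq_add

theorem latticeChar_sqrt_mul {d : ℂ} (m : ℕ) (e : π - 1 = 3 * d) {w : ℂ} (hw : w ∈ O3) :
    latticeChar π m (w * ((1 + 2 * ρ3) * d)) =
      exp (2 * Real.pi * I * m * (w / π + (starRingEnd ℂ) w / (starRingEnd ℂ) π)) := by
  have h0 := h.ne_zero
  have h0' := h.conj.ne_zero
  have ec := congrArg (starRingEnd ℂ) e
  rw [map_sub, map_one, map_mul, map_ofNat] at ec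
  obtain ⟨r, s, hrs⟩ := mem_O3_iff.1 hw
  have hn : w + (starRingEnd ℂ) w = (2 * r - s : ℤ) := by
    rw [hrs]
    simp only [map_add, map_mul, map_intCast, conj_rho3]
    push_cast
    linear_combination (s : ℂ) * rho3_sq_add
  rw [latticeChar, exp_eq_exp_iff_exists_int]
  refine ⟨-(m * (2 * r - s)), ?_⟩
  have e1 : (1 + 2 * ρ3) * (w * ((1 + 2 * ρ3) * d) / π -
      (starRingEnd ℂ) (w * ((1 + 2 * ρ3) * d) / π)) =
      (w / π + (starRingEnd ℂ) w / (starRingEnd ℂ) π) - (w + (starRingEnd ℂ) w) := by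
    rw [map_div₀, map_mul, map_mul, conj_one_add_two_rho3]
    field_simp
    linear_combination (4 * (w * d * (starRingEnd ℂ) π + (starRingEnd ℂ) w * (starRingEnd ℂ) d * π)) *
      rho3_sq_add + w * (starRingEnd ℂ) π * e + (starRingEnd ℂ) w * π * ec
  rw [e1, hn]
  push_cast; ring

theorem twistedTrace_eq (m : ℕ) {ν : ℂ} (hν : ν ∈ O3) (u : ℂ) :
    ∑ s ∈ Finset.range p, latticeChar π m s * phiE ((u + (s + ν)) / π) =
      (latticeChar π m ν)⁻¹ * twistedTrace p π m u := by
  have := h.sum_range_add (G := fun z => latticeChar π m z * phiE ((u + z) / π)) (fun z w hw => by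
    rw [latticeChar_add, h.latticeChar_mul m hw, mul_one, ← add_assoc, add_div,
      mul_div_cancel_left₀ _ h.ne_zero, phiE_add hw]) hν
  rw [twistedTrace, ← this, Finset.mul_sum]
  refine Finset.sum_congr rfl fun s _ => ?_
  rw [latticeChar_add]
  field_simp [latticeChar_ne_zero π m ν]

theorem twistedTrace_add_aPt {d w : ℂ} (m : ℕ) (e : π - 1 = 3 * d) (hd : d ∈ O3) (hwO : w ∈ O3)
    (hw : ∀ u, phiE (u + w * aPt) = ρ3 ^ 2 * phiE u) (u : ℂ) :
    twistedTrace p π m (u + w * aPt) =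
      ρ3 ^ 2 * (latticeChar π m (w * ((1 + 2 * ρ3) * d)))⁻¹ * twistedTrace p π m u := by
  rw [mul_assoc, ← h.twistedTrace_eq m (mul_mem hwO (mul_mem (add_mem (one_mem _) (mul_mem
    (ofNat_mem O3 2) rho3_mem)) hd)), twistedTrace, Finset.mul_sum]
  refine Finset.sum_congr rfl fun s _ => ?_
  rw [h.phiE_div_add_aPt e hw]
  ring

theorem twistedTrace_add_third {d : ℂ} (m : ℕ) (e : π - 1 = 3 * d) (hd : d ∈ O3) (u : ℂ) :
    twistedTrace p π m (u + 1 / 3) = latticeChar π m d * twistedTrace p π m (u + π / 3) := by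
  have h1 := h.twistedTrace_eq m hd (u + 1 / 3)
  rw [eq_inv_mul_iff_mul_eq₀ (latticeChar_ne_zero π m d)] at h1
  rw [← h1, twistedTrace]
  congr 1
  refine Finset.sum_congr rfl fun s _ => ?_
  congr 3
  linear_combination (-1 / 3 : ℂ) * e

theorem tendsto_mul_twistedTrace (h3 : p % 3 = 1) {d : ℂ} (m : ℕ) (e : π - 1 = 3 * d)
    (hd : d ∈ O3) : Tendsto (fun u => u * twistedTrace p π m (u + 1 / 3)) (𝓝[≠] 0)
      (𝓝 (latticeChar π m d * (π * (3 * fermatScale : ℂ)⁻¹))) := by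
  have h0 := h.ne_zero
  obtain ⟨q, hq⟩ : ∃ q, p = q + 1 := Nat.exists_eq_succ_of_ne_zero h.prime.ne_zero
  have hs : ∀ s ∈ Finset.range q, Tendsto (fun u => u * (latticeChar π m (s + 1 : ℕ) *
      phiE ((u + π / 3 + (s + 1 : ℕ)) / π))) (𝓝[≠] 0) (𝓝 0) := fun s hs => by
    have hc := (h.differentiableAt_phiE_div_third h3 (s := s + 1)
      (by simp only [Finset.mem_Icc, Finset.mem_range] at *; omega)).continuousAt
    have := (continuousAt_id.fun_mul (hc.const_mul (latticeChar π m (s + 1 : ℕ)))).tendsto.mono_left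
      (nhdsWithin_le_nhds (s := {0}ᶜ))
    simpa using this
  have h1 := (tendsto_finsetSum _ hs).add (tendsto_mul_phiE_div_add_third h0)
  rw [Finset.sum_const_zero, zero_add] at h1
  refine (h1.const_mul (latticeChar π m d)).congr fun u => ?_
  rw [h.twistedTrace_add_third m e hd, twistedTrace, hq, Finset.sum_range_succ', Nat.cast_zero,
    add_zero, add_div, div_right_comm π 3 π, div_self h0, latticeChar_zero, ← Finset.mul_sum]
  ring

theorem mul_latticeChar_ne_one (h3 : p % 3 = 1) (m : ℕ) {ν : ℂ} (hν : ν ∈ O3) :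
    ρ3 ^ 2 * (latticeChar π m ν)⁻¹ ≠ 1 := fun e => by
  have hp : ∀ k : ℕ, latticeChar π m (k * ν) = latticeChar π m ν ^ k := fun k => by
    induction k with
    | zero => simp [latticeChar_zero]
    | succ k ih => rw [Nat.cast_succ, add_mul, one_mul, latticeChar_add, ih, pow_succ]
  have h1 := hp p
  rw [h.norm, mul_assoc, h.latticeChar_mul m (mul_mem (conj_mem_O3 h.mem) hν)] at h1
  rw [mul_inv_eq_one₀ (latticeChar_ne_zero π m ν)] at e
  rw [← e, ← Nat.div_add_mod p 3, h3, ← pow_mul, mul_add, ← mul_assoc, mul_comm 2 3, mul_assoc,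
    pow_add, pow_mul, rho3_cube, one_pow, one_mul] at h1
  exact rho3_sq_ne_one h1.symm

/-- The twisted trace is a quotient of theta functions. -/
theorem twistedTrace_eq_thetaQuot (h3 : p % 3 = 1) (hprim : ECong π 1 3) {d : ℂ}
    (e : π - 1 = 3 * d) (hd : d ∈ O3) (m : ℕ) {L g z : ℂ}
    (hL : Tendsto (fun u => u / thetaE ((1 + 2 * ρ3) * u)) (𝓝[≠] 0) (𝓝 L))
    (hg : g = 4 * Real.pi * I / 3 - 2 * Real.pi * I * m * (1 / π + 1 / (starRingEnd ℂ) π))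
    (hz : z = (1 + 2 * ρ3) * m / (starRingEnd ℂ) π) {u : ℂ} (hu : u ∉ fermatPoles) :
    exp (g * ((1 + 2 * ρ3) / 3)) * thetaE ((1 + 2 * ρ3) / 3 - z) * L * twistedTrace p π m u =
      latticeChar π m d * (π * (3 * fermatScale : ℂ)⁻¹) * thetaQuot g z u := by
  have hn : ∀ ν, ‖ρ3 ^ 2 * (latticeChar π m ν)⁻¹‖ = 1 := fun ν => by
    rw [norm_mul, norm_inv, norm_latticeChar, norm_pow, norm_rho3, one_pow, inv_one, one_mul]
  have hsO : (1 + 2 * ρ3) * d ∈ O3 :=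
    mul_mem (add_mem (one_mem _) (mul_mem (ofNat_mem O3 2) rho3_mem)) hd
  have hc : (starRingEnd ℂ) ρ3 = -1 - ρ3 := by rw [conj_rho3]; linear_combination rho3_sq_add
  refine mul_eq_mul_of_fermatPoles (c := 1 / 3) (by rw [sub_self]; exact zero_mem _)
    (hn (1 * ((1 + 2 * ρ3) * d))) (hn (ρ3 * ((1 + 2 * ρ3) * d)))
    (h.mul_latticeChar_ne_one h3 m (by rwa [one_mul])) (fun u hu => ?_)
    (fun u hu => differentiableAt_thetaQuot _ _ hu) (h.tendsto_mul_twistedTrace h3 m e hd)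
    (tendsto_mul_thetaQuot hL g z) (fun u => ?_) (fun u => ?_)
    (h.twistedTrace_add_aPt m e hd rho3_mem phiE_add_rho_mul_aPt) (fun u => ?_) hu
  · exact DifferentiableAt.fun_sum fun s _ =>
      (h.differentiableAt_phiE_div hu hprim (natCast_mem O3 s)).const_mul _
  · have := h.twistedTrace_add_aPt m e hd (one_mem _) (by simpa using phiE_add_aPt) u
    rwa [one_mul aPt] at this
  · rw [thetaQuot_add_aPt, h.latticeChar_sqrt_mul m e (one_mem _), map_one, hg, exp_sub,
      exp_four_pi_I_div_three, div_eq_mul_inv]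
  · rw [thetaQuot_add_rho_mul_aPt, h.latticeChar_sqrt_mul m e rho3_mem, hc, ← exp_neg,
      ← rho3_sq_eq_exp, ← exp_add]
    congr 2
    rw [hg, hz]
    ring

theorem sum_latticeChar_mul_phiE (h3 : p % 3 = 1) (hprim : ECong π 1 3) (m : ℕ) :
    ∑ s ∈ Finset.range p, exp (2 * Real.pi * I * (3 * b * m * s) / p) * phiE (s / π) =
      -π * phiE (m / (starRingEnd ℂ) π) := by
  have h0 := h.ne_zero
  have h0' := h.conj.ne_zero
  obtain ⟨d, hd, e⟩ := id hprim
  have ec := congrArg (starRingEnd ℂ) e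
  rw [map_sub, map_one, map_mul, map_ofNat] at ec
  have hs0 : (1 + 2 * ρ3) ≠ 0 := right_ne_zero_of_mul_eq_one aPt_mul
  obtain ⟨L, hL0, hL⟩ := exists_tendsto_div_thetaE hs0
  have hprim' : ECong ((starRingEnd ℂ) π) 1 3 := ⟨_, conj_mem_O3 hd, ec⟩
  have hm := h.conj.div_notMem_fermatPoles hprim' (natCast_mem O3 m)
  have hz0 : (0 : ℂ) ∉ fermatPoles := notMem_fermatPoles_of_mem (zero_mem _)
  have k1 := h.twistedTrace_eq_thetaQuot h3 hprim e hd m hL rfl rfl hz0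
  have k2 := phiE_eq_thetaQuot hL hm
  have hM : ∑ s ∈ Finset.range p, exp (2 * Real.pi * I * (3 * b * m * s) / p) * phiE (s / π) =
      twistedTrace p π m 0 := by
    refine Finset.sum_congr rfl fun s _ => ?_
    rw [h.latticeChar_natCast, zero_add]
  rw [hM]
  set g := 4 * Real.pi * I / 3 - 2 * Real.pi * I * m * (1 / π + 1 / (starRingEnd ℂ) π) with hg
  set t := (1 + 2 * ρ3) / 3 with ht
  set z := (1 + 2 * ρ3) * m / (starRingEnd ℂ) π with hz
  have hzm : (1 + 2 * ρ3) * (m / (starRingEnd ℂ) π) = z := by rw [hz, mul_div_assoc]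
  have n1 : thetaE (z - t) ≠ 0 := by
    rw [← hzm]
    exact thetaE_ne_zero (mt sub_third_mem_iff.1 hm)
  have n2 : thetaE t ≠ 0 := fun h' => by
    refine thetaE_ne_zero (V := -t) ?_ ?_
    · have := mt sub_third_mem_iff.1 hz0
      rwa [mul_zero, zero_sub] at this
    · rw [thetaE_neg, h', mul_zero]
  rw [thetaQuot, mul_zero, mul_zero, exp_zero, one_mul, zero_sub, zero_sub, thetaE_neg z,
    thetaE_neg t, ← neg_sub z t, thetaE_neg (z - t)] at k1
  rw [thetaQuot, hzm, sub_zero] at k2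
  have hph : latticeChar π m d * exp (4 * Real.pi * I / 3 * t) =
      exp (g * t) * exp (4 * Real.pi * I / 3 * z) := by
    rw [latticeChar, ← exp_add, ← exp_add, map_div₀, hg, hz, ht]
    congr 1
    field_simp
    linear_combination (-6 * m * (starRingEnd ℂ) π) * e + 6 * m * π * ec
  have hzt : exp (-(2 * Real.pi * I * z)) =
      exp (-(2 * Real.pi * I * (z - t))) * exp (-(2 * Real.pi * I * t)) := by
    rw [← exp_add]; congr 1; ring
  rw [hzt] at k1
  have x1 := exp_ne_zero (-(2 * Real.pi * I * (z - t)))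
  have x2 := exp_ne_zero (-(2 * Real.pi * I * t))
  have x3 := exp_ne_zero (g * t)
  have x4 := exp_ne_zero (4 * Real.pi * I / 3 * t)
  generalize (3 * fermatScale : ℂ)⁻¹ = κ at k1 k2
  generalize exp (-(2 * Real.pi * I * (z - t))) = b₁ at *
  generalize exp (-(2 * Real.pi * I * t)) = b₂ at *
  generalize exp (g * t) = b₃ at *
  generalize exp (4 * Real.pi * I / 3 * t) = b₄ at *
  generalize exp (4 * Real.pi * I / 3 * z) = b₅ at *
  generalize thetaE t = θ₁ at *
  generalize thetaE (z - t) = θ₂ at *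
  rw [neg_mul, neg_mul (b₁ * b₂), neg_mul b₂, neg_div_neg_eq] at k1
  have k1' : b₃ * θ₁ * θ₂ * L * twistedTrace p π m 0 = -(latticeChar π m d * π * κ * thetaE z) := by
    field_simp at k1
    linear_combination -k1
  have k2' : b₄ * θ₁ * θ₂ * L * phiE (m / (starRingEnd ℂ) π) = κ * b₅ * thetaE z := by
    field_simp at k2
    linear_combination k2
  refine mul_left_cancel₀ (mul_ne_zero (mul_ne_zero (mul_ne_zero (mul_ne_zero x3 x4) n1) n2) hL0) ?_
  linear_combination b₄ * k1' + π * b₃ * k2' - π * κ * thetaE z * hph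

end SplitPrime
end

section

theorem SplitPrime.torsionData {p : ℕ} {π : ℂ} {a b : ℤ} (h : SplitPrime p π a b)
    (h3 : p % 3 = 1) (hprim : ECong π 1 3) :
    TorsionData p π b phiE fun s => psiE (s / π) where
  group := by
    have hs : ∀ s : ℕ, (s / π : ℂ) ∉ fermatPoles := fun s =>
      h.div_notMem_fermatPoles hprim (natCast_mem O3 s)
    have hp : ∀ s : ℕ, ((s + p : ℕ) / π : ℂ) = s / π + (starRingEnd ℂ) π := fun s => by
      rw [Nat.cast_add, add_div, h.norm, mul_div_cancel_left₀ _ h.ne_zero]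
    have ha : ∀ r s : ℕ, ((r + s : ℕ) / π : ℂ) = r / π + s / π := fun r s => by
      rw [Nat.cast_add, add_div]
    exact
      { curve := fun s => phiE_cube_sub (hs s)
        x_zero := by simpa using phiE_zero
        y_zero := by simpa using psiE_of_mem (zero_mem O3)
        x_period := fun s => by
          simp only [hp]
          exact phiE_add (conj_mem_O3 h.mem) _
        y_period := fun s => by
          simp only [hp]
          exact psiE_add (conj_mem_O3 h.mem) _
        x_add := fun r s => by
          have := hs (r + s)
          simp only [ha] at *
          exact phiE_add_formula (hs r) (hs s) this
        y_add := fun r s => by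
          have := hs (r + s)
          simp only [ha] at *
          exact psiE_add_formula (hs r) (hs s) this }
  period u w hw := phiE_add hw u
  rotate := phiE_rho
  conj u := (phiE_conj u).symm
  prod := h.exists_prod_phiE h3 hprim
  fourier := h.sum_latticeChar_mul_phiE h3 hprim

end

/-- **Lemma I.6 (`G₃`-formula; Cassels–Matthews).** Let `π ∈ ℤ[ρ]` be a primary prime
with `p = π·π̄`. Then the cubic Gauss sum satisfies `G₃(π) = −χ_π(3)·π̃²·π̃̄`, where
`π̃̄` denotes the complex conjugate of the canonical cubic root `π̃` of `π`. -/
theorem stmt_10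
    (p : ℕ) (hp : p.Prime) (hp3 : p % 3 = 1)
    (π : ℂ) (hπ : π ∈ O3) (hprimary : ECong π 1 3)
    (hnorm : (p : ℂ) = π * (starRingEnd ℂ) π)
    (χ : ℂ → ℂ) (hχ : IsCubicChar π p χ)
    (S : Finset ℂ) (hS : IsThirdSet π S)
    (γ : ℂ) (hγ : IsGamma3 π S γ)
    (πt : ℂ) (hπt : πt = γ⁻¹ * ∏ ν ∈ S, phi3 (ν / π)) :
    G3sum p χ = -(χ 3) * πt ^ 2 * (starRingEnd ℂ) πt := by
  obtain ⟨a, b, hab⟩ := mem_O3_iff.1 hπ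
  have h : SplitPrime p π a b := ⟨hp, hnorm, hab⟩
  rw [phi3_eq] at hπt
  exact h.G3sum_eq_of_torsionData hp3 hprimary hχ hS hγ (h.torsionData hp3 hprimary) hπt

end
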